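/- arXiv:2411.04391 — 3 statements merged into one kernel-verified Lean document; each statement's English description precedes it below -/
import Mathlib

section
/- For every chore instance with n ≥ 2 agents having additive positive cost functions v_1,…,v_n over a finite set M of chores, there exists an allocation, i.e., a partition (A_1,…,A_n) of M, such that v_i(A_i) ≤ MMS^{⌊9n/11⌋}(v_i, M) for every agent i. (Existence of 1-out-of-⌊9n/11⌋ maximin-share allocations.) -/
open Finset

variable {α : Type*} [DecidableEq α]

/-- The total cost of a bundle `S` of chores under the additive cost function `v`. -/
def bundleCost (v : α → ℚ) (S : Finset α) : ℚ := ∑ c ∈ S, v c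

/-- `P` is a partition of `M` into `d` (possibly empty) bundles. -/
def IsPartitionInto (M : Finset α) (d : ℕ) (P : Fin d → Finset α) : Prop :=
  (∀ j, P j ⊆ M) ∧ (∀ j k, j ≠ k → Disjoint (P j) (P k)) ∧ ∀ c ∈ M, ∃ j, c ∈ P j

/-- `μ` is the `d`-maximin share `MMS^d(v, M)`: the minimum, over all partitions of `M`
into `d` bundles, of the maximum bundle cost. -/
def IsMMS (v : α → ℚ) (M : Finset α) (d : ℕ) (μ : ℚ) : Prop :=
  (∃ P : Fin d → Finset α, IsPartitionInto M d P ∧ ∀ j, bundleCost v (P j) ≤ μ) ∧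
    ∀ P : Fin d → Finset α, IsPartitionInto M d P → ∃ j, μ ≤ bundleCost v (P j)


structure FInst (v : ℕ → ℚ) (V : Finset ℕ) (c : ℕ) (g h : ℕ → ℕ) (D N : Finset ℕ) : Prop where
  cV : c ∈ V
  cmax : ∀ e ∈ V, e ≤ c
  anti : ∀ e ∈ V, ∀ f ∈ V, e ≤ f → v f ≤ v e
  pos : 0 < v c
  gD : ∀ e ∈ V, g e ∈ D
  gsum : ∀ l ∈ D, ∑ e ∈ V.filter (fun e => g e = l), v e ≤ 1
  hN : ∀ e ∈ V, e ≠ c → h e ∈ N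
  hc : ∀ k ∈ N, k < h c
  ff : ∀ k ∈ N, ∀ e ∈ V, k < h e → 1 < ∑ f ∈ V.filter (fun f => h f = k ∧ f < e), v f + v e

namespace FInst
variable {v : ℕ → ℚ} {V : Finset ℕ} {c : ℕ} {g h : ℕ → ℕ} {D N : Finset ℕ}

theorem ge_s (I : FInst v V c g h D N) {e : ℕ} (he : e ∈ V) : v c ≤ v e :=
  I.anti e he c I.cV (I.cmax e he)

theorem vpos (I : FInst v V c g h D N) {e : ℕ} (he : e ∈ V) : 0 < v e :=
  lt_of_lt_of_le I.pos (I.ge_s he)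

theorem le_one (I : FInst v V c g h D N) {e : ℕ} (he : e ∈ V) : v e ≤ 1 := by
  refine le_trans ?_ (I.gsum (g e) (I.gD e he))
  exact Finset.single_le_sum (f := v) (fun i hi => (I.vpos (mem_filter.1 hi).1).le)
    (by simp [he])

theorem ff_sub (k k' : ℕ) (hk : k' ≠ k) (e : ℕ) :
    (V.filter (fun e => h e ≠ k)).filter (fun f => h f = k' ∧ f < e)
      = V.filter (fun f => h f = k' ∧ f < e) := by
  ext f
  simp only [mem_filter]
  constructor
  · rintro ⟨⟨h1, _⟩, h2⟩; exact ⟨h1, h2⟩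
  · rintro ⟨h1, h2, h3⟩; exact ⟨⟨h1, by omega⟩, h2, h3⟩

theorem remove0 (I : FInst v V c g h D N) {k l : ℕ} (hk : k ∈ N)
    (H : ∀ e ∈ V, h e ≠ k → g e ≠ l) :
    FInst v (V.filter (fun e => h e ≠ k)) c g h (D.erase l) (N.erase k) where
  cV := by
    have := I.hc k hk
    simp only [mem_filter]; exact ⟨I.cV, by omega⟩
  cmax e he := I.cmax e (mem_filter.1 he).1
  anti e he f hf := I.anti e (mem_filter.1 he).1 f (mem_filter.1 hf).1
  pos := I.pos
  gD e he := by
    rw [mem_filter] at he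
    exact mem_erase.2 ⟨H e he.1 he.2, I.gD e he.1⟩
  gsum l' hl' := by
    refine le_trans ?_ (I.gsum l' (mem_of_mem_erase hl'))
    refine Finset.sum_le_sum_of_subset_of_nonneg ?_ (fun i hi _ => (I.vpos (mem_filter.1 hi).1).le)
    exact filter_subset_filter _ (filter_subset _ _)
  hN e he hec := by
    rw [mem_filter] at he
    exact mem_erase.2 ⟨he.2, I.hN e he.1 hec⟩
  hc k' hk' := I.hc k' (mem_of_mem_erase hk')
  ff k' hk' e he hlt := by
    rw [ff_sub k k' (ne_of_mem_erase hk')]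
    exact I.ff k' (mem_of_mem_erase hk') e (mem_filter.1 he).1 hlt

theorem remove1 (I : FInst v V c g h D N) {k l z b : ℕ} (hk : k ∈ N)
    (hz : z ∈ V) (hb : b ∈ V) (hbk : h b = k) (hbl : g b ≠ l) (hzb : v z ≤ v b)
    (H : ∀ e ∈ V, h e ≠ k → g e = l → e = z) :
    FInst v (V.filter (fun e => h e ≠ k)) c (Function.update g z (g b)) h (D.erase l) (N.erase k) where
  cV := by
    have := I.hc k hk
    simp only [mem_filter]; exact ⟨I.cV, by omega⟩
  cmax e he := I.cmax e (mem_filter.1 he).1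
  anti e he f hf := I.anti e (mem_filter.1 he).1 f (mem_filter.1 hf).1
  pos := I.pos
  gD e he := by
    rw [mem_filter] at he
    by_cases hez : e = z
    · subst hez; simp [hbl, I.gD b hb]
    · rw [Function.update_of_ne hez]
      exact mem_erase.2 ⟨fun h' => hez (H e he.1 he.2 h'), I.gD e he.1⟩
  gsum l' hl' := by
    refine le_trans ?_ (I.gsum l' (mem_of_mem_erase hl'))
    by_cases hl : g b = l'
    · have hbm : b ∈ V.filter (fun e => g e = l') := by simp [hb, hl]
      rw [← Finset.add_sum_erase _ _ hbm]
      by_cases hzz : z ∈ (V.filter (fun e => g e = l')).erase b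
      · refine le_trans (Finset.sum_le_sum_of_subset_of_nonneg
          (t := (V.filter (fun e => g e = l')).erase b) ?_ ?_) ?_
        · intro e he
          simp only [mem_filter] at he
          by_cases hez : e = z
          · subst hez; exact hzz
          · rw [Function.update_of_ne hez] at he
            simp only [mem_erase, mem_filter]
            exact ⟨fun h' => he.1.2 (h' ▸ hbk), he.1.1, he.2⟩
        · intro i hi _
          exact (I.vpos (mem_filter.1 (mem_of_mem_erase hi)).1).le
        · have := I.vpos hb; linarith
      · refine le_trans (Finset.sum_le_sum_of_subset_of_nonneg
          (t := insert z ((V.filter (fun e => g e = l')).erase b)) ?_ ?_) ?_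
        · intro e he
          simp only [mem_filter] at he
          by_cases hez : e = z
          · subst hez; simp
          · rw [Function.update_of_ne hez] at he
            simp only [mem_insert, mem_erase, mem_filter]
            exact Or.inr ⟨fun h' => he.1.2 (h' ▸ hbk), he.1.1, he.2⟩
        · intro i hi _
          rcases mem_insert.1 hi with rfl | hi
          · exact (I.vpos hz).le
          · exact (I.vpos (mem_filter.1 (mem_of_mem_erase hi)).1).le
        · rw [Finset.sum_insert hzz]; linarith
    · refine Finset.sum_le_sum_of_subset_of_nonneg ?_ (fun i hi _ => (I.vpos (mem_filter.1 hi).1).le)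
      intro e he
      simp only [mem_filter] at he ⊢
      by_cases hez : e = z
      · subst hez; simp at he; exact absurd he.2 hl
      · rw [Function.update_of_ne hez] at he
        exact ⟨he.1.1, he.2⟩
  hN e he hec := by
    rw [mem_filter] at he
    exact mem_erase.2 ⟨he.2, I.hN e he.1 hec⟩
  hc k' hk' := I.hc k' (mem_of_mem_erase hk')
  ff k' hk' e he hlt := by
    rw [ff_sub k k' (ne_of_mem_erase hk')]
    exact I.ff k' (mem_of_mem_erase hk') e (mem_filter.1 he).1 hlt

/-- If an optimal bin has at most two items, we can reduce. -/
theorem reduce (I : FInst v V c g h D N) (hN0 : N.Nonempty) {l : ℕ} (hl : l ∈ D)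
    (hcard : (V.filter (fun e => g e = l)).card ≤ 2) :
    ∃ V' g' k, k ∈ N ∧ FInst v V' c g' h (D.erase l) (N.erase k) := by
  -- every bin is nonempty
  have hne : ∀ k ∈ N, ∀ e ∈ V, k < h e → v e < 1 →
      ∃ b ∈ V, h b = k ∧ b < e := by
    intro k hk e he hlt hv1
    have := I.ff k hk e he hlt
    by_contra hcon
    push Not at hcon
    have h0 : V.filter (fun f => h f = k ∧ f < e) = ∅ := by
      ext f; simp only [mem_filter, notMem_empty, iff_false, not_and, not_lt]
      intro hf hfk; exact hcon f hf hfk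
    rw [h0] at this; simp at this; linarith
  have hpair : ∀ x ∈ V, ∀ y ∈ V, x < y → g x = l → g y = l → v x + v y ≤ 1 := by
    intro x hx y hy hxy gx gy
    refine le_trans ?_ (I.gsum l hl)
    rw [← Finset.sum_pair (f := v) hxy.ne]
    refine Finset.sum_le_sum_of_subset_of_nonneg ?_ (fun i hi _ => (I.vpos (mem_filter.1 hi).1).le)
    intro e he
    simp only [mem_insert, mem_singleton] at he
    rcases he with rfl | rfl <;> simp [*]
  obtain ⟨k0, hk0⟩ := hN0
  rcases Nat.lt_or_ge (V.filter (fun e => g e = l)).card 2 with h1 | h2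
  · rcases Finset.card_le_one_iff_subset_singleton.1 (Nat.le_of_lt_succ h1) with ⟨x, hx⟩
    have hx' : ∀ e ∈ V, g e = l → e = x := fun e he hge => by
      have : e ∈ V.filter (fun e => g e = l) := by simp [he, hge]
      simpa using hx this
    by_cases hxV : x ∈ V ∧ x ≠ c ∧ g x = l
    · refine ⟨_, _, h x, I.hN x hxV.1 hxV.2.1, I.remove0 (l := l) (I.hN x hxV.1 hxV.2.1) ?_⟩
      intro e he hek hge
      exact hek (by rw [hx' e he hge])
    · by_cases hcl : g c = l
      · -- only c in the bin
        by_cases hc1 : v c < 1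
        · obtain ⟨b, hb, hbk, hbc⟩ := hne k0 hk0 c I.cV (I.hc k0 hk0) hc1
          refine ⟨_, _, k0, hk0, I.remove1 (l := l) (z := c) (b := b) hk0 I.cV hb hbk ?_ (I.ge_s hb) ?_⟩
          · intro hgb
            have := hx' b hb hgb; have := hx' c I.cV hcl; omega
          · intro e he _ hge
            rw [hx' e he hge, hx' c I.cV hcl]
        · -- v c = 1
          have hsum := I.ff k0 hk0 c I.cV (I.hc k0 hk0)
          have h1 := I.le_one I.cV
          have hpos : 0 < ∑ f ∈ V.filter (fun f => h f = k0 ∧ f < c), v f := by linarith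
          obtain ⟨b, hb⟩ : (V.filter (fun f => h f = k0 ∧ f < c)).Nonempty := by
            by_contra hcon
            rw [not_nonempty_iff_eq_empty] at hcon
            rw [hcon] at hpos; simp at hpos
          simp only [mem_filter] at hb
          refine ⟨_, _, k0, hk0, I.remove1 (l := l) (z := c) (b := b) hk0 I.cV hb.1 hb.2.1 ?_ (I.ge_s hb.1) ?_⟩
          · intro hgb
            have := hx' b hb.1 hgb; have := hx' c I.cV hcl; omega
          · intro e he _ hge
            rw [hx' e he hge, hx' c I.cV hcl]
      · refine ⟨_, _, k0, hk0, I.remove0 (l := l) hk0 ?_⟩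
        intro e he _ hge
        have := hx' e he hge
        subst this
        exact hxV ⟨he, fun h' => hcl (h' ▸ hge), hge⟩
  · have h2' : (V.filter (fun e => g e = l)).card = 2 := le_antisymm hcard h2
    obtain ⟨x, y, hxy, hS⟩ : ∃ x y, x < y ∧ V.filter (fun e => g e = l) = {x, y} := by
      obtain ⟨x, y, hne, hS⟩ := Finset.card_eq_two.1 h2'
      rcases lt_or_gt_of_ne hne with h' | h'
      · exact ⟨x, y, h', hS⟩
      · exact ⟨y, x, h', by rw [hS, pair_comm]⟩
    have hxm : x ∈ V.filter (fun e => g e = l) := by rw [hS]; simp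
    have hym : y ∈ V.filter (fun e => g e = l) := by rw [hS]; simp
    simp only [mem_filter] at hxm hym
    have hmem : ∀ e ∈ V, g e = l → e = x ∨ e = y := fun e he hge => by
      have : e ∈ V.filter (fun e => g e = l) := by simp [he, hge]
      rw [hS] at this; simpa using this
    have hxc : x ≠ c := by have := I.cmax y hym.1; omega
    have hp := hpair x hxm.1 y hym.1 hxy hxm.2 hym.2
    have hxN := I.hN x hxm.1 hxc
    rcases lt_trichotomy (h x) (h y) with hlt | heq | hgt
    · have hs := I.ff (h x) hxN y hym.1 hlt
      obtain ⟨b, hb, hbx⟩ : ∃ b ∈ V.filter (fun f => h f = h x ∧ f < y), b ≠ x := by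
        by_contra hcon
        push Not at hcon
        have : ∑ f ∈ V.filter (fun f => h f = h x ∧ f < y), v f ≤ ∑ f ∈ ({x} : Finset ℕ), v f := by
          refine Finset.sum_le_sum_of_subset_of_nonneg ?_ ?_
          · intro e he; simpa using hcon e he
          · intro i hi _; rw [mem_singleton] at hi; subst hi; exact (I.vpos hxm.1).le
        simp at this
        linarith
      simp only [mem_filter] at hb
      refine ⟨_, _, h x, hxN, I.remove1 (l := l) (z := y) (b := b) hxN hym.1 hb.1 hb.2.1 ?_
        (I.anti b hb.1 y hym.1 hb.2.2.le) ?_⟩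
      · intro hgb
        rcases hmem b hb.1 hgb with h' | h'
        · exact hbx h'
        · omega
      · intro e he hek hge
        rcases hmem e he hge with rfl | h'
        · exact absurd rfl hek
        · exact h'
    · refine ⟨_, _, h x, hxN, I.remove0 (l := l) hxN ?_⟩
      intro e he hek hge
      rcases hmem e he hge with rfl | rfl
      · exact hek rfl
      · exact hek heq.symm
    · have hyc : y ≠ c := by
        intro h'; subst h'; have := I.hc _ hxN; omega
      have hyN := I.hN y hym.1 hyc
      have hx1 : v x < 1 := by have := I.vpos hym.1; linarith
      obtain ⟨b, hb, hbk, hbx⟩ := hne (h y) hyN x hxm.1 hgt hx1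
      refine ⟨_, _, h y, hyN, I.remove1 (l := l) (z := x) (b := b) hyN hxm.1 hb hbk ?_
        (I.anti b hb x hxm.1 hbx.le) ?_⟩
      · intro hgb
        rcases hmem b hb hgb with h' | h' <;> omega
      · intro e he hek hge
        rcases hmem e he hge with rfl | rfl
        · rfl
        · exact absurd rfl hek

end FInst

/-- it suffices to refute instances with all optimal bins having at least three items -/
theorem FInst.min_reduce
    (key : ∀ (v : ℕ → ℚ) (V : Finset ℕ) (c : ℕ) (g h : ℕ → ℕ) (D N : Finset ℕ),
      FInst v V c g h D N → 11 * D.card ≤ 9 * N.card →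
      (∀ l ∈ D, 3 ≤ (V.filter (fun e => g e = l)).card) → False) :
    ∀ (d : ℕ) (v : ℕ → ℚ) (V : Finset ℕ) (c : ℕ) (g h : ℕ → ℕ) (D N : Finset ℕ),
      FInst v V c g h D N → 11 * D.card ≤ 9 * N.card → D.card = d → False := by
  intro d
  induction d with
  | zero =>
    intro v V c g h D N I _ h0
    have := I.gD c I.cV
    rw [Finset.card_eq_zero.1 h0] at this; simp at this
  | succ d ih =>
    intro v V c g h D N I hdn hD
    by_cases h3 : ∀ l ∈ D, 3 ≤ (V.filter (fun e => g e = l)).card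
    · exact key v V c g h D N I hdn h3
    · push Not at h3
      obtain ⟨l, hl, hlc⟩ := h3
      have hN0 : N.Nonempty := by
        rw [← Finset.card_pos]; omega
      obtain ⟨V', g', k, hk, I'⟩ := I.reduce hN0 hl (by omega)
      have h1 := Finset.card_erase_of_mem hl
      have h2 := Finset.card_erase_of_mem hk
      exact ih v V' c g' h _ _ I' (by omega) (by omega)


structure FRed (v : ℕ → ℚ) (V : Finset ℕ) (c : ℕ) (g h : ℕ → ℕ) (D N : Finset ℕ) (a : ℕ → ℕ) : Prop
    extends FInst v V c g h D N where
  dn : 11 * D.card ≤ 9 * N.card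
  three : ∀ l ∈ D, 3 ≤ (V.filter (fun e => g e = l)).card
  aV : ∀ k ∈ N, a k ∈ V
  ah : ∀ k ∈ N, h (a k) = k
  amin : ∀ k ∈ N, ∀ f ∈ V, h f = k → a k ≤ f

theorem sum_three_le {S : Finset ℕ} {v : ℕ → ℚ} {s : ℚ} (hs : ∀ e ∈ S, s ≤ v e)
    {x : ℕ} (hx : x ∈ S) {m : ℕ} (hS : m + 1 ≤ S.card) (hs0 : 0 ≤ s) :
    v x + m * s ≤ ∑ e ∈ S, v e := by
  rw [← Finset.add_sum_erase _ _ hx]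
  have h1 : (S.erase x).card • s ≤ ∑ e ∈ S.erase x, v e :=
    Finset.card_nsmul_le_sum _ _ _ (fun e he => hs e (mem_of_mem_erase he))
  rw [Finset.card_erase_of_mem hx, nsmul_eq_mul] at h1
  have h2 : (m : ℚ) ≤ ((S.card - 1 : ℕ) : ℚ) := by exact_mod_cast (by omega)
  have := mul_le_mul_of_nonneg_right h2 hs0
  linarith

theorem FInst.toRed {v : ℕ → ℚ} {V : Finset ℕ} {c : ℕ} {g h : ℕ → ℕ} {D N : Finset ℕ}
    (I : FInst v V c g h D N) (dn : 11 * D.card ≤ 9 * N.card)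
    (three : ∀ l ∈ D, 3 ≤ (V.filter (fun e => g e = l)).card) :
    ∃ a, FRed v V c g h D N a := by
  have hc1 : v c + (2:ℕ) * v c ≤ 1 :=
    le_trans (sum_three_le (S := V.filter (fun e => g e = g c))
      (fun e he => I.ge_s (mem_filter.1 he).1) (by simp [I.cV])
      (three _ (I.gD c I.cV)) I.pos.le) (I.gsum _ (I.gD c I.cV))
  have hex : ∀ k, ∃ x, k ∈ N → (x ∈ V ∧ h x = k ∧ ∀ f ∈ V, h f = k → x ≤ f) := by
    intro k
    by_cases hk : k ∈ N
    · have := I.ff k hk c I.cV (I.hc k hk)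
      have hne : (V.filter (fun f => h f = k ∧ f < c)).Nonempty := by
        by_contra hcon
        rw [not_nonempty_iff_eq_empty] at hcon
        rw [hcon] at this; have := I.pos; simp at *; linarith
      have hne2 : (V.filter (fun f => h f = k)).Nonempty := by
        obtain ⟨b, hb⟩ := hne
        simp only [mem_filter] at hb
        exact ⟨b, by simp [hb]⟩
      refine ⟨(V.filter (fun f => h f = k)).min' hne2, fun _ => ?_⟩
      have hm := Finset.min'_mem _ hne2
      refine ⟨(mem_filter.1 hm).1, (mem_filter.1 hm).2, fun f hf hfk => ?_⟩
      exact Finset.min'_le _ _ (by simp [hf, hfk])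
    · exact ⟨0, fun h' => absurd h' hk⟩
  choose a ha using hex
  exact ⟨a, { toFInst := I, dn := dn, three := three, aV := fun k hk => (ha k hk).1,
              ah := fun k hk => (ha k hk).2.1, amin := fun k hk => (ha k hk).2.2 }⟩

/-- sorted enumeration -/
theorem sorted_pop {S : Finset ℕ} {m : ℕ} (hS : S.card = m + 1) :
    ∃ x ∈ S, (S.erase x).card = m ∧ ∀ y ∈ S.erase x, x < y := by
  have hne : S.Nonempty := by rw [← Finset.card_pos]; omega
  refine ⟨S.min' hne, S.min'_mem hne, ?_, ?_⟩
  · rw [Finset.card_erase_of_mem (S.min'_mem hne)]; omega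
  · intro y hy
    exact Finset.min'_lt_of_mem_erase_min' _ hne hy

theorem sum_opt {S : Finset ℕ} {v : ℕ → ℚ} {s C : ℚ} (ω : ℚ → ℚ)
    (hanti : ∀ e ∈ S, ∀ f ∈ S, e ≤ f → v f ≤ v e) (hs : ∀ e ∈ S, s ≤ v e)
    (hhalf : ∀ e ∈ S, v e ≤ 1/2) (hsum : ∑ e ∈ S, v e ≤ 1) (h3 : 3 ≤ S.card) (hs6 : 1/6 < s)
    (O3 : ∀ p q r, p ≤ 1/2 → q ≤ p → r ≤ q → s ≤ r → p + q + r ≤ 1 → ω p + ω q + ω r ≤ C)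
    (O4 : ∀ p q r t, p ≤ 1/2 → q ≤ p → r ≤ q → t ≤ r → s ≤ t → p + q + r + t ≤ 1 →
      ω p + ω q + ω r + ω t ≤ C)
    (O5 : ∀ p q r t u, p ≤ 1/2 → q ≤ p → r ≤ q → t ≤ r → u ≤ t → s ≤ u → p + q + r + t + u ≤ 1 →
      ω p + ω q + ω r + ω t + ω u ≤ C) :
    ∑ e ∈ S, ω (v e) ≤ C := by
  have hc5 : S.card ≤ 5 := by
    by_contra hcon
    have h1 : S.card • s ≤ ∑ e ∈ S, v e := Finset.card_nsmul_le_sum _ _ _ hs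
    rw [nsmul_eq_mul] at h1
    have h2 : (6:ℚ) ≤ (S.card : ℚ) := by exact_mod_cast (by omega)
    nlinarith
  obtain ⟨m, hm⟩ : ∃ m, S.card = m + 1 := ⟨S.card - 1, by omega⟩
  obtain ⟨x1, hx1, c1, l1⟩ := sorted_pop hm
  obtain ⟨m2, rfl⟩ : ∃ m2, m = m2 + 1 := ⟨m - 1, by omega⟩
  obtain ⟨x2, hx2, c2, l2⟩ := sorted_pop c1
  obtain ⟨m3, rfl⟩ : ∃ m3, m2 = m3 + 1 := ⟨m2 - 1, by omega⟩
  obtain ⟨x3, hx3, c3, l3⟩ := sorted_pop c2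
  rw [← Finset.add_sum_erase _ _ hx1, ← Finset.add_sum_erase _ _ hx2, ← Finset.add_sum_erase _ _ hx3] at hsum ⊢
  have m1 := hx1
  have m2 := mem_of_mem_erase hx2
  have m3' := mem_of_mem_erase (mem_of_mem_erase hx3)
  have v12 := hanti x1 m1 x2 m2 (l1 _ hx2).le
  have v23 := hanti x2 m2 x3 m3' (l2 _ hx3).le
  rcases Nat.eq_zero_or_pos m3 with h0 | h0
  · have he : ((S.erase x1).erase x2).erase x3 = ∅ := by rw [← Finset.card_eq_zero]; omega
    rw [he] at hsum ⊢
    simp only [sum_empty] at hsum ⊢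
    have := O3 _ _ _ (hhalf _ m1) v12 v23 (hs _ m3') (by linarith)
    linarith
  · obtain ⟨m4, rfl⟩ : ∃ m4, m3 = m4 + 1 := ⟨m3 - 1, by omega⟩
    obtain ⟨x4, hx4, c4, l4⟩ := sorted_pop c3
    have m4' := mem_of_mem_erase (mem_of_mem_erase (mem_of_mem_erase hx4))
    have v34 := hanti x3 m3' x4 m4' (l3 _ hx4).le
    rw [← Finset.add_sum_erase _ _ hx4] at hsum ⊢
    rcases Nat.eq_zero_or_pos m4 with h0 | h0
    · have he : (((S.erase x1).erase x2).erase x3).erase x4 = ∅ := by rw [← Finset.card_eq_zero]; omega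
      rw [he] at hsum ⊢
      simp only [sum_empty] at hsum ⊢
      have := O4 _ _ _ _ (hhalf _ m1) v12 v23 v34 (hs _ m4') (by linarith)
      linarith
    · obtain rfl : m4 = 1 := by omega
      obtain ⟨x5, hx5, c5, l5⟩ := sorted_pop (m := 0) c4
      have m5' := mem_of_mem_erase (mem_of_mem_erase (mem_of_mem_erase (mem_of_mem_erase hx5)))
      have v45 := hanti x4 m4' x5 m5' (l4 _ hx5).le
      rw [← Finset.add_sum_erase _ _ hx5] at hsum ⊢
      rw [Finset.card_eq_zero.1 c5] at hsum ⊢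
      simp only [sum_empty] at hsum ⊢
      have := O5 _ _ _ _ _ (hhalf _ m1) v12 v23 v34 v45 (hs _ m5') (by linarith)
      linarith

namespace FRed
variable {v : ℕ → ℚ} {V : Finset ℕ} {c : ℕ} {g h : ℕ → ℕ} {D N : Finset ℕ} {a : ℕ → ℕ}

theorem ge_s (R : FRed v V c g h D N a) {e : ℕ} (he : e ∈ V) : v c ≤ v e := R.toFInst.ge_s he

theorem le_12 (R : FRed v V c g h D N a) {e : ℕ} (he : e ∈ V) : v e ≤ 1 - 2 * v c := by
  have := le_trans (sum_three_le (S := V.filter (fun f => g f = g e)) (x := e) (m := 2)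
      (fun e he => R.ge_s (mem_filter.1 he).1) (by simp [he])
      (R.three _ (R.gD e he)) R.pos.le) (R.gsum _ (R.gD e he))
  push_cast at this; linarith

theorem s_le (R : FRed v V c g h D N a) : v c ≤ 1/3 := by
  have := R.le_12 R.cV; linarith

theorem Npos (R : FRed v V c g h D N a) : 0 < N.card := by
  have h1 : 0 < D.card := Finset.card_pos.2 ⟨_, R.gD c R.cV⟩
  have := R.dn; omega

theorem pre_c (R : FRed v V c g h D N a) {k : ℕ} (hk : k ∈ N) :
    V.filter (fun f => h f = k ∧ f < c) = V.filter (fun f => h f = k) := by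
  ext f
  simp only [mem_filter]
  constructor
  · rintro ⟨h1, h2, _⟩; exact ⟨h1, h2⟩
  · rintro ⟨h1, h2⟩
    refine ⟨h1, h2, lt_of_le_of_ne (R.cmax f h1) ?_⟩
    rintro rfl; have := R.hc k hk; omega

theorem bin_sum (R : FRed v V c g h D N a) {k : ℕ} (hk : k ∈ N) :
    1 < ∑ f ∈ V.filter (fun f => h f = k), v f + v c := by
  have := R.ff k hk c R.cV (R.hc k hk)
  rwa [R.pre_c hk] at this

theorem sum_bins (R : FRed v V c g h D N a) (w : ℕ → ℚ) :
    ∑ e ∈ V, w e = w c + ∑ k ∈ N, ∑ f ∈ V.filter (fun f => h f = k), w f := by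
  rw [← Finset.add_sum_erase _ _ R.cV]
  congr 1
  rw [← Finset.sum_fiberwise_of_maps_to (s := V.erase c) (t := N) (g := h)
    (fun e he => R.hN e (mem_of_mem_erase he) (ne_of_mem_erase he))]
  refine Finset.sum_congr rfl (fun k hk => Finset.sum_congr ?_ (fun _ _ => rfl))
  ext f
  simp only [mem_filter, mem_erase]
  constructor
  · rintro ⟨⟨_, h1⟩, h2⟩; exact ⟨h1, h2⟩
  · rintro ⟨h1, h2⟩
    refine ⟨⟨?_, h1⟩, h2⟩
    rintro rfl; have := R.hc k hk; omega

theorem sum_opts (R : FRed v V c g h D N a) (w : ℕ → ℚ) :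
    ∑ e ∈ V, w e = ∑ l ∈ D, ∑ f ∈ V.filter (fun f => g f = l), w f :=
  (Finset.sum_fiberwise_of_maps_to R.gD _).symm

theorem volume (R : FRed v V c g h D N a) : (N.card : ℚ) * (1 - v c) + v c < D.card := by
  have h1 := R.sum_bins v
  rw [R.sum_opts v] at h1
  have h2 : ∑ l ∈ D, ∑ f ∈ V.filter (fun f => g f = l), v f ≤ ∑ l ∈ D, (1:ℚ) :=
    Finset.sum_le_sum R.gsum
  have h3 : ∑ k ∈ N, (1 - v c) < ∑ k ∈ N, ∑ f ∈ V.filter (fun f => h f = k), v f :=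
    Finset.sum_lt_sum_of_nonempty (Finset.card_pos.1 R.Npos)
      (fun k hk => by have := R.bin_sum hk; linarith)
  simp only [sum_const, nsmul_eq_mul, mul_one] at h2 h3
  linarith

theorem s_gt (R : FRed v V c g h D N a) : 2/11 < v c := by
  have h1 := R.volume
  have h2 : (11:ℚ) * D.card ≤ 9 * N.card := by exact_mod_cast R.dn
  have h3 : (0:ℚ) < N.card := by exact_mod_cast R.Npos
  have := R.pos
  by_contra hcon
  push Not at hcon
  nlinarith

/-- number of items before `e` in bin `k` -/
theorem card_pre (R : FRed v V c g h D N a) {k e m : ℕ} {X Y : ℚ} (hk : k ∈ N) (he : e ∈ V)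
    (hlt : k < h e) (hX : v (a k) ≤ X) (hY : v e ≤ Y) (hm : m * X + Y ≤ 1) :
    m + 1 ≤ (V.filter (fun f => h f = k ∧ f < e)).card := by
  by_contra hcon
  have h1 := R.ff k hk e he hlt
  have hX0 : 0 ≤ X := le_trans (R.toFInst.vpos (R.aV k hk)).le hX
  have h2 : ∑ f ∈ V.filter (fun f => h f = k ∧ f < e), v f ≤
      (V.filter (fun f => h f = k ∧ f < e)).card • X := by
    refine Finset.sum_le_card_nsmul _ _ _ (fun f hf => ?_)
    simp only [mem_filter] at hf
    exact le_trans (R.anti _ (R.aV k hk) f hf.1 (R.amin k hk f hf.1 hf.2.1)) hX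
  rw [nsmul_eq_mul] at h2
  have h3 : ((V.filter (fun f => h f = k ∧ f < e)).card : ℚ) ≤ m := by exact_mod_cast (by omega)
  have := mul_le_mul_of_nonneg_right h3 hX0
  linarith

theorem card_bin (R : FRed v V c g h D N a) {k m : ℕ} {X : ℚ} (hk : k ∈ N)
    (hX : v (a k) ≤ X) (hm : m * X + v c ≤ 1) :
    m + 1 ≤ (V.filter (fun f => h f = k)).card := by
  have := R.card_pre hk R.cV (R.hc k hk) hX le_rfl hm
  rwa [R.pre_c hk] at this

theorem two_bin (R : FRed v V c g h D N a) {k : ℕ} (hk : k ∈ N) :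
    2 ≤ (V.filter (fun f => h f = k)).card := by
  have := R.pos
  exact R.card_bin (m := 1) hk (R.le_12 (R.aV k hk)) (by push_cast; linarith)

theorem a_lt (R : FRed v V c g h D N a) {k e : ℕ} (hk : k ∈ N) (he : e ∈ V) (hlt : k < h e) :
    a k < e := by
  have h1 := R.card_pre (m := 0) hk he hlt le_rfl (Y := 1)
    (by have := R.le_12 he; have := R.pos; linarith) (by simp)
  obtain ⟨f, hf⟩ := Finset.card_pos.1 (by omega : 0 < (V.filter (fun f => h f = k ∧ f < e)).card)
  simp only [mem_filter] at hf
  exact lt_of_le_of_lt (R.amin k hk f hf.1 hf.2.1) hf.2.2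

theorem va_anti (R : FRed v V c g h D N a) {k k' : ℕ} (hk : k ∈ N) (hk' : k' ∈ N) (hlt : k ≤ k') :
    v (a k') ≤ v (a k) := by
  rcases hlt.eq_or_lt with rfl | hlt
  · exact le_rfl
  · exact R.anti _ (R.aV k hk) _ (R.aV k' hk')
      (R.a_lt hk (R.aV k' hk') (by rw [R.ah k' hk']; exact hlt)).le

theorem master (R : FRed v V c g h D N a) (ω : ℚ → ℚ) (C loss : ℚ)
    (O3 : ∀ p q r, p ≤ 1/2 → q ≤ p → r ≤ q → v c ≤ r → p + q + r ≤ 1 → ω p + ω q + ω r ≤ C)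
    (O4 : ∀ p q r t, p ≤ 1/2 → q ≤ p → r ≤ q → t ≤ r → v c ≤ t → p + q + r + t ≤ 1 →
      ω p + ω q + ω r + ω t ≤ C)
    (O5 : ∀ p q r t u, p ≤ 1/2 → q ≤ p → r ≤ q → t ≤ r → u ≤ t → v c ≤ u → p + q + r + t + u ≤ 1 →
      ω p + ω q + ω r + ω t + ω u ≤ C)
    (hL : ∀ k ∈ N, ∀ p q, 1/2 < v (a k) → q ≤ p → v c ≤ q → v (a k) + p + q ≤ 1 →
      ω p + ω q ≤ C - 36 + ∑ f ∈ (V.filter (fun f => h f = k)).erase (a k), ω (v f))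
    (hL18 : ∀ p, 1/2 < p → ω p = 18)
    (hL2 : ∀ p q, q ≤ p → v c ≤ q → p + q < 1/2 → 18 + ω p + ω q ≤ C)
    (hloss : ∑ k ∈ N, (if v (a k) ≤ 1/2 then 36 - ∑ f ∈ V.filter (fun f => h f = k), ω (v f) else 0)
      ≤ loss) :
    36 * (N.card : ℚ) + ω (v c) ≤ C * D.card + loss := by
  classical
  set w : ℕ → ℚ := fun e => if h e ∈ N ∧ e = a (h e) ∧ 1/2 < v e then
    36 - ∑ f ∈ (V.filter (fun f => h f = h e)).erase e, ω (v f) else ω (v e) with hw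
  have hs := R.s_gt
  have hs3 := R.s_le
  have hopt : ∀ l ∈ D, ∑ f ∈ V.filter (fun f => g f = l), w f ≤ C := by
    intro l hl
    by_cases hB : ∃ x ∈ V.filter (fun f => g f = l), 1/2 < v x
    · obtain ⟨x, hx, hx2⟩ := hB
      have hxV := (mem_filter.1 hx).1
      have hcard : (V.filter (fun f => g f = l)).card = 3 := by
        refine le_antisymm ?_ (R.three l hl)
        by_contra hcon
        have := le_trans (sum_three_le (m := 3) (fun e he => R.ge_s (mem_filter.1 he).1) hx
          (by omega) R.pos.le) (R.gsum l hl)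
        push_cast at this; linarith
      have hc2 : ((V.filter (fun f => g f = l)).erase x).card = 1 + 1 := by
        rw [Finset.card_erase_of_mem hx]; omega
      obtain ⟨y, hy, c2, l2⟩ := sorted_pop hc2
      obtain ⟨z, hz, c3, l3⟩ := sorted_pop (m := 0) c2
      have hyV := (mem_filter.1 (mem_of_mem_erase hy)).1
      have hzV := (mem_filter.1 (mem_of_mem_erase (mem_of_mem_erase hz))).1
      have hsum := R.gsum l hl
      rw [← Finset.add_sum_erase _ _ hx, ← Finset.add_sum_erase _ _ hy,
        ← Finset.add_sum_erase _ _ hz, Finset.card_eq_zero.1 c3, sum_empty] at hsum ⊢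
      have hzs := R.ge_s hzV
      have hyz := R.anti y hyV z hzV (l2 z hz).le
      have hwy : w y = ω (v y) := by
        rw [hw]; dsimp only; rw [if_neg]; rintro ⟨_, _, h3⟩; linarith
      have hwz : w z = ω (v z) := by
        rw [hw]; dsimp only; rw [if_neg]; rintro ⟨_, _, h3⟩; linarith
      rw [hwy, hwz]
      by_cases hxa : h x ∈ N ∧ x = a (h x) ∧ 1/2 < v x
      · have hwx : w x = 36 - ∑ f ∈ (V.filter (fun f => h f = h x)).erase x, ω (v f) := by
          rw [hw]; dsimp only; rw [if_pos hxa]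
        have := hL (h x) hxa.1 (v y) (v z) (by rw [← hxa.2.1]; exact hx2) hyz hzs
          (by rw [← hxa.2.1]; linarith)
        rw [← hxa.2.1] at this
        rw [hwx]; linarith
      · have hwx : w x = 18 := by
          rw [hw]; dsimp only; rw [if_neg hxa]; exact hL18 _ hx2
        have := hL2 (v y) (v z) hyz hzs (by linarith)
        rw [hwx]; linarith
    · push Not at hB
      have : ∑ f ∈ V.filter (fun f => g f = l), w f = ∑ f ∈ V.filter (fun f => g f = l), ω (v f) := by
        refine Finset.sum_congr rfl (fun f hf => ?_)
        rw [hw]; dsimp only; rw [if_neg]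
        rintro ⟨_, _, h3⟩; have := hB f hf; linarith
      rw [this]
      refine sum_opt (s := v c) ω ?_ ?_ hB (R.gsum l hl) (R.three l hl) (by linarith) O3 O4 O5
      · intro e he f hf hef
        exact R.anti e (mem_filter.1 he).1 f (mem_filter.1 hf).1 hef
      · intro e he; exact R.ge_s (mem_filter.1 he).1
  have hwc : w c = ω (v c) := by
    rw [hw]; dsimp only; rw [if_neg]; rintro ⟨_, _, h3⟩; linarith
  have hbin : ∀ k ∈ N, ∑ f ∈ V.filter (fun f => h f = k), w f = 36 -
      (if v (a k) ≤ 1/2 then 36 - ∑ f ∈ V.filter (fun f => h f = k), ω (v f) else 0) := by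
    intro k hk
    by_cases hka : v (a k) ≤ 1/2
    · rw [if_pos hka]
      have : ∑ f ∈ V.filter (fun f => h f = k), w f = ∑ f ∈ V.filter (fun f => h f = k), ω (v f) := by
        refine Finset.sum_congr rfl (fun f hf => ?_)
        rw [mem_filter] at hf
        rw [hw]; dsimp only; rw [if_neg]
        rintro ⟨_, _, h3⟩
        have := R.anti _ (R.aV k hk) f hf.1 (R.amin k hk f hf.1 hf.2)
        linarith
      rw [this]; ring
    · rw [if_neg hka]
      have ham : a k ∈ V.filter (fun f => h f = k) := by simp [R.aV k hk, R.ah k hk]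
      rw [← Finset.add_sum_erase _ _ ham]
      have h1 : w (a k) = 36 - ∑ f ∈ (V.filter (fun f => h f = k)).erase (a k), ω (v f) := by
        rw [hw]; dsimp only; rw [R.ah k hk, if_pos ⟨hk, rfl, by push Not at hka; exact hka⟩]
      have h2 : ∑ f ∈ (V.filter (fun f => h f = k)).erase (a k), w f =
          ∑ f ∈ (V.filter (fun f => h f = k)).erase (a k), ω (v f) := by
        refine Finset.sum_congr rfl (fun f hf => ?_)
        rw [mem_erase, mem_filter] at hf
        rw [hw]; dsimp only; rw [if_neg]
        rintro ⟨_, h2, _⟩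
        rw [hf.2.2] at h2; exact hf.1 h2
      rw [h1, h2]; ring
  have hb := R.sum_bins w
  rw [R.sum_opts w, hwc, Finset.sum_congr rfl hbin, Finset.sum_sub_distrib] at hb
  have ho := Finset.sum_le_sum hopt
  simp only [sum_const, nsmul_eq_mul] at ho hb
  linarith

end FRed


theorem loss_cat (N : Finset ℕ) (t : ℕ → ℚ) (cat : ℕ → ℕ) (ℓ : ℕ → ℚ) (m : ℕ)
    (hcat : ∀ k ∈ N, cat k < m) (hℓ : ∀ j, 0 ≤ ℓ j) (h1 : ∀ k ∈ N, t k ≤ ℓ (cat k))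
    (h2 : ∀ k ∈ N, ∀ k' ∈ N, k < k' → cat k = cat k' → t k ≤ 0) :
    ∑ k ∈ N, t k ≤ ∑ j ∈ range m, ℓ j := by
  rw [← Finset.sum_fiberwise_of_maps_to (s := N) (t := range m) (g := cat)
    (fun k hk => mem_range.2 (hcat k hk))]
  refine Finset.sum_le_sum (fun j _ => ?_)
  rcases (N.filter (fun k => cat k = j)).eq_empty_or_nonempty with h0 | h0
  · rw [h0]; simpa using hℓ j
  · have hm := Finset.max'_mem _ h0
    rw [← Finset.add_sum_erase _ _ hm]
    have ha : t ((N.filter (fun k => cat k = j)).max' h0) ≤ ℓ j := by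
      have := h1 _ (mem_filter.1 hm).1
      rwa [(mem_filter.1 hm).2] at this
    have hb : ∑ k ∈ (N.filter (fun k => cat k = j)).erase ((N.filter (fun k => cat k = j)).max' h0), t k ≤ 0 := by
      refine Finset.sum_nonpos (fun k hk => ?_)
      have hk' := mem_filter.1 (mem_of_mem_erase hk)
      refine h2 k hk'.1 _ (mem_filter.1 hm).1 ?_ (by rw [hk'.2, (mem_filter.1 hm).2])
      exact lt_of_le_of_ne (Finset.le_max' _ _ (mem_of_mem_erase hk)) (ne_of_mem_erase hk)
    linarith

theorem wt_ge {S T : Finset ℕ} (hTS : T ⊆ S) {x : ℕ} (hx : x ∈ T) {w : ℕ → ℚ} {w0 w1 wf : ℚ}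
    {m1 m2 : ℕ} (hf : wf ≤ w x) (h1 : ∀ f ∈ T, w1 ≤ w f) (h0 : ∀ f ∈ S, w0 ≤ w f)
    (h01 : w0 ≤ w1) (h00 : 0 ≤ w0) (hT : m1 + 1 ≤ T.card) (hS : m1 + 1 + m2 ≤ S.card) :
    wf + m1 * w1 + m2 * w0 ≤ ∑ f ∈ S, w f := by
  rw [← Finset.sum_sdiff hTS, ← Finset.add_sum_erase _ _ hx]
  have e1 : (S \ T).card • w0 ≤ ∑ f ∈ S \ T, w f :=
    Finset.card_nsmul_le_sum _ _ _ (fun f hf => h0 f (mem_sdiff.1 hf).1)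
  have e2 : (T.erase x).card • w1 ≤ ∑ f ∈ T.erase x, w f :=
    Finset.card_nsmul_le_sum _ _ _ (fun f hf => h1 f (mem_of_mem_erase hf))
  rw [nsmul_eq_mul] at e1 e2
  have c1 : (S \ T).card + T.card = S.card := Finset.card_sdiff_add_card_eq_card hTS
  have c2 : (T.erase x).card + 1 = T.card := by
    rw [Finset.card_erase_of_mem hx]; omega
  obtain ⟨α, hα⟩ : ∃ α, (T.erase x).card = m1 + α := ⟨(T.erase x).card - m1, by omega⟩
  have c3 : m2 ≤ (S \ T).card + α := by omega
  have c3' : (m2 : ℚ) ≤ (S \ T).card + α := by exact_mod_cast c3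
  rw [hα] at e2; push_cast at e2
  have := mul_le_mul_of_nonneg_right c3' h00
  have h5 := mul_le_mul_of_nonneg_left h01 (Nat.cast_nonneg (α := ℚ) α)
  nlinarith

namespace FRed
variable {v : ℕ → ℚ} {V : Finset ℕ} {c : ℕ} {g h : ℕ → ℕ} {D N : Finset ℕ} {a : ℕ → ℕ}

theorem bin_wt (R : FRed v V c g h D N a) {ω : ℚ → ℚ} {k e m1 m2 : ℕ} {wf w1 w0 : ℚ} (hk : k ∈ N)
    (hf : wf ≤ ω (v (a k)))
    (h1 : ∀ f ∈ V, h f = k → f < e → w1 ≤ ω (v f))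
    (h0 : ∀ f ∈ V, w0 ≤ ω (v f)) (h01 : w0 ≤ w1) (h00 : 0 ≤ w0)
    (hT : m1 + 1 ≤ (V.filter (fun f => h f = k ∧ f < e)).card)
    (hS : m1 + 1 + m2 ≤ (V.filter (fun f => h f = k)).card) :
    wf + m1 * w1 + m2 * w0 ≤ ∑ f ∈ V.filter (fun f => h f = k), ω (v f) := by
  obtain ⟨f, hff⟩ := Finset.card_pos.1 (by omega : 0 < (V.filter (fun f => h f = k ∧ f < e)).card)
  simp only [mem_filter] at hff
  refine wt_ge (T := V.filter (fun f => h f = k ∧ f < e)) ?_ (x := a k) ?_ hf ?_ ?_ h01 h00 hT hS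
  · intro f hf; simp only [mem_filter] at hf ⊢; exact ⟨hf.1, hf.2.1⟩
  · simp only [mem_filter]
    exact ⟨R.aV k hk, R.ah k hk, lt_of_le_of_lt (R.amin k hk f hff.1 hff.2.1) hff.2.2⟩
  · intro f hf; simp only [mem_filter] at hf; exact h1 f hf.1 hf.2.1 hf.2.2
  · intro f hf; exact h0 f (mem_filter.1 hf).1

theorem bin_wt' (R : FRed v V c g h D N a) {ω : ℚ → ℚ} {k m : ℕ} {wf w0 : ℚ} (hk : k ∈ N)
    (hf : wf ≤ ω (v (a k)))
    (h0 : ∀ f ∈ V, w0 ≤ ω (v f)) (h00 : 0 ≤ w0)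
    (hS : m + 1 ≤ (V.filter (fun f => h f = k)).card) :
    wf + m * w0 ≤ ∑ f ∈ V.filter (fun f => h f = k), ω (v f) := by
  have := R.bin_wt (e := c) (m1 := m) (m2 := 0) (w1 := w0) hk hf (fun f hf _ _ => h0 f hf) h0 le_rfl h00
    (by rw [R.pre_c hk]; exact hS) (by simpa using hS)
  simpa using this

/-- the reference size for Q-type bins -/
def QS (v : ℕ → ℚ) (N : Finset ℕ) (a : ℕ → ℕ) (σ ρ : ℚ) : Prop :=
  (ρ = 0 ∧ ∀ k ∈ N, σ/4 < v (a k) → v (a k) ≤ σ/3 → False) ∨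
  ∃ kq ∈ N, σ/4 < v (a kq) ∧ v (a kq) ≤ σ/3 ∧ ρ = v (a kq) ∧
    ∀ k ∈ N, σ/4 < v (a k) → v (a k) ≤ σ/3 → k ≤ kq

theorem exists_QS (v : ℕ → ℚ) (N : Finset ℕ) (a : ℕ → ℕ) (σ : ℚ) : ∃ ρ, QS v N a σ ρ := by
  rcases (N.filter (fun k => σ/4 < v (a k) ∧ v (a k) ≤ σ/3)).eq_empty_or_nonempty with h0 | h0
  · refine ⟨0, Or.inl ⟨rfl, fun k hk h1 h2 => ?_⟩⟩
    have : k ∈ N.filter (fun k => σ/4 < v (a k) ∧ v (a k) ≤ σ/3) := by simp [hk, h1, h2]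
    rw [h0] at this; simp at this
  · have hm := Finset.max'_mem _ h0
    have hm' := mem_filter.1 hm
    refine ⟨_, Or.inr ⟨_, hm'.1, hm'.2.1, hm'.2.2, rfl, fun k hk h1 h2 => ?_⟩⟩
    exact Finset.le_max' _ _ (by simp [hk, h1, h2])

theorem loss_total (R : FRed v V c g h D N a) (ω : ℚ → ℚ) {σ ρ : ℚ} (hσ : σ = 1 - v c)
    (hQS : QS v N a σ ρ) {wl wQ wP ℓB ℓM ℓT ℓQ ℓtr : ℚ}
    (hl : ∀ x, (1 - ρ)/3 < x → ρ ≤ x → σ/4 < x → wl ≤ ω x)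
    (hQ : ∀ x, ρ ≤ x → σ/4 < x → wQ ≤ ω x)
    (hP : ∀ x, v c ≤ x → wP ≤ ω x)
    (hPQ : wP ≤ wQ) (hQl : wQ ≤ wl) (hP0 : 36 ≤ 5 * wP) (hQ4 : 36 ≤ 4 * wQ) (hl3 : 36 ≤ 3 * wl + wP)
    (nB : 0 ≤ ℓB) (nM : 0 ≤ ℓM) (nT : 0 ≤ ℓT) (nQ : 0 ≤ ℓQ) (ntr : 0 ≤ ℓtr)
    (B1 : ∀ k ∈ N, σ/2 < v (a k) → v (a k) ≤ 1/2 → 36 ≤ ∑ f ∈ V.filter (fun f => h f = k), ω (v f) + ℓB)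
    (B2 : ∀ k ∈ N, ∀ k' ∈ N, k < k' → v (a k) ≤ 1/2 → σ/2 < v (a k') →
      36 ≤ ∑ f ∈ V.filter (fun f => h f = k), ω (v f))
    (M1 : ∀ k ∈ N, 1/3 < v (a k) → v (a k) ≤ σ/2 → 36 ≤ ∑ f ∈ V.filter (fun f => h f = k), ω (v f) + ℓM)
    (M2 : ∀ k ∈ N, ∀ k' ∈ N, k < k' → v (a k) ≤ σ/2 → 1/3 < v (a k') →
      36 ≤ ∑ f ∈ V.filter (fun f => h f = k), ω (v f))
    (T1 : ∀ k ∈ N, σ/3 < v (a k) → v (a k) ≤ 1/3 → 36 ≤ ∑ f ∈ V.filter (fun f => h f = k), ω (v f) + ℓT)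
    (T2 : ∀ k ∈ N, ∀ k' ∈ N, k < k' → v (a k) ≤ 1/3 → σ/3 < v (a k') →
      36 ≤ ∑ f ∈ V.filter (fun f => h f = k), ω (v f))
    (Q1 : (∃ k ∈ N, σ/4 < v (a k) ∧ v (a k) ≤ σ/3) →
      36 ≤ wQ + 3 * wP + ℓQ ∧ 36 ≤ wl + 2 * wQ + wP + ℓtr) :
    ∑ k ∈ N, (if v (a k) ≤ 1/2 then 36 - ∑ f ∈ V.filter (fun f => h f = k), ω (v f) else 0)
      ≤ ℓB + ℓM + ℓT + ℓQ + ℓtr := by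
  classical
  have hs := R.s_gt
  have hs3 := R.s_le
  have hPV : ∀ f ∈ V, wP ≤ ω (v f) := fun f hf => hP _ (R.ge_s hf)
  -- transition predicate
  obtain ⟨Tr, hTrlt, hTrw, hTru, hnTr⟩ : ∃ Tr : ℕ → Prop,
      (∀ k ∈ N, σ/4 < v (a k) → v (a k) ≤ σ/3 → Tr k → True) ∧
      (∀ k ∈ N, σ/4 < v (a k) → v (a k) ≤ σ/3 → Tr k →
        36 ≤ ∑ f ∈ V.filter (fun f => h f = k), ω (v f) + ℓtr) ∧
      (∀ k ∈ N, ∀ k' ∈ N, k < k' → σ/4 < v (a k) → v (a k) ≤ σ/3 → σ/4 < v (a k') → v (a k') ≤ σ/3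
        → Tr k → Tr k' → False) ∧
      (∀ k ∈ N, ∀ k' ∈ N, k < k' → σ/4 < v (a k) → v (a k) ≤ σ/3 → σ/4 < v (a k') → v (a k') ≤ σ/3
        → ¬ Tr k → 36 ≤ ∑ f ∈ V.filter (fun f => h f = k), ω (v f)) := by
    rcases hQS with ⟨_, hno⟩ | ⟨kq, hkq, hq1, hq2, hρ, hlast⟩
    · refine ⟨fun _ => False, fun _ _ _ _ _ => trivial, ?_, ?_, ?_⟩
      · intro _ _ _ _ h'; exact h'.elim
      · intro _ _ _ _ _ _ _ _ _ h'; exact h'.elim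
      · intro k hk _ _ _ h1 h2; exact (hno k hk h1 h2).elim
    · have hpre3 : ∀ k ∈ N, ∀ e ∈ V, k < h e → v (a k) ≤ σ/3 → v e ≤ σ/3 →
          3 ≤ (V.filter (fun f => h f = k ∧ f < e)).card := by
        intro k hk e he hke h1 h2
        exact R.card_pre (m := 2) hk he hke h1 h2 (by push_cast; linarith [R.pos])
      have hbin4 : ∀ k ∈ N, v (a k) ≤ σ/3 → 4 ≤ (V.filter (fun f => h f = k)).card := by
        intro k hk h1
        exact R.card_bin (m := 3) hk h1 (by push_cast; linarith)
      have hfge : ∀ f ∈ V, f < a kq → ρ ≤ v f := by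
        intro f hf hlt; rw [hρ]; exact R.anti f hf _ (R.aV kq hkq) hlt.le
      have hρ4 : σ/4 < ρ := by rw [hρ]; exact hq1
      refine ⟨fun k => k < kq ∧ (V.filter (fun f => h f = k ∧ f < a kq)).card = 3 ∧
        ∃ f ∈ V, h f = k ∧ f < a kq ∧ v f ≤ (1 - ρ)/3, fun _ _ _ _ _ => trivial, ?_, ?_, ?_⟩
      · rintro k hk h1 h2 ⟨hlt, hcard, f, hf, hfk, hfe, hfv⟩
        have hff := R.ff k hk (a kq) (R.aV kq hkq) (by rw [R.ah kq hkq]; exact hlt)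
        have hle : ∑ f ∈ V.filter (fun f => h f = k ∧ f < a kq), v f ≤
            (V.filter (fun f => h f = k ∧ f < a kq)).card • v (a k) := by
          refine Finset.sum_le_card_nsmul _ _ _ (fun f hf => ?_)
          simp only [mem_filter] at hf
          exact R.anti _ (R.aV k hk) f hf.1 (R.amin k hk f hf.1 hf.2.1)
        rw [hcard, nsmul_eq_mul] at hle
        push_cast at hle
        have hak : (1 - ρ)/3 < v (a k) := by linarith
        have hak2 : ρ ≤ v (a k) := by
          rw [hρ]; exact R.va_anti hk hkq hlt.le
        have := R.bin_wt (ω := ω) (e := a kq) (m1 := 2) (m2 := 1) (wf := wl) (w1 := wQ) (w0 := wP) hk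
          (hl _ hak hak2 h1)
          (fun f hf _ hlt => hQ _ (hfge f hf hlt) (lt_of_lt_of_le hρ4 (hfge f hf hlt))) hPV hPQ (by linarith)
          (by omega) (hbin4 k hk h2)
        push_cast at this
        have := (Q1 ⟨k, hk, h1, h2⟩).2
        linarith
      · rintro k hk k' hk' hkk h1 h2 h1' h2' ⟨hlt, hcard, f, hf, hfk, hfe, hfv⟩ ⟨hlt', hcard', _⟩
        have hff := R.ff k' hk' (a kq) (R.aV kq hkq) (by rw [R.ah kq hkq]; exact hlt')
        have hle : ∑ f ∈ V.filter (fun f => h f = k' ∧ f < a kq), v f ≤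
            (V.filter (fun f => h f = k' ∧ f < a kq)).card • ((1-ρ)/3) := by
          refine Finset.sum_le_card_nsmul _ _ _ (fun f' hf' => ?_)
          simp only [mem_filter] at hf'
          have hv2 : v f' ≤ σ/3 := le_trans (R.anti _ (R.aV k' hk') f' hf'.1 (R.amin k' hk' f' hf'.1 hf'.2.1)) h2'
          have h3 := hpre3 k hk f' hf'.1 (by omega) h2 hv2
          have hsub : V.filter (fun x => h x = k ∧ x < f') ⊆ V.filter (fun x => h x = k ∧ x < a kq) := by
            intro x hx; simp only [mem_filter] at hx ⊢; exact ⟨hx.1, hx.2.1, by omega⟩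
          have heq := Finset.eq_of_subset_of_card_le hsub (by omega)
          have hfm : f ∈ V.filter (fun x => h x = k ∧ x < f') := by
            rw [heq]; simp [hf, hfk, hfe]
          simp only [mem_filter] at hfm
          exact le_trans (R.anti f hf f' hf'.1 hfm.2.2.le) hfv
        rw [hcard', nsmul_eq_mul] at hle
        push_cast at hle
        linarith
      · intro k hk k' hk' hkk h1 h2 h1' h2' hnt
        have hlt : k < kq := lt_of_lt_of_le hkk (hlast k' hk' h1' h2')
        have h3 := hpre3 k hk (a kq) (R.aV kq hkq) (by rw [R.ah kq hkq]; exact hlt) h2 hq2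
        have hak2 : ρ ≤ v (a k) := by
          rw [hρ]; exact R.va_anti hk hkq hlt.le
        rcases h3.lt_or_eq with h4 | h4
        · have := R.bin_wt (ω := ω) (e := a kq) (m1 := 3) (m2 := 0) (wf := wQ) (w1 := wQ) (w0 := wP) hk
            (hQ _ hak2 h1)
            (fun f hf _ hlt => hQ _ (hfge f hf hlt) (lt_of_lt_of_le hρ4 (hfge f hf hlt))) hPV hPQ (by linarith)
            (by omega) (hbin4 k hk h2)
          push_cast at this
          linarith
        · have hall : ∀ f ∈ V, h f = k → f < a kq → (1-ρ)/3 < v f := by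
            intro f hf hfk hfe
            by_contra hcon
            push Not at hcon
            exact hnt ⟨hlt, h4.symm, f, hf, hfk, hfe, hcon⟩
          have := R.bin_wt (ω := ω) (e := a kq) (m1 := 2) (m2 := 1) (wf := wl) (w1 := wl) (w0 := wP) hk
            (hl _ (hall _ (R.aV k hk) (R.ah k hk)
              (R.a_lt hk (R.aV kq hkq) (by rw [R.ah kq hkq]; exact hlt))) hak2 h1)
            (fun f hf hfk hlt => hl _ (hall f hf hfk hlt) (hfge f hf hlt)
              (lt_of_lt_of_le hρ4 (hfge f hf hlt))) hPV (by linarith) (by linarith)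
            (by omega) (hbin4 k hk h2)
          push_cast at this
          linarith
  have hQlast : ∀ k ∈ N, σ/4 < v (a k) → v (a k) ≤ σ/3 →
      36 ≤ ∑ f ∈ V.filter (fun f => h f = k), ω (v f) + ℓQ := by
    intro k hk h1 h2
    have hk2 : ρ ≤ v (a k) := by
      rcases hQS with ⟨h0, _⟩ | ⟨kq, hkq, hq1, hq2, hρ, hlast⟩
      · have := R.toFInst.vpos (R.aV k hk); linarith
      · rw [hρ]; exact R.va_anti hk hkq (hlast k hk h1 h2)
    have := R.bin_wt' (ω := ω) (m := 3) (wf := wQ) (w0 := wP) hk (hQ _ hk2 h1) hPV (by linarith)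
      (R.card_bin (m := 3) hk h2 (by push_cast; linarith))
    push_cast at this
    have := (Q1 ⟨k, hk, h1, h2⟩).1
    linarith
  have hPbin : ∀ k ∈ N, v (a k) ≤ σ/4 → 36 ≤ ∑ f ∈ V.filter (fun f => h f = k), ω (v f) := by
    intro k hk h1
    have := R.bin_wt' (ω := ω) (m := 4) (wf := wP) (w0 := wP) hk (hPV _ (R.aV k hk)) hPV (by linarith)
      (R.card_bin (m := 4) hk h1 (by push_cast; linarith))
    push_cast at this
    linarith
  set cat : ℕ → ℕ := fun k => if 1/2 < v (a k) then 0 else if σ/2 < v (a k) then 1 else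
    if 1/3 < v (a k) then 2 else if σ/3 < v (a k) then 3 else if σ/4 < v (a k) then
      (if Tr k then 5 else 4) else 6 with hcat
  set ℓ : ℕ → ℚ := fun j => if j = 1 then ℓB else if j = 2 then ℓM else if j = 3 then ℓT else
    if j = 4 then ℓQ else if j = 5 then ℓtr else 0 with hℓ
  have key := loss_cat N (fun k => if v (a k) ≤ 1/2 then
    36 - ∑ f ∈ V.filter (fun f => h f = k), ω (v f) else 0) cat ℓ 7 ?_ ?_ ?_ ?_
  · refine le_trans key (le_of_eq ?_)
    simp [hℓ, Finset.sum_range_succ]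
  · intro k _
    simp only [hcat]; split_ifs <;> norm_num
  · intro j; simp only [hℓ]; split_ifs <;> first | assumption | exact le_rfl
  · intro k hk
    by_cases c0 : 1/2 < v (a k)
    · have e0 : cat k = 0 := by simp only [hcat]; rw [if_pos c0]
      rw [e0, if_neg (not_le.2 c0)]; simp [hℓ]
    rw [if_pos (not_lt.1 c0)]
    by_cases c1 : σ/2 < v (a k)
    · have e0 : cat k = 1 := by simp only [hcat]; rw [if_neg c0, if_pos c1]
      rw [e0]; simp only [hℓ]; norm_num; linarith [B1 k hk c1 (not_lt.1 c0)]
    by_cases c2 : 1/3 < v (a k)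
    · have e0 : cat k = 2 := by simp only [hcat]; rw [if_neg c0, if_neg c1, if_pos c2]
      rw [e0]; simp only [hℓ]; norm_num; linarith [M1 k hk c2 (not_lt.1 c1)]
    by_cases c3 : σ/3 < v (a k)
    · have e0 : cat k = 3 := by simp only [hcat]; rw [if_neg c0, if_neg c1, if_neg c2, if_pos c3]
      rw [e0]; simp only [hℓ]; norm_num; linarith [T1 k hk c3 (not_lt.1 c2)]
    by_cases c4 : σ/4 < v (a k)
    · by_cases c5 : Tr k
      · have e0 : cat k = 5 := by
          simp only [hcat]; rw [if_neg c0, if_neg c1, if_neg c2, if_neg c3, if_pos c4, if_pos c5]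
        rw [e0]; simp only [hℓ]; norm_num; linarith [hTrw k hk c4 (not_lt.1 c3) c5]
      · have e0 : cat k = 4 := by
          simp only [hcat]; rw [if_neg c0, if_neg c1, if_neg c2, if_neg c3, if_pos c4, if_neg c5]
        rw [e0]; simp only [hℓ]; norm_num; linarith [hQlast k hk c4 (not_lt.1 c3)]
    · have e0 : cat k = 6 := by
        simp only [hcat]; rw [if_neg c0, if_neg c1, if_neg c2, if_neg c3, if_neg c4]
      rw [e0]; simp only [hℓ]; norm_num; linarith [hPbin k hk (not_lt.1 c4)]
  · intro k hk k' hk' hkk hceq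
    by_cases c0 : 1/2 < v (a k)
    · simp only [if_neg (not_le.2 c0)]; exact le_rfl
    simp only [if_pos (not_lt.1 c0)]
    have hle := R.va_anti hk hk' hkk.le
    have c0' : ¬ 1/2 < v (a k') := by intro h'; linarith
    suffices 36 ≤ ∑ f ∈ V.filter (fun f => h f = k), ω (v f) by linarith
    simp only [hcat] at hceq
    rw [if_neg c0, if_neg c0'] at hceq
    by_cases d1 : σ/2 < v (a k')
    · exact B2 k hk k' hk' hkk (not_lt.1 c0) d1
    rw [if_neg d1] at hceq
    by_cases c1 : σ/2 < v (a k)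
    · rw [if_pos c1] at hceq; split_ifs at hceq <;> omega
    rw [if_neg c1] at hceq
    by_cases d2 : 1/3 < v (a k')
    · exact M2 k hk k' hk' hkk (not_lt.1 c1) d2
    rw [if_neg d2] at hceq
    by_cases c2 : 1/3 < v (a k)
    · rw [if_pos c2] at hceq; split_ifs at hceq <;> omega
    rw [if_neg c2] at hceq
    by_cases d3 : σ/3 < v (a k')
    · exact T2 k hk k' hk' hkk (not_lt.1 c2) d3
    rw [if_neg d3] at hceq
    by_cases c3 : σ/3 < v (a k)
    · rw [if_pos c3] at hceq; split_ifs at hceq <;> omega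
    rw [if_neg c3] at hceq
    by_cases c4 : σ/4 < v (a k)
    · rw [if_pos c4] at hceq
      by_cases d4 : σ/4 < v (a k')
      · rw [if_pos d4] at hceq
        by_cases t1 : Tr k
        · by_cases t2 : Tr k'
          · exact (hTru k hk k' hk' hkk c4 (not_lt.1 c3) d4 (not_lt.1 d3) t1 t2).elim
          · rw [if_pos t1, if_neg t2] at hceq; omega
        · exact hnTr k hk k' hk' hkk c4 (not_lt.1 c3) d4 (not_lt.1 d3) t1
      · rw [if_neg d4] at hceq; split_ifs at hceq <;> omega
    · exact hPbin k hk (not_lt.1 c4)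

end FRed


namespace FRed
variable {v : ℕ → ℚ} {V : Finset ℕ} {c : ℕ} {g h : ℕ → ℕ} {D N : Finset ℕ} {a : ℕ → ℕ}

theorem a_mem (R : FRed v V c g h D N a) {k : ℕ} (hk : k ∈ N) :
    a k ∈ V.filter (fun f => h f = k) := by simp [R.aV k hk, R.ah k hk]

theorem two_or (R : FRed v V c g h D N a) {k : ℕ} (hk : k ∈ N) :
    (∃ x ∈ V, h x = k ∧ a k < x ∧ (V.filter (fun f => h f = k)).erase (a k) = {x} ∧
      1 < v (a k) + v x + v c) ∨ 3 ≤ (V.filter (fun f => h f = k)).card := by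
  rcases (R.two_bin hk).eq_or_lt with h2 | h3
  · left
    have hc : ((V.filter (fun f => h f = k)).erase (a k)).card = 1 := by
      rw [Finset.card_erase_of_mem (R.a_mem hk)]; omega
    obtain ⟨x, hx⟩ := Finset.card_eq_one.1 hc
    have hxm : x ∈ (V.filter (fun f => h f = k)).erase (a k) := by rw [hx]; simp
    rw [mem_erase, mem_filter] at hxm
    have hs := R.bin_sum hk
    rw [← Finset.add_sum_erase _ _ (R.a_mem hk), hx, sum_singleton] at hs
    exact ⟨x, hxm.2.1, hxm.2.2, lt_of_le_of_ne (R.amin k hk x hxm.2.1 hxm.2.2) (Ne.symm hxm.1), hx,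
      by linarith⟩
  · exact Or.inr h3

theorem two_wt (R : FRed v V c g h D N a) {k x : ℕ} (hk : k ∈ N) (ω : ℚ → ℚ)
    (hx : (V.filter (fun f => h f = k)).erase (a k) = {x}) :
    ∑ f ∈ V.filter (fun f => h f = k), ω (v f) = ω (v (a k)) + ω (v x) := by
  rw [← Finset.add_sum_erase _ _ (R.a_mem hk), hx, sum_singleton]

theorem erase_wt (R : FRed v V c g h D N a) {k : ℕ} (hk : k ∈ N) (ω : ℚ → ℚ) {w0 : ℚ}
    (h3 : 3 ≤ (V.filter (fun f => h f = k)).card) (h0 : ∀ f ∈ V, w0 ≤ ω (v f)) (h00 : 0 ≤ w0) :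
    2 * w0 ≤ ∑ f ∈ (V.filter (fun f => h f = k)).erase (a k), ω (v f) := by
  have h1 : ((V.filter (fun f => h f = k)).erase (a k)).card • w0 ≤
      ∑ f ∈ (V.filter (fun f => h f = k)).erase (a k), ω (v f) :=
    Finset.card_nsmul_le_sum _ _ _ (fun f hf => h0 f (mem_filter.1 (mem_of_mem_erase hf)).1)
  rw [Finset.card_erase_of_mem (R.a_mem hk), nsmul_eq_mul] at h1
  have h2 : (2:ℚ) ≤ (((V.filter (fun f => h f = k)).card - 1 : ℕ) : ℚ) := by
    exact_mod_cast (by omega)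
  have := mul_le_mul_of_nonneg_right h2 h00
  linarith

theorem ex_before (R : FRed v V c g h D N a) {k e : ℕ} (hk : k ∈ N) (he : e ∈ V) (hlt : k < h e)
    (hfit : v (a k) + v e ≤ 1) : ∃ f ∈ (V.filter (fun f => h f = k)).erase (a k), f < e := by
  have := R.card_pre (m := 1) hk he hlt le_rfl le_rfl (by push_cast; linarith)
  obtain ⟨f, hf, hne⟩ := Finset.exists_mem_ne (by omega :
    1 < (V.filter (fun f => h f = k ∧ f < e)).card) (a k)
  simp only [mem_filter] at hf
  exact ⟨f, by rw [mem_erase, mem_filter]; exact ⟨hne, hf.1, hf.2.1⟩, hf.2.2⟩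

theorem second_lt (R : FRed v V c g h D N a) {k e x : ℕ} (hk : k ∈ N) (he : e ∈ V) (hlt : k < h e)
    (hfit : v (a k) + v e ≤ 1) (hx : (V.filter (fun f => h f = k)).erase (a k) = {x}) : x < e := by
  obtain ⟨f, hf, hfe⟩ := R.ex_before hk he hlt hfit
  rw [hx, mem_singleton] at hf
  rwa [← hf]

theorem erase_one (R : FRed v V c g h D N a) {k f : ℕ} (ω : ℚ → ℚ)
    (hf : f ∈ (V.filter (fun f => h f = k)).erase (a k)) (h0 : ∀ f ∈ V, 0 ≤ ω (v f)) :
    ω (v f) ≤ ∑ f ∈ (V.filter (fun f => h f = k)).erase (a k), ω (v f) :=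
  Finset.single_le_sum (f := fun f => ω (v f))
    (fun i hi => h0 i (mem_filter.1 (mem_of_mem_erase hi)).1) hf

/-- weight of a bin with a later bin `k'` -/
theorem W_nl (R : FRed v V c g h D N a) {ω : ℚ → ℚ} {k k' m1 m2 : ℕ} {wf w1 w0 : ℚ} (hk : k ∈ N)
    (hk' : k' ∈ N) (hlt : k < k') (hfit : m1 * v (a k) + v (a k') ≤ 1)
    (hf : wf ≤ ω (v (a k)))
    (h1 : ∀ x, v (a k') ≤ x → x ≤ v (a k) → w1 ≤ ω x)
    (h0 : ∀ x, v c ≤ x → w0 ≤ ω x) (h01 : w0 ≤ w1) (h00 : 0 ≤ w0)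
    (hS : m1 + 1 + m2 ≤ (V.filter (fun f => h f = k)).card ∨ m2 = 0) :
    wf + m1 * w1 + m2 * w0 ≤ ∑ f ∈ V.filter (fun f => h f = k), ω (v f) := by
  have hc := R.card_pre (m := m1) hk (R.aV k' hk') (by rw [R.ah k' hk']; exact hlt) le_rfl le_rfl hfit
  refine R.bin_wt (e := a k') hk hf ?_ (fun f hf => h0 _ (R.ge_s hf)) h01 h00 hc ?_
  · intro f hf hfk hlt
    exact h1 _ (R.anti f hf _ (R.aV k' hk') hlt.le) (R.anti _ (R.aV k hk) f hf (R.amin k hk f hf hfk))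
  · rcases hS with hS | hS
    · exact hS
    · subst hS
      refine le_trans hc (Finset.card_le_card ?_)
      intro f hf; simp only [mem_filter] at hf ⊢; exact ⟨hf.1, hf.2.1⟩

theorem vol_A (R : FRed v V c g h D N a) (hs : v c ≤ 1/4) : 3 * N.card + 1 < 4 * D.card := by
  have h1 := R.volume
  have h2 : (0:ℚ) ≤ N.card - 1 := by
    have : (1:ℚ) ≤ N.card := by exact_mod_cast R.Npos
    linarith
  have : (3:ℚ) * N.card + 1 < 4 * D.card := by nlinarith
  exact_mod_cast this

theorem vol_B (R : FRed v V c g h D N a) (hs : v c ≤ 1/5) : 4 * N.card + 1 < 5 * D.card := by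
  have h1 := R.volume
  have h2 : (0:ℚ) ≤ N.card - 1 := by
    have : (1:ℚ) ≤ N.card := by exact_mod_cast R.Npos
    linarith
  have : (4:ℚ) * N.card + 1 < 5 * D.card := by nlinarith
  exact_mod_cast this

/-- no T-bad bin -/
def NoT (v : ℕ → ℚ) (V : Finset ℕ) (h : ℕ → ℕ) (N : Finset ℕ) (a : ℕ → ℕ) (σ : ℚ) : Prop :=
  ∀ k ∈ N, ∀ x ∈ V, (V.filter (fun f => h f = k)).erase (a k) = {x} → 1/2 < v (a k) →
    σ/3 < v x → v x ≤ 1/3 → 2 * σ/3 ≤ v (a k)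

/-- no Q-bad bin -/
def NoQ (v : ℕ → ℚ) (V : Finset ℕ) (h : ℕ → ℕ) (N : Finset ℕ) (a : ℕ → ℕ) (σ : ℚ) : Prop :=
  ∀ k ∈ N, ∀ x ∈ V, (V.filter (fun f => h f = k)).erase (a k) = {x} → 1/2 < v (a k) →
    σ/4 < v x → v x ≤ σ/3 → 1 - σ/2 ≤ v (a k)

theorem caseAN (R : FRed v V c g h D N a) {σ : ℚ} (hσ : σ = 1 - v c) (hs5 : 1/5 < v c)
    (noT : NoT v V h N a σ) (noQ : NoQ v V h N a σ) : False := by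
  have hs3 := R.s_le
  obtain ⟨ω, hω⟩ : ∃ ω : ℚ → ℚ, ω = fun x => if 1/2 < x then 18 else if σ/2 < x then 18 else
    if 1/3 < x then 27/2 else if σ/3 < x then 12 else 9 := ⟨_, rfl⟩
  have u0 : ∀ x, ω x ≤ 18 := by intro x; simp only [hω]; split_ifs <;> linarith
  have u1 : ∀ x, x ≤ σ/2 → ω x ≤ 27/2 := by intro x hx; simp only [hω]; split_ifs <;> linarith
  have u2 : ∀ x, x ≤ 1/3 → ω x ≤ 12 := by intro x hx; simp only [hω]; split_ifs <;> linarith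
  have u3 : ∀ x, x ≤ σ/3 → ω x ≤ 9 := by intro x hx; simp only [hω]; split_ifs <;> linarith
  have l0 : ∀ x, 9 ≤ ω x := by intro x; simp only [hω]; split_ifs <;> linarith
  have l1 : ∀ x, σ/3 < x → 12 ≤ ω x := by intro x hx; simp only [hω]; split_ifs <;> linarith
  have l2 : ∀ x, 1/3 < x → 27/2 ≤ ω x := by intro x hx; simp only [hω]; split_ifs <;> linarith
  have l3 : ∀ x, σ/2 < x → 18 ≤ ω x := by intro x hx; simp only [hω]; split_ifs <;> linarith
  obtain ⟨ρ, hρ⟩ := exists_QS v N a σ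
  have hloss : ∀ ℓB ℓM ℓT : ℚ, 0 ≤ ℓB → 0 ≤ ℓM → 0 ≤ ℓT → _ → _ → _ → _ := 
    fun ℓB ℓM ℓT nB nM nT B1 M1 T1 => R.loss_total ω hσ hρ (wl := 9) (wQ := 9) (wP := 9)
      (ℓB := ℓB) (ℓM := ℓM) (ℓT := ℓT) (ℓQ := 0) (ℓtr := 0)
      (fun x _ _ _ => l0 x) (fun x _ _ => l0 x) (fun x _ => l0 x) le_rfl le_rfl (by norm_num) (by norm_num)
      (by norm_num) nB nM nT le_rfl le_rfl B1
      (by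
        intro k hk k' hk' hlt h1 h2
        have := R.va_anti hk hk' hlt.le
        have := R.W_nl (ω := ω) (m1 := 1) (m2 := 0) (wf := 18) (w1 := 18) (w0 := 9) hk hk' hlt (by push_cast; linarith)
          (l3 _ (by linarith)) (fun x hx _ => l3 x (by linarith)) (fun x _ => l0 x) (by norm_num) (by norm_num)
          (Or.inr rfl)
        push_cast at this; linarith)
      M1
      (by
        intro k hk k' hk' hlt h1 h2
        have := R.va_anti hk hk' hlt.le
        have := R.W_nl (ω := ω) (m1 := 1) (m2 := 1) (wf := 27/2) (w1 := 27/2) (w0 := 9) hk hk' hlt (by push_cast; linarith)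
          (l2 _ (by linarith)) (fun x hx _ => l2 x (by linarith)) (fun x _ => l0 x) (by norm_num) (by norm_num)
          (Or.inl (R.card_bin (m := 2) hk h1 (by push_cast; linarith)))
        push_cast at this; linarith)
      T1
      (by
        intro k hk k' hk' hlt h1 h2
        have := R.va_anti hk hk' hlt.le
        have := R.W_nl (ω := ω) (m1 := 2) (m2 := 0) (wf := 12) (w1 := 12) (w0 := 9) hk hk' hlt (by push_cast; linarith)
          (l1 _ (by linarith)) (fun x hx _ => l1 x (by linarith)) (fun x _ => l0 x) (by norm_num) (by norm_num)
          (Or.inr rfl)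
        push_cast at this; linarith)
      (fun _ => by norm_num)
  -- loss at most 12
  have hB6 : ∀ k ∈ N, σ/2 < v (a k) → v (a k) ≤ 1/2 → 36 ≤ ∑ f ∈ V.filter (fun f => h f = k), ω (v f) + 6 := by
    intro k hk h1 h2
    rcases R.two_or hk with ⟨x, hxV, hxk, hax, hx, hsum⟩ | h3
    · rw [R.two_wt hk ω hx]
      have := l3 _ h1
      have hxs := R.ge_s hxV
      have := l1 (v x) (by linarith)
      linarith
    · have := R.bin_wt' (ω := ω) (m := 2) (wf := 18) (w0 := 9) hk (l3 _ h1) (fun f _ => l0 _) (by norm_num) h3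
      push_cast at this; linarith
  have hM45 : ∀ k ∈ N, 1/3 < v (a k) → v (a k) ≤ σ/2 → 36 ≤ ∑ f ∈ V.filter (fun f => h f = k), ω (v f) + 9/2 := by
    intro k hk h1 h2
    have := R.bin_wt' (ω := ω) (m := 2) (wf := 27/2) (w0 := 9) hk (l2 _ h1) (fun f _ => l0 _) (by norm_num)
      (R.card_bin (m := 2) hk h2 (by push_cast; linarith))
    push_cast at this; linarith
  have hT6 : ∀ k ∈ N, σ/3 < v (a k) → v (a k) ≤ 1/3 → 36 ≤ ∑ f ∈ V.filter (fun f => h f = k), ω (v f) + 6 := by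
    intro k hk h1 h2
    have := R.bin_wt' (ω := ω) (m := 2) (wf := 12) (w0 := 9) hk (l1 _ h1) (fun f _ => l0 _) (by norm_num)
      (R.card_bin (m := 2) hk h2 (by push_cast; linarith))
    push_cast at this; linarith
  have hloss12 : ∑ k ∈ N, (if v (a k) ≤ 1/2 then 36 - ∑ f ∈ V.filter (fun f => h f = k), ω (v f) else 0)
      ≤ 12 := by
    by_cases hM : ∃ k ∈ N, 1/3 < v (a k) ∧ v (a k) ≤ σ/2
    · obtain ⟨km, hkm, hm1, hm2⟩ := hM
      have hB45 : ∀ k ∈ N, σ/2 < v (a k) → v (a k) ≤ 1/2 →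
          36 ≤ ∑ f ∈ V.filter (fun f => h f = k), ω (v f) + 9/2 := by
        intro k hk h1 h2
        have hlt : k < km := by
          by_contra hcon
          have := R.va_anti hkm hk (not_lt.1 hcon)
          linarith
        have := R.W_nl (ω := ω) (m1 := 1) (m2 := 0) (wf := 18) (w1 := 27/2) (w0 := 9) hk hkm hlt (by push_cast; linarith)
          (l3 _ (by linarith)) (fun x hx _ => l2 x (by linarith)) (fun x _ => l0 x) (by norm_num) (by norm_num)
          (Or.inr rfl)
        push_cast at this; linarith
      by_cases hT : ∃ k ∈ N, σ/3 < v (a k) ∧ v (a k) ≤ 1/3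
      · obtain ⟨kt, hkt, ht1, ht2⟩ := hT
        refine le_trans (hloss (9/2) (3/2) 6 (by norm_num) (by norm_num) (by norm_num) hB45 ?_ hT6) (by norm_num)
        intro k hk h1 h2
        have hlt : k < kt := by
          by_contra hcon
          have := R.va_anti hkt hk (not_lt.1 hcon)
          linarith
        have := R.W_nl (ω := ω) (m1 := 1) (m2 := 1) (wf := 27/2) (w1 := 12) (w0 := 9) hk hkt hlt (by push_cast; linarith)
          (l2 _ (by linarith)) (fun x hx _ => l1 x (by linarith)) (fun x _ => l0 x) (by norm_num) (by norm_num)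
          (Or.inl (R.card_bin (m := 2) hk h2 (by push_cast; linarith)))
        push_cast at this; linarith
      · refine le_trans (hloss (9/2) (9/2) 0 (by norm_num) (by norm_num) (by norm_num) hB45 hM45 ?_) (by norm_num)
        intro k hk h1 h2; exact (hT ⟨k, hk, h1, h2⟩).elim
    · refine le_trans (hloss 6 0 6 (by norm_num) (by norm_num) (by norm_num) hB6 ?_ hT6) (by norm_num)
      intro k hk h1 h2; exact (hM ⟨k, hk, h1, h2⟩).elim
  have key := R.master ω (87/2) 12 ?_ ?_ ?_ ?_ ?_ ?_ hloss12
  · -- final contradiction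
    by_cases hs4 : v c ≤ 1/4
    · have hv := R.vol_A hs4
      have hd := R.dn
      have := l0 (v c)
      have h1 : (36:ℚ) * N.card + 9 ≤ 87/2 * D.card + 12 := by linarith
      have h2 : (72:ℚ) * N.card ≤ 87 * D.card + 6 := by linarith
      have h3 : 72 * N.card ≤ 87 * D.card + 6 := by exact_mod_cast h2
      omega
    · have := l1 (v c) (by linarith)
      have h2 : (11:ℚ) * D.card ≤ 9 * N.card := by exact_mod_cast R.dn
      have h3 : (0:ℚ) < N.card := by exact_mod_cast R.Npos
      linarith
  · intro p q r hp hqp hrq hsr hsum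
    have := u0 p
    by_cases hq : q ≤ 1/3
    · have := u2 r (by linarith)
      have := u2 q hq
      linarith
    · have := u1 q (by linarith)
      by_cases hr : r ≤ 1/3
      · have := u2 r hr; linarith
      · have := u1 r (by linarith); 
        by_cases hp' : p ≤ σ/2
        · have := u1 p hp'; linarith
        · linarith
  · intro p q r t hp hqp hrq htr hst hsum
    have := u1 p (by linarith)
    have := u3 r (by by_contra hcon; linarith)
    have := u3 t (by by_contra hcon; linarith)
    have := u2 q (by by_contra hcon; linarith)
    linarith
  · intro p q r t u _ _ _ _ _ _ _; linarith
  · intro k hk p q hLk hqp hsq hsum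
    have hp := u2 p (by linarith)
    have hq := u3 q (by linarith)
    rcases R.two_or hk with ⟨x, hxV, hxk, hax, hx, hsum2⟩ | h3
    · rw [hx, sum_singleton]
      by_cases c1 : 1/3 < v x
      · have := l2 _ c1; linarith
      by_cases c2 : σ/3 < v x
      · have h1 := noT k hk x hxV hx hLk c2 (by linarith)
        have := u3 p (by linarith)
        have := l1 _ c2
        linarith
      · have hxs := R.ge_s hxV
        have h1 := noQ k hk x hxV hx hLk (by linarith) (by linarith)
        linarith
    · have := R.erase_wt hk ω h3 (fun f _ => l0 (v f)) (by norm_num)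
      linarith
  · intro p hp; simp only [hω]; rw [if_pos hp]
  · intro p q hqp hsq hsum
    have hp := u2 p (by linarith)
    have hq := u3 q (by linarith)
    linarith

end FRed


namespace FRed
variable {v : ℕ → ℚ} {V : Finset ℕ} {c : ℕ} {g h : ℕ → ℕ} {D N : Finset ℕ} {a : ℕ → ℕ}

theorem lt_of_va (R : FRed v V c g h D N a) {k k' : ℕ} (hk : k ∈ N) (hk' : k' ∈ N)
    (hv : v (a k') < v (a k)) : k < k' := by
  by_contra hcon
  have := R.va_anti hk' hk (not_lt.1 hcon)
  linarith

set_option maxHeartbeats 1000000 in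
theorem caseBN (R : FRed v V c g h D N a) {σ : ℚ} (hσ : σ = 1 - v c) (hs5 : v c ≤ 1/5)
    (noT : NoT v V h N a σ) (noQ : NoQ v V h N a σ) : False := by
  have hs := R.s_gt
  obtain ⟨ρ, hρ⟩ := exists_QS v N a σ
  obtain ⟨ω, hω⟩ : ∃ ω : ℚ → ℚ, ω = fun x => if 1/2 < x then 18 else if σ/2 < x then 18 else
    if 1/3 < x then 72/5 else if σ/3 < x then 12 else if (1-ρ)/3 < x ∧ ρ ≤ x then 48/5 else
    if σ/4 < x then 9 else 36/5 := ⟨_, rfl⟩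
  have u0 : ∀ x, ω x ≤ 18 := by intro x; simp only [hω]; grind
  have u1 : ∀ x, x ≤ σ/2 → ω x ≤ 72/5 := by intro x hx; simp only [hω]; grind
  have u2 : ∀ x, x ≤ 1/3 → ω x ≤ 12 := by intro x hx; simp only [hω]; grind
  have u3 : ∀ x, x ≤ σ/3 → ω x ≤ 48/5 := by intro x hx; simp only [hω]; grind
  have u4 : ∀ x, x ≤ 1/4 → ω x ≤ 9 := by
    intro x hx; simp only [hω]; grind
  have u5 : ∀ x, x ≤ σ/4 → ω x ≤ 36/5 := by
    intro x hx; simp only [hω]; grind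
  have l0 : ∀ x, 36/5 ≤ ω x := by intro x; simp only [hω]; grind
  have lQ : ∀ x, σ/4 < x → 9 ≤ ω x := by intro x hx; simp only [hω]; grind
  have ll : ∀ x, (1-ρ)/3 < x → ρ ≤ x → 48/5 ≤ ω x := by
    intro x hx hx2; simp only [hω]; grind
  have l1 : ∀ x, σ/3 < x → 12 ≤ ω x := by intro x hx; simp only [hω]; grind
  have l2 : ∀ x, 1/3 < x → 72/5 ≤ ω x := by intro x hx; simp only [hω]; grind
  have l3 : ∀ x, σ/2 < x → 18 ≤ ω x := by intro x hx; simp only [hω]; grind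
  have mono : ∀ p x, p ≤ x → x ≤ σ/3 → ω p ≤ ω x := by
    intro p x hpx hx
    by_cases h1 : (1-ρ)/3 < p ∧ ρ ≤ p
    · exact le_trans (u3 p (by linarith)) (ll x (by linarith [h1.1]) (by linarith [h1.2]))
    by_cases h2 : σ/4 < p
    · have : ω p ≤ 9 := by simp only [hω]; grind
      exact le_trans this (lQ x (by linarith))
    · exact le_trans (u5 p (by linarith)) (l0 x)
  have lL : ∀ p, 1/2 < p → ω p = 18 := by intro p hp; simp only [hω]; rw [if_pos hp]
  clear hω
  have hB6 : ∀ k ∈ N, σ/2 < v (a k) → v (a k) ≤ 1/2 → 36 ≤ ∑ f ∈ V.filter (fun f => h f = k), ω (v f) + 6 := by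
    intro k hk h1 h2
    rcases R.two_or hk with ⟨x, hxV, hxk, hax, hx, hsum⟩ | h3
    · rw [R.two_wt hk ω hx]
      have := l3 _ h1
      have hxs := R.ge_s hxV
      have := l1 (v x) (by linarith)
      linarith
    · have := R.bin_wt' (ω := ω) (m := 2) (wf := 18) (w0 := 36/5) hk (l3 _ h1) (fun f _ => l0 _) (by norm_num) h3
      push_cast at this; linarith
  have hM72 : ∀ k ∈ N, 1/3 < v (a k) → v (a k) ≤ σ/2 → 36 ≤ ∑ f ∈ V.filter (fun f => h f = k), ω (v f) + 36/5 := by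
    intro k hk h1 h2
    have := R.bin_wt' (ω := ω) (m := 2) (wf := 72/5) (w0 := 36/5) hk (l2 _ h1) (fun f _ => l0 _) (by norm_num)
      (R.card_bin (m := 2) hk h2 (by push_cast; linarith))
    push_cast at this; linarith
  obtain ⟨ℓT, ℓQ, ℓtr, nT, nQ, ntr, T1, Q1, e1, e2⟩ : ∃ ℓT ℓQ ℓtr : ℚ, 0 ≤ ℓT ∧ 0 ≤ ℓQ ∧ 0 ≤ ℓtr ∧
      (∀ k ∈ N, σ/3 < v (a k) → v (a k) ≤ 1/3 → 36 ≤ ∑ f ∈ V.filter (fun f => h f = k), ω (v f) + ℓT) ∧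
      ((∃ k ∈ N, σ/4 < v (a k) ∧ v (a k) ≤ σ/3) →
        36 ≤ 9 + 3 * (36/5) + ℓQ ∧ 36 ≤ 48/5 + 2 * 9 + 36/5 + ℓtr) ∧
      ℓT + ℓQ + ℓtr ≤ 63/5 ∧ ℓQ + ℓtr ≤ 33/5 := by
    by_cases hQ : ∃ k ∈ N, σ/4 < v (a k) ∧ v (a k) ≤ σ/3
    · refine ⟨6, 27/5, 6/5, by norm_num, by norm_num, by norm_num, ?_, fun _ => by norm_num, by norm_num, by norm_num⟩
      obtain ⟨kq, hkq, hq1, hq2⟩ := hQ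
      intro k hk h1 h2
      have := R.W_nl (ω := ω) (m1 := 2) (m2 := 0) (wf := 12) (w1 := 9) (w0 := 36/5) hk hkq
        (R.lt_of_va hk hkq (by linarith)) (by push_cast; linarith)
        (l1 _ (by linarith)) (fun x hx _ => lQ x (by linarith)) (fun x _ => l0 x) (by norm_num) (by norm_num)
        (Or.inr rfl)
      push_cast at this; linarith
    · refine ⟨48/5, 0, 0, by norm_num, by norm_num, by norm_num, ?_, fun h => (hQ h).elim, by norm_num, by norm_num⟩
      intro k hk h1 h2
      have := R.bin_wt' (ω := ω) (m := 2) (wf := 12) (w0 := 36/5) hk (l1 _ h1) (fun f _ => l0 _) (by norm_num)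
        (R.card_bin (m := 2) hk h2 (by push_cast; linarith))
      push_cast at this; linarith
  have hloss : ∀ ℓB ℓM ℓT : ℚ, 0 ≤ ℓB → 0 ≤ ℓM → 0 ≤ ℓT → _ → _ → _ → _ := 
    fun ℓB ℓM ℓT nB nM nT B1 M1 T1 => R.loss_total ω hσ hρ (wl := 48/5) (wQ := 9) (wP := 36/5)
      (ℓB := ℓB) (ℓM := ℓM) (ℓT := ℓT) (ℓQ := ℓQ) (ℓtr := ℓtr)
      (fun x h1 h2 _ => ll x h1 h2) (fun x _ => lQ x) (fun x _ => l0 x) (by norm_num) (by norm_num) (by norm_num) (by norm_num)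
      (by norm_num) nB nM nT nQ ntr B1
      (by
        intro k hk k' hk' hlt h1 h2
        have := R.va_anti hk hk' hlt.le
        have := R.W_nl (ω := ω) (m1 := 1) (m2 := 0) (wf := 18) (w1 := 18) (w0 := 36/5) hk hk' hlt (by push_cast; linarith)
          (l3 _ (by linarith)) (fun x hx _ => l3 x (by linarith)) (fun x _ => l0 x) (by norm_num) (by norm_num)
          (Or.inr rfl)
        push_cast at this; linarith)
      M1
      (by
        intro k hk k' hk' hlt h1 h2
        have := R.va_anti hk hk' hlt.le
        have := R.W_nl (ω := ω) (m1 := 1) (m2 := 1) (wf := 72/5) (w1 := 72/5) (w0 := 36/5) hk hk' hlt (by push_cast; linarith)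
          (l2 _ (by linarith)) (fun x hx _ => l2 x (by linarith)) (fun x _ => l0 x) (by norm_num) (by norm_num)
          (Or.inl (R.card_bin (m := 2) hk h1 (by push_cast; linarith)))
        push_cast at this; linarith)
      T1
      (by
        intro k hk k' hk' hlt h1 h2
        have := R.va_anti hk hk' hlt.le
        have := R.W_nl (ω := ω) (m1 := 2) (m2 := 0) (wf := 12) (w1 := 12) (w0 := 36/5) hk hk' hlt (by push_cast; linarith)
          (l1 _ (by linarith)) (fun x hx _ => l1 x (by linarith)) (fun x _ => l0 x) (by norm_num) (by norm_num)
          (Or.inr rfl)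
        push_cast at this; linarith)
      Q1
  have hloss12 : ∑ k ∈ N, (if v (a k) ≤ 1/2 then 36 - ∑ f ∈ V.filter (fun f => h f = k), ω (v f) else 0)
      ≤ 93/5 := by
    by_cases hM : ∃ k ∈ N, 1/3 < v (a k) ∧ v (a k) ≤ σ/2
    · obtain ⟨km, hkm, hm1, hm2⟩ := hM
      have hB36 : ∀ k ∈ N, σ/2 < v (a k) → v (a k) ≤ 1/2 →
          36 ≤ ∑ f ∈ V.filter (fun f => h f = k), ω (v f) + 18/5 := by
        intro k hk h1 h2
        have := R.W_nl (ω := ω) (m1 := 1) (m2 := 0) (wf := 18) (w1 := 72/5) (w0 := 36/5) hk hkm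
          (R.lt_of_va hk hkm (by linarith)) (by push_cast; linarith)
          (l3 _ (by linarith)) (fun x hx _ => l2 x (by linarith)) (fun x _ => l0 x) (by norm_num) (by norm_num)
          (Or.inr rfl)
        push_cast at this; linarith
      by_cases hT : ∃ k ∈ N, σ/3 < v (a k) ∧ v (a k) ≤ 1/3
      · obtain ⟨kt, hkt, ht1, ht2⟩ := hT
        refine le_trans (hloss (18/5) (12/5) ℓT (by norm_num) (by norm_num) nT hB36 ?_ T1) (by linarith)
        intro k hk h1 h2
        have := R.W_nl (ω := ω) (m1 := 1) (m2 := 1) (wf := 72/5) (w1 := 12) (w0 := 36/5) hk hkt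
          (R.lt_of_va hk hkt (by linarith)) (by push_cast; linarith)
          (l2 _ (by linarith)) (fun x hx _ => l1 x (by linarith)) (fun x _ => l0 x) (by norm_num) (by norm_num)
          (Or.inl (R.card_bin (m := 2) hk h2 (by push_cast; linarith)))
        push_cast at this; linarith
      · refine le_trans (hloss (18/5) (36/5) 0 (by norm_num) (by norm_num) (by norm_num) hB36 hM72 ?_) (by linarith)
        intro k hk h1 h2; exact (hT ⟨k, hk, h1, h2⟩).elim
    · refine le_trans (hloss 6 0 ℓT (by norm_num) (by norm_num) nT hB6 ?_ T1) (by linarith)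
      intro k hk h1 h2; exact (hM ⟨k, hk, h1, h2⟩).elim
  have key := R.master ω (216/5) (93/5) ?_ ?_ ?_ ?_ ?_ ?_ hloss12
  all_goals clear hloss12 e1 e2 nT nQ ntr
  · have hv := R.vol_B hs5
    have hd := R.dn
    have := l0 (v c)
    have h2 : (60:ℚ) * N.card ≤ 72 * D.card + 19 := by linarith
    have h3 : 60 * N.card ≤ 72 * D.card + 19 := by exact_mod_cast h2
    omega
  · intro p q r hp hqp hrq hsr hsum
    by_cases hp' : p ≤ σ/2
    · have := u1 p hp'
      have := u1 q (by linarith)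
      have := u2 r (by linarith)
      linarith
    have := u0 p
    by_cases hq : q ≤ 1/3
    · have := u2 r (by linarith)
      have := u2 q hq
      linarith
    · have := u1 q (by linarith)
      have := u3 r (by linarith)
      linarith
  · intro p q r t hp hqp hrq htr hst hsum
    have hr3 := u3 r (by by_contra hcon; linarith)
    have ht3 := u3 t (by by_contra hcon; linarith)
    by_cases hp' : p ≤ σ/2
    · have := u1 p hp'
      by_cases hp2 : p ≤ 1/3
      · have := u2 p hp2
        have := u2 q (by linarith)
        linarith
      by_cases hq : q ≤ σ/3
      · have := u3 q hq; linarith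
      have := u2 q (by linarith)
      have := u5 t (by linarith)
      have := u4 r (by linarith)
      linarith
    · have := u0 p
      have := u3 q (by linarith)
      have := u5 r (by linarith)
      have := u5 t (by linarith)
      linarith
  · intro p q r t u _ _ _ _ _ _ _
    have := u3 p (by linarith)
    have := u3 q (by linarith)
    have := u3 r (by linarith)
    have := u5 t (by linarith)
    have := u5 u (by linarith)
    linarith
  · intro k hk p q hLk hqp hsq hsum
    have hp := u2 p (by linarith)
    have hq := u4 q (by linarith)
    rcases R.two_or hk with ⟨x, hxV, hxk, hax, hx, hsum2⟩ | h3
    · rw [hx, sum_singleton]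
      by_cases c1 : 1/3 < v x
      · have := l2 _ c1; linarith
      by_cases c2 : σ/3 < v x
      · have h1 := noT k hk x hxV hx hLk c2 (by linarith)
        have := u3 p (by linarith)
        have := l1 _ c2
        linarith
      · have hxs := R.ge_s hxV
        have hm := mono p (v x) (by linarith) (by linarith)
        by_cases c3 : σ/4 < v x
        · have h1 := noQ k hk x hxV hx hLk (by linarith) (by linarith)
          have := u5 q (by linarith)
          linarith
        · have := u5 q (by linarith)
          linarith
    · have := R.erase_wt hk ω h3 (fun f _ => l0 (v f)) (by norm_num)
      linarith
  · exact lL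
  · intro p q hqp hsq hsum
    have hp := u2 p (by linarith)
    have hq := u4 q (by linarith)
    linarith

end FRed


namespace FRed
variable {v : ℕ → ℚ} {V : Finset ℕ} {c : ℕ} {g h : ℕ → ℕ} {D N : Finset ℕ} {a : ℕ → ℕ}

theorem Treg (R : FRed v V c g h D N a) {σ : ℚ} (hσ : σ = 1 - v c)
    (hT : ¬ NoT v V h N a σ) : v c < 1/4 ∧ ∃ τ, σ/3 < τ ∧ τ ≤ 1/3 ∧
      (∀ k ∈ N, 1/2 < v (a k) →
        ((∃ f ∈ (V.filter (fun f => h f = k)).erase (a k), τ ≤ v f) ∧ 1 < v (a k) + τ + v c) ∨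
        3 ≤ (V.filter (fun f => h f = k)).card ∨
        ∃ x, (V.filter (fun f => h f = k)).erase (a k) = {x} ∧ σ/2 < v x) ∧
      (∀ k ∈ N, v (a k) ≤ 1/2 → ∀ e ∈ V, h e = k → v e ≤ σ/2 → v e ≤ τ) := by
  classical
  have hs := R.s_gt
  set P : ℕ → Prop := fun k => ∃ x ∈ V, (V.filter (fun f => h f = k)).erase (a k) = {x} ∧ 1/2 < v (a k) ∧
    σ/3 < v x ∧ v x ≤ 1/3 ∧ v (a k) < 2*σ/3 with hP
  have hne : (N.filter P).Nonempty := by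
    unfold NoT at hT
    push Not at hT
    obtain ⟨k, hk, x, hx, h1, h2, h3, h4, h5⟩ := hT
    exact ⟨k, mem_filter.2 ⟨hk, x, hx, h1, h2, h3, h4, h5⟩⟩
  have hmax := Finset.le_max' (N.filter P)
  have hm := Finset.max'_mem _ hne
  set i := (N.filter P).max' hne with hi
  obtain ⟨hiN, x, hxV, hx, h1, h2, h3, h4⟩ := mem_filter.1 hm
  have hxm : x ∈ (V.filter (fun f => h f = i)).erase (a i) := by rw [hx]; simp
  have hxi : h x = i := (mem_filter.1 (mem_of_mem_erase hxm)).2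
  have hsum : 1 < v (a i) + v x + v c := by
    have := R.bin_sum hiN
    rw [← Finset.add_sum_erase _ _ (R.a_mem hiN), hx, sum_singleton] at this
    linarith
  have later : ∀ e ∈ V, i < h e → v e ≤ σ/2 → v e ≤ v x := by
    intro e he hlt hle
    exact R.anti x hxV e he (R.second_lt hiN he hlt (by linarith) hx).le
  refine ⟨by linarith, v x, h2, h3, ?_, ?_⟩
  · intro k hk hL
    have hL2 := R.le_12 (R.aV k hk)
    rcases lt_trichotomy k i with hki | hki | hki
    · left
      have := R.va_anti hk hiN hki.le
      obtain ⟨f, hf, hlt⟩ := R.ex_before hk hxV (by rw [hxi]; exact hki) (by linarith)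
      exact ⟨⟨f, hf, R.anti f (mem_filter.1 (mem_of_mem_erase hf)).1 x hxV hlt.le⟩, by linarith⟩
    · left; rw [hki]; exact ⟨⟨x, hxm, le_rfl⟩, hsum⟩
    · right
      have hva := R.va_anti hiN hk hki.le
      rcases R.two_or hk with ⟨x', hxV', hxk', hax', hx', hsum'⟩ | h3'
      · right
        refine ⟨x', hx', ?_⟩
        by_contra hcon
        have := later x' hxV' (by rw [hxk']; exact hki) (by linarith)
        have := hmax k (mem_filter.2 ⟨hk, x', hxV', hx', hL, by linarith, by linarith, by linarith⟩)
        omega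
      · left; exact h3'
  · intro k hk hk2 e he hek hle
    refine later e he ?_ hle
    rw [hek]
    exact R.lt_of_va hiN hk (by linarith)

set_option maxHeartbeats 1000000 in
theorem caseAT1 (R : FRed v V c g h D N a) {σ τ : ℚ} (hσ : σ = 1 - v c) (hs5 : 1/5 < v c)
    (hs4 : v c < 1/4) (ht1 : σ/3 < τ) (ht2 : τ ≤ 1/3)
    (hL : ∀ k ∈ N, 1/2 < v (a k) →
        ((∃ f ∈ (V.filter (fun f => h f = k)).erase (a k), τ ≤ v f) ∧ 1 < v (a k) + τ + v c) ∨
        3 ≤ (V.filter (fun f => h f = k)).card ∨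
        ∃ x, (V.filter (fun f => h f = k)).erase (a k) = {x} ∧ σ/2 < v x)
    (hM : ∀ k ∈ N, v (a k) ≤ 1/2 → ∀ e ∈ V, h e = k → v e ≤ σ/2 → v e ≤ τ)
    (hE : ∀ k ∈ N, ∀ x ∈ V, v (a k) ≤ 1/2 → σ/2 < v (a k) →
      (V.filter (fun f => h f = k)).erase (a k) = {x} → σ/2 < v x) : False := by
  obtain ⟨ω, hω⟩ : ∃ ω : ℚ → ℚ, ω = fun x => if 1/2 < x then 18 else if σ/2 < x then 18 else
    if τ ≤ x then 13 else if σ/3 < x then 12 else 9 := ⟨_, rfl⟩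
  have u0 : ∀ x, ω x ≤ 18 := by intro x; simp only [hω]; grind
  have u1 : ∀ x, x ≤ σ/2 → ω x ≤ 13 := by intro x hx; simp only [hω]; grind
  have u2 : ∀ x, x < τ → ω x ≤ 12 := by intro x hx; simp only [hω]; grind
  have u3 : ∀ x, x ≤ σ/3 → ω x ≤ 9 := by intro x hx; simp only [hω]; grind
  have l0 : ∀ x, 9 ≤ ω x := by intro x; simp only [hω]; grind
  have l1 : ∀ x, σ/3 < x → 12 ≤ ω x := by intro x hx; simp only [hω]; grind
  have l2 : ∀ x, τ ≤ x → 13 ≤ ω x := by intro x hx; simp only [hω]; grind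
  have l3 : ∀ x, σ/2 < x → 18 ≤ ω x := by intro x hx; simp only [hω]; grind
  have lL : ∀ p, 1/2 < p → ω p = 18 := by intro p hp; simp only [hω]; rw [if_pos hp]
  clear hω
  obtain ⟨ρ, hρ⟩ := exists_QS v N a σ
  have noM : ∀ k ∈ N, 1/3 < v (a k) → v (a k) ≤ σ/2 → False := by
    intro k hk h1 h2
    have := hM k hk (by linarith) (a k) (R.aV k hk) (R.ah k hk) h2
    linarith
  have hloss := R.loss_total ω hσ hρ (wl := 9) (wQ := 9) (wP := 9)
      (ℓB := 0) (ℓM := 0) (ℓT := 6) (ℓQ := 0) (ℓtr := 0)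
      (fun x _ _ _ => l0 x) (fun x _ _ => l0 x) (fun x _ => l0 x) le_rfl le_rfl (by norm_num) (by norm_num)
      (by norm_num) le_rfl le_rfl (by norm_num) le_rfl le_rfl
      (by
        intro k hk h1 h2
        rcases R.two_or hk with ⟨x, hxV, hxk, hax, hx, hsum⟩ | h3
        · rw [R.two_wt hk ω hx]
          have := l3 _ h1
          have := l3 _ (hE k hk x hxV h2 h1 hx)
          linarith
        · have := R.bin_wt' (ω := ω) (m := 2) (wf := 18) (w0 := 9) hk (l3 _ h1) (fun f _ => l0 _) (by norm_num) h3
          push_cast at this; linarith)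
      (by
        intro k hk k' hk' hlt h1 h2
        have := R.va_anti hk hk' hlt.le
        have := R.W_nl (ω := ω) (m1 := 1) (m2 := 0) (wf := 18) (w1 := 18) (w0 := 9) hk hk' hlt (by push_cast; linarith)
          (l3 _ (by linarith)) (fun x hx _ => l3 x (by linarith)) (fun x _ => l0 x) (by norm_num) (by norm_num)
          (Or.inr rfl)
        push_cast at this; linarith)
      (fun k hk h1 h2 => (noM k hk h1 h2).elim)
      (fun k hk k' hk' hlt h1 h2 => (noM k' hk' h2 (by linarith [R.va_anti hk hk' hlt.le])).elim)
      (by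
        intro k hk h1 h2
        have := R.bin_wt' (ω := ω) (m := 2) (wf := 12) (w0 := 9) hk (l1 _ h1) (fun f _ => l0 _) (by norm_num)
          (R.card_bin (m := 2) hk h2 (by push_cast; linarith))
        push_cast at this; linarith)
      (by
        intro k hk k' hk' hlt h1 h2
        have := R.va_anti hk hk' hlt.le
        have := R.W_nl (ω := ω) (m1 := 2) (m2 := 0) (wf := 12) (w1 := 12) (w0 := 9) hk hk' hlt (by push_cast; linarith)
          (l1 _ (by linarith)) (fun x hx _ => l1 x (by linarith)) (fun x _ => l0 x) (by norm_num) (by norm_num)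
          (Or.inr rfl)
        push_cast at this; linarith)
      (fun _ => by norm_num)
  have key := R.master ω 44 _ ?_ ?_ ?_ ?_ lL ?_ hloss
  all_goals clear hloss
  · have := l0 (v c)
    have h2 : (11:ℚ) * D.card ≤ 9 * N.card := by exact_mod_cast R.dn
    linarith
  · intro p q r hp hqp hrq hsr hsum
    have := u0 p
    have := u1 q (by linarith)
    have := u1 r (by linarith)
    linarith
  · intro p q r t hp hqp hrq htr hst hsum
    have := u1 p (by linarith)
    have := u1 q (by linarith)
    have := u3 r (by linarith)
    have := u3 t (by linarith)
    linarith
  · intro p q r t u _ _ _ _ _ _ _; linarith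
  · intro k hk p q hLk hqp hsq hsum
    have hq := u3 q (by linarith)
    rcases hL k hk hLk with ⟨⟨f, hf, hfv⟩, h1⟩ | h3 | ⟨x, hx, hx2⟩
    · have := u2 p (by linarith)
      have := l2 _ hfv
      have := R.erase_one ω hf (fun f _ => le_trans (by norm_num) (l0 (v f)))
      linarith
    · have hp := u1 p (by linarith)
      have := R.erase_wt hk ω h3 (fun f _ => l0 (v f)) (by norm_num)
      linarith
    · have hp := u1 p (by linarith)
      rw [hx, sum_singleton]
      have := l3 _ hx2
      linarith
  · intro p q hqp hsq hsum
    have hp := u1 p (by linarith)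
    have hq := u3 q (by linarith)
    linarith

set_option maxHeartbeats 1000000 in
theorem caseAT2 (R : FRed v V c g h D N a) {σ τ : ℚ} (hσ : σ = 1 - v c) (hs5 : 1/5 < v c)
    (hs4 : v c < 1/4) (ht1 : σ/3 < τ) (ht2 : τ ≤ 1/3)
    (hL : ∀ k ∈ N, 1/2 < v (a k) →
        ((∃ f ∈ (V.filter (fun f => h f = k)).erase (a k), τ ≤ v f) ∧ 1 < v (a k) + τ + v c) ∨
        3 ≤ (V.filter (fun f => h f = k)).card ∨
        ∃ x, (V.filter (fun f => h f = k)).erase (a k) = {x} ∧ σ/2 < v x)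
    (hM : ∀ k ∈ N, v (a k) ≤ 1/2 → ∀ e ∈ V, h e = k → v e ≤ σ/2 → v e ≤ τ)
    {kb yy : ℕ} (hkb : kb ∈ N) (hyy : yy ∈ V) (hb2 : v (a kb) ≤ 1/2) (hb1 : σ/2 < v (a kb))
    (hyE : (V.filter (fun f => h f = kb)).erase (a kb) = {yy}) (hy2 : v yy ≤ σ/2)
    (hyk : h yy = kb) (hysum : 1 < v (a kb) + v yy + v c) : False := by
  have hyτ := hM kb hkb hb2 yy hyy hyk hy2
  obtain ⟨β, hβ⟩ : ∃ β, β = v (a kb) := ⟨_, rfl⟩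
  obtain ⟨y, hy⟩ : ∃ y, y = v yy := ⟨_, rfl⟩
  rw [← hβ] at hb1 hb2 hysum
  rw [← hy] at hysum hyτ hy2
  obtain ⟨ω, hω⟩ : ∃ ω : ℚ → ℚ, ω = fun x => if 1/2 < x then 18 else if β ≤ x then 20 else
    if σ/2 < x then 16 else
    if y ≤ x then 14 else if σ/3 < x then 12 else 9 := ⟨_, rfl⟩
  have u00 : ∀ x, ω x ≤ 20 := by intro x; simp only [hω]; grind
  have u0 : ∀ x, x < β → ω x ≤ 16 := by intro x; simp only [hω]; grind
  have u1 : ∀ x, x ≤ σ/2 → ω x ≤ 14 := by intro x hx; simp only [hω]; grind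
  have u2 : ∀ x, x < y → ω x ≤ 12 := by intro x hx; simp only [hω]; grind
  have u3 : ∀ x, x ≤ σ/3 → ω x ≤ 9 := by intro x hx; simp only [hω]; grind
  have l0 : ∀ x, 9 ≤ ω x := by intro x; simp only [hω]; grind
  have l1 : ∀ x, σ/3 < x → 12 ≤ ω x := by intro x hx; simp only [hω]; grind
  have l2 : ∀ x, y ≤ x → 14 ≤ ω x := by intro x hx; simp only [hω]; grind
  have l3 : ∀ x, σ/2 < x → 16 ≤ ω x := by intro x hx; simp only [hω]; grind
  have l4 : ∀ x, β ≤ x → x ≤ 1/2 → 20 ≤ ω x := by intro x hx; simp only [hω]; grind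
  have lL : ∀ p, 1/2 < p → ω p = 18 := by intro p hp; simp only [hω]; rw [if_pos hp]
  clear hω
  obtain ⟨ρ, hρ⟩ := exists_QS v N a σ
  have noM : ∀ k ∈ N, 1/3 < v (a k) → v (a k) ≤ σ/2 → False := by
    intro k hk h1 h2
    have := hM k hk (by linarith) (a k) (R.aV k hk) (R.ah k hk) h2
    linarith
  have hlast : ∀ k ∈ N, σ/2 < v (a k) → v (a k) ≤ 1/2 → k ≤ kb := by
    intro k hk h1 h2
    by_contra hcon
    have := R.second_lt hkb (R.aV k hk) (by rw [R.ah k hk]; omega) (by linarith) hyE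
    have := R.anti _ hyy _ (R.aV k hk) this.le
    linarith
  have hB2 : ∀ k ∈ N, ∀ k' ∈ N, k < k' → v (a k) ≤ 1/2 → σ/2 < v (a k') →
      36 ≤ ∑ f ∈ V.filter (fun f => h f = k), ω (v f) := by
    intro k hk k' hk' hlt h1 h2
    have h5 := R.va_anti hk hk' hlt.le
    have h6 := R.va_anti hk' hkb (hlast k' hk' h2 (by linarith))
    have := R.W_nl (ω := ω) (m1 := 1) (m2 := 0) (wf := 20) (w1 := 20) (w0 := 9) hk hk' hlt (by push_cast; linarith)
      (l4 _ (by linarith) h1) (fun x hx hx2 => l4 x (by linarith) (by linarith)) (fun x _ => l0 x) (by norm_num) (by norm_num)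
      (Or.inr rfl)
    push_cast at this; linarith
  have hloss := R.loss_total ω hσ hρ (wl := 9) (wQ := 9) (wP := 9)
      (ℓB := 2) (ℓM := 0) (ℓT := 6) (ℓQ := 0) (ℓtr := 0)
      (fun x _ _ _ => l0 x) (fun x _ _ => l0 x) (fun x _ => l0 x) le_rfl le_rfl (by norm_num) (by norm_num)
      (by norm_num) (by norm_num) le_rfl (by norm_num) le_rfl le_rfl
      (by
        intro k hk h1 h2
        rcases (hlast k hk h1 h2).lt_or_eq with h3 | h3
        · have := hB2 k hk kb hkb h3 h2 (by linarith)
          linarith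
        · rw [h3, R.two_wt hkb ω hyE]
          have := l4 (v (a kb)) (by linarith) (by linarith)
          have := l2 (v yy) (by linarith)
          linarith)
      hB2
      (fun k hk h1 h2 => (noM k hk h1 h2).elim)
      (fun k hk k' hk' hlt h1 h2 => (noM k' hk' h2 (by linarith [R.va_anti hk hk' hlt.le])).elim)
      (by
        intro k hk h1 h2
        have := R.bin_wt' (ω := ω) (m := 2) (wf := 12) (w0 := 9) hk (l1 _ h1) (fun f _ => l0 _) (by norm_num)
          (R.card_bin (m := 2) hk h2 (by push_cast; linarith))
        push_cast at this; linarith)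
      (by
        intro k hk k' hk' hlt h1 h2
        have := R.va_anti hk hk' hlt.le
        have := R.W_nl (ω := ω) (m1 := 2) (m2 := 0) (wf := 12) (w1 := 12) (w0 := 9) hk hk' hlt (by push_cast; linarith)
          (l1 _ (by linarith)) (fun x hx _ => l1 x (by linarith)) (fun x _ => l0 x) (by norm_num) (by norm_num)
          (Or.inr rfl)
        push_cast at this; linarith)
      (fun _ => by norm_num)
  have key := R.master ω 44 _ ?_ ?_ ?_ ?_ lL ?_ hloss
  all_goals clear hloss
  · have := l0 (v c)
    have h2 : (11:ℚ) * D.card ≤ 9 * N.card := by exact_mod_cast R.dn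
    linarith
  · intro p q r hp hqp hrq hsr hsum
    by_cases hp1 : p ≤ σ/2
    · have := u1 p (by linarith)
      have := u1 q (by linarith)
      have := u1 r (by linarith)
      linarith
    by_cases hp2 : p < β
    · have := u0 p hp2
      have := u1 q (by linarith)
      have := u1 r (by linarith)
      linarith
    have := u00 p
    have := u2 q (by linarith)
    have := u2 r (by linarith)
    linarith
  · intro p q r t hp hqp hrq htr hst hsum
    have := u1 p (by linarith)
    have := u2 q (by linarith)
    have := u3 r (by linarith)
    have := u3 t (by linarith)
    linarith
  · intro p q r t u _ _ _ _ _ _ _; linarith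
  · intro k hk p q hLk hqp hsq hsum
    have hq := u3 q (by linarith)
    have hp := u2 p (by linarith)
    rcases hL k hk hLk with ⟨⟨f, hf, hfv⟩, h1⟩ | h3 | ⟨x, hx, hx2⟩
    · have := l2 (v f) (by linarith)
      have := R.erase_one ω hf (fun f _ => le_trans (by norm_num) (l0 (v f)))
      linarith
    · have := R.erase_wt hk ω h3 (fun f _ => l0 (v f)) (by norm_num)
      linarith
    · rw [hx, sum_singleton]
      have := l3 _ hx2
      linarith
  · intro p q hqp hsq hsum
    have hp := u2 p (by linarith)
    have hq := u3 q (by linarith)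
    linarith

end FRed


namespace FRed
variable {v : ℕ → ℚ} {V : Finset ℕ} {c : ℕ} {g h : ℕ → ℕ} {D N : Finset ℕ} {a : ℕ → ℕ}

theorem QS_num {σ ρ : ℚ} (hρ : QS v N a σ ρ) : ρ = 0 ∨ (σ/4 < ρ ∧ ρ ≤ σ/3) := by
  rcases hρ with h0 | ⟨kq, _, h1, h2, h3, _⟩
  · exact Or.inl h0.1
  · right; rw [h3]; exact ⟨h1, h2⟩

theorem lossBT (R : FRed v V c g h D N a) (ω : ℚ → ℚ) {σ ρ : ℚ} (hσ : σ = 1 - v c) (hs5 : v c ≤ 1/5)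
    (hρ : QS v N a σ ρ) (l0 : ∀ x, 42/5 ≤ ω x) (lQ : ∀ x, ρ ≤ x → σ/4 < x → 9 ≤ ω x)
    (ll : ∀ x, (1-ρ)/3 < x → ρ ≤ x → 46/5 ≤ ω x) (l1 : ∀ x, σ/3 < x → x ≤ 1/3 → 12 ≤ ω x)
    (noM : ∀ k ∈ N, 1/3 < v (a k) → v (a k) ≤ σ/2 → False)
    (B2 : ∀ k ∈ N, ∀ k' ∈ N, k < k' → v (a k) ≤ 1/2 → σ/2 < v (a k') →
      36 ≤ ∑ f ∈ V.filter (fun f => h f = k), ω (v f))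
    (B1 : ∀ k ∈ N, σ/2 < v (a k) → v (a k) ≤ 1/2 →
      36 ≤ ∑ f ∈ V.filter (fun f => h f = k), ω (v f) + 6/5)
    (B1' : ∀ kt ∈ N, σ/3 < v (a kt) → v (a kt) ≤ 1/3 → ∀ k ∈ N, σ/2 < v (a k) → v (a k) ≤ 1/2 →
      36 ≤ ∑ f ∈ V.filter (fun f => h f = k), ω (v f)) :
    ∑ k ∈ N, (if v (a k) ≤ 1/2 then 36 - ∑ f ∈ V.filter (fun f => h f = k), ω (v f) else 0)
      ≤ 41/5 := by
  have hs := R.s_gt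
  obtain ⟨ℓT, ℓQ, ℓtr, nT, nQ, ntr, T1, Q1, e1, e2⟩ : ∃ ℓT ℓQ ℓtr : ℚ, 0 ≤ ℓT ∧ 0 ≤ ℓQ ∧ 0 ≤ ℓtr ∧
      (∀ k ∈ N, σ/3 < v (a k) → v (a k) ≤ 1/3 → 36 ≤ ∑ f ∈ V.filter (fun f => h f = k), ω (v f) + ℓT) ∧
      ((∃ k ∈ N, σ/4 < v (a k) ∧ v (a k) ≤ σ/3) →
        36 ≤ 9 + 3 * (42/5) + ℓQ ∧ 36 ≤ 46/5 + 2 * 9 + 42/5 + ℓtr) ∧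
      ℓT + ℓQ + ℓtr ≤ 41/5 ∧ ℓQ + ℓtr ≤ 11/5 := by
    rcases hρ with ⟨_, hno⟩ | ⟨kq, hkq, hq1, hq2, hρ, hlast⟩
    · refine ⟨36/5, 0, 0, by norm_num, by norm_num, by norm_num, ?_,
        fun h => by obtain ⟨k, hk, h1, h2⟩ := h; exact (hno k hk h1 h2).elim, by norm_num, by norm_num⟩
      intro k hk h1 h2
      have := R.bin_wt' (ω := ω) (m := 2) (wf := 12) (w0 := 42/5) hk (l1 _ h1 h2) (fun f _ => l0 _) (by norm_num)
        (R.card_bin (m := 2) hk h2 (by push_cast; linarith))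
      push_cast at this; linarith
    · refine ⟨6, 9/5, 2/5, by norm_num, by norm_num, by norm_num, ?_, fun _ => by norm_num, by norm_num, by norm_num⟩
      intro k hk h1 h2
      have := R.W_nl (ω := ω) (m1 := 2) (m2 := 0) (wf := 12) (w1 := 9) (w0 := 42/5) hk hkq
        (R.lt_of_va hk hkq (by linarith)) (by push_cast; linarith)
        (l1 _ (by linarith) h2) (fun x hx _ => lQ x (by linarith) (by linarith)) (fun x _ => l0 x) (by norm_num) (by norm_num)
        (Or.inr rfl)
      push_cast at this; linarith
  have hloss : ∀ ℓB ℓT : ℚ, 0 ≤ ℓB → 0 ≤ ℓT → _ → _ → _ := 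
    fun ℓB ℓT nB nT B1 T1 => R.loss_total ω hσ hρ (wl := 46/5) (wQ := 9) (wP := 42/5)
      (ℓB := ℓB) (ℓM := 0) (ℓT := ℓT) (ℓQ := ℓQ) (ℓtr := ℓtr)
      (fun x h1 h2 _ => ll x h1 h2) lQ (fun x _ => l0 x) (by norm_num) (by norm_num) (by norm_num) (by norm_num)
      (by norm_num) nB le_rfl nT nQ ntr B1 B2
      (fun k hk h1 h2 => (noM k hk h1 h2).elim)
      (fun k hk k' hk' hlt h1 h2 => (noM k' hk' h2 (by linarith [R.va_anti hk hk' hlt.le])).elim)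
      T1
      (by
        intro k hk k' hk' hlt h1 h2
        have := R.va_anti hk hk' hlt.le
        have := R.W_nl (ω := ω) (m1 := 2) (m2 := 0) (wf := 12) (w1 := 12) (w0 := 42/5) hk hk' hlt (by push_cast; linarith)
          (l1 _ (by linarith) h1) (fun x hx hx2 => l1 x (by linarith) (by linarith)) (fun x _ => l0 x) (by norm_num) (by norm_num)
          (Or.inr rfl)
        push_cast at this; linarith)
      Q1
  by_cases hT : ∃ k ∈ N, σ/3 < v (a k) ∧ v (a k) ≤ 1/3
  · obtain ⟨kt, hkt, ht1, ht2⟩ := hT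
    refine le_trans (hloss 0 ℓT le_rfl nT ?_ T1) (by linarith)
    intro k hk h1 h2
    have := B1' kt hkt ht1 ht2 k hk h1 h2
    linarith
  · refine le_trans (hloss (6/5) 0 (by norm_num) le_rfl B1 ?_) (by linarith)
    intro k hk h1 h2; exact (hT ⟨k, hk, h1, h2⟩).elim

set_option maxHeartbeats 1000000 in
theorem caseBT1 (R : FRed v V c g h D N a) {σ τ : ℚ} (hσ : σ = 1 - v c) (hs5 : v c ≤ 1/5)
    (ht1 : σ/3 < τ) (ht2 : τ ≤ 1/3)
    (hL : ∀ k ∈ N, 1/2 < v (a k) →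
        ((∃ f ∈ (V.filter (fun f => h f = k)).erase (a k), τ ≤ v f) ∧ 1 < v (a k) + τ + v c) ∨
        3 ≤ (V.filter (fun f => h f = k)).card ∨
        ∃ x, (V.filter (fun f => h f = k)).erase (a k) = {x} ∧ σ/2 < v x)
    (hM : ∀ k ∈ N, v (a k) ≤ 1/2 → ∀ e ∈ V, h e = k → v e ≤ σ/2 → v e ≤ τ)
    (hE : ∀ k ∈ N, ∀ x ∈ V, v (a k) ≤ 1/2 → σ/2 < v (a k) →
      (V.filter (fun f => h f = k)).erase (a k) = {x} → σ/2 < v x) : False := by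
  have hs := R.s_gt
  obtain ⟨ρ, hρ⟩ := exists_QS v N a σ
  have hρn := QS_num hρ
  obtain ⟨ω, hω⟩ : ∃ ω : ℚ → ℚ, ω = fun x => if 1/2 < x then 18 else if σ/2 < x then 18 else
    if τ ≤ x then 13 else if σ/3 < x then 12 else if (1-ρ)/3 < x ∧ ρ ≤ x then 46/5 else
    if σ/4 < x ∧ ρ ≤ x then 9 else 42/5 := ⟨_, rfl⟩
  have u0 : ∀ x, ω x ≤ 18 := by intro x; simp only [hω]; grind
  have u1 : ∀ x, x ≤ σ/2 → ω x ≤ 13 := by intro x hx; simp only [hω]; grind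
  have u2 : ∀ x, x < τ → ω x ≤ 12 := by intro x hx; simp only [hω]; grind
  have u3 : ∀ x, x ≤ σ/3 → ω x ≤ 46/5 := by intro x hx; simp only [hω]; grind
  have u4 : ∀ x, x ≤ 1/4 → ω x ≤ 9 := by intro x hx; simp only [hω]; grind
  have u5 : ∀ x, x ≤ σ/4 → ω x ≤ 42/5 := by intro x hx; simp only [hω]; grind
  have u6 : ∀ x, x ≤ σ/3 → x ≤ (1-ρ)/3 → ω x ≤ 9 := by intro x hx; simp only [hω]; grind
  have u7 : ∀ x, x ≤ σ/3 → x < ρ → ω x ≤ 42/5 := by intro x hx; simp only [hω]; grind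
  have l0 : ∀ x, 42/5 ≤ ω x := by intro x; simp only [hω]; grind
  have lQ : ∀ x, ρ ≤ x → σ/4 < x → 9 ≤ ω x := by intro x hx; simp only [hω]; grind
  have ll : ∀ x, (1-ρ)/3 < x → ρ ≤ x → 46/5 ≤ ω x := by intro x hx hx2; simp only [hω]; grind
  have l1 : ∀ x, σ/3 < x → 12 ≤ ω x := by intro x hx; simp only [hω]; grind
  have l2 : ∀ x, τ ≤ x → 13 ≤ ω x := by intro x hx; simp only [hω]; grind
  have l3 : ∀ x, σ/2 < x → 18 ≤ ω x := by intro x hx; simp only [hω]; grind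
  have lL : ∀ p, 1/2 < p → ω p = 18 := by intro p hp; simp only [hω]; rw [if_pos hp]
  clear hω
  have noM : ∀ k ∈ N, 1/3 < v (a k) → v (a k) ≤ σ/2 → False := by
    intro k hk h1 h2
    have := hM k hk (by linarith) (a k) (R.aV k hk) (R.ah k hk) h2
    linarith
  have hloss := R.lossBT ω hσ hs5 hρ l0 lQ ll (fun x h1 _ => l1 x h1) noM
      (by
        intro k hk k' hk' hlt h1 h2
        have := R.va_anti hk hk' hlt.le
        have := R.W_nl (ω := ω) (m1 := 1) (m2 := 0) (wf := 18) (w1 := 18) (w0 := 42/5) hk hk' hlt (by push_cast; linarith)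
          (l3 _ (by linarith)) (fun x hx _ => l3 x (by linarith)) (fun x _ => l0 x) (by norm_num) (by norm_num)
          (Or.inr rfl)
        push_cast at this; linarith)
      (by
        intro k hk h1 h2
        rcases R.two_or hk with ⟨x, hxV, hxk, hax, hx, hsum⟩ | h3
        · rw [R.two_wt hk ω hx]
          have := l3 _ h1
          have := l3 _ (hE k hk x hxV h2 h1 hx)
          linarith
        · have := R.bin_wt' (ω := ω) (m := 2) (wf := 18) (w0 := 42/5) hk (l3 _ h1) (fun f _ => l0 _) (by norm_num) h3
          push_cast at this; linarith)
      (by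
        intro kt hkt ht1 ht2 k hk h1 h2
        rcases R.two_or hk with ⟨x, hxV, hxk, hax, hx, hsum⟩ | h3
        · rw [R.two_wt hk ω hx]
          have := l3 _ h1
          have := l3 _ (hE k hk x hxV h2 h1 hx)
          linarith
        · have := R.W_nl (ω := ω) (m1 := 1) (m2 := 1) (wf := 18) (w1 := 12) (w0 := 42/5) hk hkt
            (R.lt_of_va hk hkt (by linarith)) (by push_cast; linarith)
            (l3 _ h1) (fun x hx _ => l1 x (by linarith)) (fun x _ => l0 x) (by norm_num) (by norm_num)
            (Or.inl h3)
          push_cast at this; linarith)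
  have key := R.master ω 44 _ ?_ ?_ ?_ ?_ lL ?_ hloss
  all_goals clear hloss
  · have := l0 (v c)
    have h2 : (11:ℚ) * D.card ≤ 9 * N.card := by exact_mod_cast R.dn
    linarith
  · intro p q r hp hqp hrq hsr hsum
    have := u0 p
    have := u1 q (by linarith)
    have := u1 r (by linarith)
    linarith
  · intro p q r t hp hqp hrq htr hst hsum
    have hr : r ≤ σ/3 := by linarith
    by_cases hp1 : p ≤ σ/2
    · have := u1 p hp1
      by_cases hq1 : q ≤ σ/3
      · have := u3 q hq1
        have := u3 r hr
        have := u3 t (by linarith)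
        linarith
      have := u1 q (by linarith)
      by_cases hr1 : r ≤ (1-ρ)/3
      · have := u6 r hr hr1
        have := u6 t (by linarith) (by linarith)
        linarith
      · have := u3 r hr
        have : ω t ≤ 42/5 := by
          refine u7 t (by linarith) ?_
          rcases hρn with h0 | h0 <;> linarith
        linarith
    · have := u0 p
      have := u4 q (by linarith)
      have := u5 r (by linarith)
      have := u5 t (by linarith)
      linarith
  · intro p q r t u _ _ _ _ _ _ _
    have := u5 t (by linarith)
    have := u5 u (by linarith)
    by_cases hp : p ≤ 1/4
    · have := u4 p hp
      have := u4 q (by linarith)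
      have := u4 r (by linarith)
      linarith
    · have := u3 p (by linarith)
      have := u5 q (by linarith)
      have := u5 r (by linarith)
      linarith
  · intro k hk p q hLk hqp hsq hsum
    have hq := u4 q (by linarith)
    rcases hL k hk hLk with ⟨⟨f, hf, hfv⟩, h1⟩ | h3 | ⟨x, hx, hx2⟩
    · have := u2 p (by linarith)
      have := l2 _ hfv
      have := R.erase_one ω hf (fun f _ => le_trans (by norm_num) (l0 (v f)))
      linarith
    · have hp := u1 p (by linarith)
      have := R.erase_wt hk ω h3 (fun f _ => l0 (v f)) (by norm_num)
      linarith
    · have hp := u1 p (by linarith)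
      rw [hx, sum_singleton]
      have := l3 _ hx2
      linarith
  · intro p q hqp hsq hsum
    have hp := u1 p (by linarith)
    have hq := u4 q (by linarith)
    linarith

set_option maxHeartbeats 1000000 in
theorem caseBT2 (R : FRed v V c g h D N a) {σ τ : ℚ} (hσ : σ = 1 - v c) (hs5 : v c ≤ 1/5)
    (ht2 : τ ≤ 1/3)
    (hL : ∀ k ∈ N, 1/2 < v (a k) →
        ((∃ f ∈ (V.filter (fun f => h f = k)).erase (a k), τ ≤ v f) ∧ 1 < v (a k) + τ + v c) ∨
        3 ≤ (V.filter (fun f => h f = k)).card ∨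
        ∃ x, (V.filter (fun f => h f = k)).erase (a k) = {x} ∧ σ/2 < v x)
    (hM : ∀ k ∈ N, v (a k) ≤ 1/2 → ∀ e ∈ V, h e = k → v e ≤ σ/2 → v e ≤ τ)
    {kb yy : ℕ} (hkb : kb ∈ N) (hyy : yy ∈ V) (hb2 : v (a kb) ≤ 1/2) (hb1 : σ/2 < v (a kb))
    (hyE : (V.filter (fun f => h f = kb)).erase (a kb) = {yy}) (hy2 : v yy ≤ σ/2)
    (hyk : h yy = kb) (hysum : 1 < v (a kb) + v yy + v c) : False := by
  have hs := R.s_gt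
  have hyτ := hM kb hkb hb2 yy hyy hyk hy2
  obtain ⟨β, hβ⟩ : ∃ β, β = v (a kb) := ⟨_, rfl⟩
  obtain ⟨y, hy⟩ : ∃ y, y = v yy := ⟨_, rfl⟩
  rw [← hβ] at hb1 hb2 hysum
  rw [← hy] at hysum hyτ hy2
  obtain ⟨ρ, hρ⟩ := exists_QS v N a σ
  have hρn := QS_num hρ
  obtain ⟨ω, hω⟩ : ∃ ω : ℚ → ℚ, ω = fun x => if 1/2 < x then 18 else if β ≤ x then 114/5 else
    if σ/2 < x then 18 else
    if y ≤ x then 14 else if σ/3 < x then 12 else if (1-ρ)/3 < x ∧ ρ ≤ x then 46/5 else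
    if σ/4 < x ∧ ρ ≤ x then 9 else 42/5 := ⟨_, rfl⟩
  have u00 : ∀ x, ω x ≤ 114/5 := by intro x; simp only [hω]; grind
  have u0 : ∀ x, x < β → ω x ≤ 18 := by intro x; simp only [hω]; grind
  have u1 : ∀ x, x ≤ σ/2 → ω x ≤ 14 := by intro x hx; simp only [hω]; grind
  have u2 : ∀ x, x < y → ω x ≤ 12 := by intro x hx; simp only [hω]; grind
  have u3 : ∀ x, x ≤ σ/3 → ω x ≤ 46/5 := by intro x hx; simp only [hω]; grind
  have u4 : ∀ x, x ≤ 1/4 → ω x ≤ 9 := by intro x hx; simp only [hω]; grind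
  have u5 : ∀ x, x ≤ σ/4 → ω x ≤ 42/5 := by intro x hx; simp only [hω]; grind
  have u6 : ∀ x, x ≤ σ/3 → x ≤ (1-ρ)/3 → ω x ≤ 9 := by intro x hx; simp only [hω]; grind
  have u7 : ∀ x, x ≤ σ/3 → x < ρ → ω x ≤ 42/5 := by intro x hx; simp only [hω]; grind
  have l0 : ∀ x, 42/5 ≤ ω x := by intro x; simp only [hω]; grind
  have lQ : ∀ x, ρ ≤ x → σ/4 < x → 9 ≤ ω x := by intro x hx; simp only [hω]; grind
  have ll : ∀ x, (1-ρ)/3 < x → ρ ≤ x → 46/5 ≤ ω x := by intro x hx hx2; simp only [hω]; grind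
  have l1 : ∀ x, σ/3 < x → 12 ≤ ω x := by intro x hx; simp only [hω]; grind
  have l2 : ∀ x, y ≤ x → 14 ≤ ω x := by intro x hx; simp only [hω]; grind
  have l3 : ∀ x, σ/2 < x → 18 ≤ ω x := by intro x hx; simp only [hω]; grind
  have l4 : ∀ x, β ≤ x → x ≤ 1/2 → 114/5 ≤ ω x := by intro x hx; simp only [hω]; grind
  have lL : ∀ p, 1/2 < p → ω p = 18 := by intro p hp; simp only [hω]; rw [if_pos hp]
  clear hω
  have noM : ∀ k ∈ N, 1/3 < v (a k) → v (a k) ≤ σ/2 → False := by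
    intro k hk h1 h2
    have := hM k hk (by linarith) (a k) (R.aV k hk) (R.ah k hk) h2
    linarith
  have hlast : ∀ k ∈ N, σ/2 < v (a k) → v (a k) ≤ 1/2 → k ≤ kb := by
    intro k hk h1 h2
    by_contra hcon
    have := R.second_lt hkb (R.aV k hk) (by rw [R.ah k hk]; omega) (by linarith) hyE
    have := R.anti _ hyy _ (R.aV k hk) this.le
    linarith
  have hB2 : ∀ k ∈ N, ∀ k' ∈ N, k < k' → v (a k) ≤ 1/2 → σ/2 < v (a k') →
      36 ≤ ∑ f ∈ V.filter (fun f => h f = k), ω (v f) := by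
    intro k hk k' hk' hlt h1 h2
    have h5 := R.va_anti hk hk' hlt.le
    have h6 := R.va_anti hk' hkb (hlast k' hk' h2 (by linarith))
    have := R.W_nl (ω := ω) (m1 := 1) (m2 := 0) (wf := 18) (w1 := 18) (w0 := 42/5) hk hk' hlt (by push_cast; linarith)
      (l3 _ (by linarith)) (fun x hx hx2 => l3 x (by linarith)) (fun x _ => l0 x) (by norm_num) (by norm_num)
      (Or.inr rfl)
    push_cast at this; linarith
  have hB1 : ∀ k ∈ N, σ/2 < v (a k) → v (a k) ≤ 1/2 →
      36 ≤ ∑ f ∈ V.filter (fun f => h f = k), ω (v f) := by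
    intro k hk h1 h2
    rcases (hlast k hk h1 h2).lt_or_eq with h3 | h3
    · exact hB2 k hk kb hkb h3 h2 (by linarith)
    · rw [h3, R.two_wt hkb ω hyE]
      have := l4 (v (a kb)) (by linarith) (by linarith)
      have := l2 (v yy) (by linarith)
      linarith
  have hloss := R.lossBT ω hσ hs5 hρ l0 lQ ll (fun x h1 _ => l1 x h1) noM hB2
    (fun k hk h1 h2 => by linarith [hB1 k hk h1 h2])
    (fun _ _ _ _ k hk h1 h2 => hB1 k hk h1 h2)
  have key := R.master ω 44 _ ?_ ?_ ?_ ?_ lL ?_ hloss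
  all_goals clear hloss
  · have := l0 (v c)
    have h2 : (11:ℚ) * D.card ≤ 9 * N.card := by exact_mod_cast R.dn
    linarith
  · intro p q r hp hqp hrq hsr hsum
    by_cases hp1 : p ≤ σ/2
    · have := u1 p (by linarith)
      have := u1 q (by linarith)
      have := u1 r (by linarith)
      linarith
    by_cases hp2 : p < β
    · have := u0 p hp2
      have := u1 q (by linarith)
      have := u2 r (by linarith)
      linarith
    have := u00 p
    have := u2 q (by linarith)
    have := u3 r (by linarith)
    linarith
  · intro p q r t hp hqp hrq htr hst hsum
    have hr : r ≤ σ/3 := by linarith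
    by_cases hp1 : p ≤ σ/2
    · have := u1 p hp1
      by_cases hq1 : q ≤ σ/3
      · have := u3 q hq1
        have := u3 r hr
        have := u3 t (by linarith)
        linarith
      have := u2 q (by linarith)
      by_cases hr1 : r ≤ (1-ρ)/3
      · have := u6 r hr hr1
        have := u6 t (by linarith) (by linarith)
        linarith
      · have := u3 r hr
        have : ω t ≤ 42/5 := by
          refine u7 t (by linarith) ?_
          rcases hρn with h0 | h0 <;> linarith
        linarith
    · have := u0 p (by linarith)
      have := u4 q (by linarith)
      have := u5 r (by linarith)
      have := u5 t (by linarith)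
      linarith
  · intro p q r t u _ _ _ _ _ _ _
    have := u5 t (by linarith)
    have := u5 u (by linarith)
    by_cases hp : p ≤ 1/4
    · have := u4 p hp
      have := u4 q (by linarith)
      have := u4 r (by linarith)
      linarith
    · have := u3 p (by linarith)
      have := u5 q (by linarith)
      have := u5 r (by linarith)
      linarith
  · intro k hk p q hLk hqp hsq hsum
    have hq := u4 q (by linarith)
    have hp := u2 p (by linarith)
    rcases hL k hk hLk with ⟨⟨f, hf, hfv⟩, h1⟩ | h3 | ⟨x, hx, hx2⟩
    · have := l2 (v f) (by linarith)
      have := R.erase_one ω hf (fun f _ => le_trans (by norm_num) (l0 (v f)))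
      linarith
    · have := R.erase_wt hk ω h3 (fun f _ => l0 (v f)) (by norm_num)
      linarith
    · rw [hx, sum_singleton]
      have := l3 _ hx2
      linarith
  · intro p q hqp hsq hsum
    have hp := u2 p (by linarith)
    have hq := u4 q (by linarith)
    linarith

theorem caseT (R : FRed v V c g h D N a) {σ : ℚ} (hσ : σ = 1 - v c)
    (hT : ¬ NoT v V h N a σ) : False := by
  obtain ⟨hs4, τ, ht1, ht2, hL, hM⟩ := R.Treg hσ hT
  by_cases hE : ∀ k ∈ N, ∀ x ∈ V, v (a k) ≤ 1/2 → σ/2 < v (a k) →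
      (V.filter (fun f => h f = k)).erase (a k) = {x} → σ/2 < v x
  · by_cases hs5 : v c ≤ 1/5
    · exact R.caseBT1 hσ hs5 ht1 ht2 hL hM hE
    · exact R.caseAT1 hσ (not_le.1 hs5) hs4 ht1 ht2 hL hM hE
  · push Not at hE
    obtain ⟨kb, hkb, y, hy, hb2, hb1, hyE, hy2⟩ := hE
    have hxm : y ∈ (V.filter (fun f => h f = kb)).erase (a kb) := by rw [hyE]; simp
    have hyk : h y = kb := (mem_filter.1 (mem_of_mem_erase hxm)).2
    have hsum : 1 < v (a kb) + v y + v c := by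
      have := R.bin_sum hkb
      rw [← Finset.add_sum_erase _ _ (R.a_mem hkb), hyE, sum_singleton] at this
      linarith
    by_cases hs5 : v c ≤ 1/5
    · exact R.caseBT2 hσ hs5 ht2 hL hM hkb hy hb2 hb1 hyE hy2 hyk hsum
    · exact R.caseAT2 hσ (not_le.1 hs5) hs4 ht1 ht2 hL hM hkb hy hb2 hb1 hyE hy2 hyk hsum

end FRed


namespace FRed
variable {v : ℕ → ℚ} {V : Finset ℕ} {c : ℕ} {g h : ℕ → ℕ} {D N : Finset ℕ} {a : ℕ → ℕ}

theorem Qreg (R : FRed v V c g h D N a) {σ : ℚ} (hσ : σ = 1 - v c)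
    (hQ : ¬ NoQ v V h N a σ) : v c ≤ 1/4 ∧ ∃ τ, σ/4 < τ ∧ τ ≤ σ/3 ∧ 1/2 - 3/2 * v c < τ ∧
      (∀ k ∈ N, 1/2 < v (a k) →
        ((∃ f ∈ (V.filter (fun f => h f = k)).erase (a k), τ ≤ v f) ∧ 1 < v (a k) + τ + v c) ∨
        3 ≤ (V.filter (fun f => h f = k)).card ∨
        ∃ x, (V.filter (fun f => h f = k)).erase (a k) = {x} ∧
          (σ/2 < v x ∨ (v c ≤ v x ∧ v x ≤ σ/4 ∧ 1 < v (a k) + v x + v c))) ∧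
      (∀ k ∈ N, v (a k) ≤ 1/2 → ∀ e ∈ V, h e = k → v e ≤ σ/2 → v e ≤ τ) := by
  classical
  have hs := R.s_gt
  set P : ℕ → Prop := fun k => ∃ x ∈ V, (V.filter (fun f => h f = k)).erase (a k) = {x} ∧ 1/2 < v (a k) ∧
    σ/4 < v x ∧ v x ≤ σ/3 ∧ v (a k) < 1 - σ/2 with hP
  have hne : (N.filter P).Nonempty := by
    unfold NoQ at hQ
    push Not at hQ
    obtain ⟨k, hk, x, hx, h1, h2, h3, h4, h5⟩ := hQ
    exact ⟨k, mem_filter.2 ⟨hk, x, hx, h1, h2, h3, h4, h5⟩⟩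
  have hmax := Finset.le_max' (N.filter P)
  have hm := Finset.max'_mem _ hne
  set i := (N.filter P).max' hne with hi
  obtain ⟨hiN, x, hxV, hx, h1, h2, h3, h4⟩ := mem_filter.1 hm
  have hxm : x ∈ (V.filter (fun f => h f = i)).erase (a i) := by rw [hx]; simp
  have hxi : h x = i := (mem_filter.1 (mem_of_mem_erase hxm)).2
  have hsum : 1 < v (a i) + v x + v c := by
    have := R.bin_sum hiN
    rw [← Finset.add_sum_erase _ _ (R.a_mem hiN), hx, sum_singleton] at this
    linarith
  have later : ∀ e ∈ V, i < h e → v e ≤ σ/2 → v e ≤ v x := by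
    intro e he hlt hle
    exact R.anti x hxV e he (R.second_lt hiN he hlt (by linarith) hx).le
  have hxs := R.ge_s hxV
  refine ⟨by linarith, v x, h2, h3, by linarith, ?_, ?_⟩
  · intro k hk hL
    have hL2 := R.le_12 (R.aV k hk)
    rcases lt_trichotomy k i with hki | hki | hki
    · left
      have := R.va_anti hk hiN hki.le
      obtain ⟨f, hf, hlt⟩ := R.ex_before hk hxV (by rw [hxi]; exact hki) (by linarith)
      exact ⟨⟨f, hf, R.anti f (mem_filter.1 (mem_of_mem_erase hf)).1 x hxV hlt.le⟩, by linarith⟩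
    · left; rw [hki]; exact ⟨⟨x, hxm, le_rfl⟩, hsum⟩
    · right
      have hva := R.va_anti hiN hk hki.le
      rcases R.two_or hk with ⟨x', hxV', hxk', hax', hx', hsum'⟩ | h3'
      · right
        refine ⟨x', hx', ?_⟩
        by_contra hcon
        push Not at hcon
        have := later x' hxV' (by rw [hxk']; exact hki) hcon.1
        have h7 : σ/4 < v x' := by
          by_contra h8
          have := hcon.2 (R.ge_s hxV') (not_lt.1 h8)
          linarith
        have := hmax k (mem_filter.2 ⟨hk, x', hxV', hx', hL, by linarith, by linarith, by linarith⟩)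
        omega
      · left; exact h3'
  · intro k hk hk2 e he hek hle
    refine later e he ?_ hle
    rw [hek]
    exact R.lt_of_va hiN hk (by linarith)

set_option maxHeartbeats 1000000 in
theorem caseAQ (R : FRed v V c g h D N a) {σ τ : ℚ} (hσ : σ = 1 - v c) (hs5 : 1/5 < v c)
    (hs4 : v c ≤ 1/4) (ht2 : τ ≤ σ/3)
    (hL : ∀ k ∈ N, 1/2 < v (a k) →
        ((∃ f ∈ (V.filter (fun f => h f = k)).erase (a k), τ ≤ v f) ∧ 1 < v (a k) + τ + v c) ∨
        3 ≤ (V.filter (fun f => h f = k)).card ∨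
        ∃ x, (V.filter (fun f => h f = k)).erase (a k) = {x} ∧
          (σ/2 < v x ∨ (v c ≤ v x ∧ v x ≤ σ/4 ∧ 1 < v (a k) + v x + v c)))
    (hM : ∀ k ∈ N, v (a k) ≤ 1/2 → ∀ e ∈ V, h e = k → v e ≤ σ/2 → v e ≤ τ) : False := by
  obtain ⟨ω, hω⟩ : ∃ ω : ℚ → ℚ, ω = fun x => if 1/2 < x then 18 else if σ/2 < x then 18 else
    if τ ≤ x then 10 else 9 := ⟨_, rfl⟩
  have u0 : ∀ x, ω x ≤ 18 := by intro x; simp only [hω]; grind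
  have u1 : ∀ x, x ≤ σ/2 → ω x ≤ 10 := by intro x hx; simp only [hω]; grind
  have u2 : ∀ x, x < τ → ω x ≤ 9 := by intro x hx; simp only [hω]; grind
  have l0 : ∀ x, 9 ≤ ω x := by intro x; simp only [hω]; grind
  have l2 : ∀ x, τ ≤ x → 10 ≤ ω x := by intro x hx; simp only [hω]; grind
  have l3 : ∀ x, σ/2 < x → 18 ≤ ω x := by intro x hx; simp only [hω]; grind
  have lL : ∀ p, 1/2 < p → ω p = 18 := by intro p hp; simp only [hω]; rw [if_pos hp]
  clear hω
  obtain ⟨ρ, hρ⟩ := exists_QS v N a σ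
  have noM : ∀ k ∈ N, σ/3 < v (a k) → v (a k) ≤ σ/2 → False := by
    intro k hk h1 h2
    have := hM k hk (by linarith) (a k) (R.aV k hk) (R.ah k hk) h2
    linarith
  have hloss := R.loss_total ω hσ hρ (wl := 9) (wQ := 9) (wP := 9)
      (ℓB := 0) (ℓM := 0) (ℓT := 0) (ℓQ := 0) (ℓtr := 0)
      (fun x _ _ _ => l0 x) (fun x _ _ => l0 x) (fun x _ => l0 x) le_rfl le_rfl (by norm_num) (by norm_num)
      (by norm_num) le_rfl le_rfl le_rfl le_rfl le_rfl
      (by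
        intro k hk h1 h2
        rcases R.two_or hk with ⟨x, hxV, hxk, hax, hx, hsum⟩ | h3
        · rw [R.two_wt hk ω hx]
          have := l3 _ h1
          have : σ/2 < v x := by
            by_contra hcon
            have := hM k hk h2 x hxV hxk (not_lt.1 hcon)
            linarith
          have := l3 _ this
          linarith
        · have := R.bin_wt' (ω := ω) (m := 2) (wf := 18) (w0 := 9) hk (l3 _ h1) (fun f _ => l0 _) (by norm_num) h3
          push_cast at this; linarith)
      (by
        intro k hk k' hk' hlt h1 h2
        have := R.va_anti hk hk' hlt.le
        have := R.W_nl (ω := ω) (m1 := 1) (m2 := 0) (wf := 18) (w1 := 18) (w0 := 9) hk hk' hlt (by push_cast; linarith)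
          (l3 _ (by linarith)) (fun x hx _ => l3 x (by linarith)) (fun x _ => l0 x) (by norm_num) (by norm_num)
          (Or.inr rfl)
        push_cast at this; linarith)
      (fun k hk h1 h2 => (noM k hk (by linarith) h2).elim)
      (fun k hk k' hk' hlt h1 h2 => (noM k' hk' (by linarith) (by linarith [R.va_anti hk hk' hlt.le])).elim)
      (fun k hk h1 h2 => (noM k hk (by linarith) (by linarith)).elim)
      (fun k hk k' hk' hlt h1 h2 => (noM k' hk' (by linarith) (by linarith [R.va_anti hk hk' hlt.le])).elim)
      (fun _ => by norm_num)
  have key := R.master ω 44 _ ?_ ?_ ?_ ?_ lL ?_ hloss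
  all_goals clear hloss
  · have := l0 (v c)
    have h2 : (11:ℚ) * D.card ≤ 9 * N.card := by exact_mod_cast R.dn
    linarith
  · intro p q r hp hqp hrq hsr hsum
    have := u0 p
    have := u1 q (by linarith)
    have := u1 r (by linarith)
    linarith
  · intro p q r t hp hqp hrq htr hst hsum
    have := u1 p (by linarith)
    have := u1 q (by linarith)
    have := u1 r (by linarith)
    have := u1 t (by linarith)
    linarith
  · intro p q r t u _ _ _ _ _ _ _; linarith
  · intro k hk p q hLk hqp hsq hsum
    rcases hL k hk hLk with ⟨⟨f, hf, hfv⟩, h1⟩ | h3 | ⟨x, hx, hx2 | hx2⟩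
    · have := u2 p (by linarith)
      have := u2 q (by linarith)
      have := l2 _ hfv
      have := R.erase_one ω hf (fun f _ => le_trans (by norm_num) (l0 (v f)))
      linarith
    · have hp := u1 p (by linarith)
      have hq := u1 q (by linarith)
      have := R.erase_wt hk ω h3 (fun f _ => l0 (v f)) (by norm_num)
      linarith
    · have hp := u1 p (by linarith)
      have hq := u1 q (by linarith)
      rw [hx, sum_singleton]
      have := l3 _ hx2
      linarith
    · linarith
  · intro p q hqp hsq hsum
    have hp := u1 p (by linarith)
    have hq := u1 q (by linarith)
    linarith

set_option maxHeartbeats 1000000 in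
theorem caseBQ (R : FRed v V c g h D N a) {σ τ : ℚ} (hσ : σ = 1 - v c) (hs5 : v c ≤ 1/5)
    (ht1 : σ/4 < τ) (ht2 : τ ≤ σ/3) (ht3 : 1/2 - 3/2 * v c < τ)
    (hL : ∀ k ∈ N, 1/2 < v (a k) →
        ((∃ f ∈ (V.filter (fun f => h f = k)).erase (a k), τ ≤ v f) ∧ 1 < v (a k) + τ + v c) ∨
        3 ≤ (V.filter (fun f => h f = k)).card ∨
        ∃ x, (V.filter (fun f => h f = k)).erase (a k) = {x} ∧
          (σ/2 < v x ∨ (v c ≤ v x ∧ v x ≤ σ/4 ∧ 1 < v (a k) + v x + v c)))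
    (hM : ∀ k ∈ N, v (a k) ≤ 1/2 → ∀ e ∈ V, h e = k → v e ≤ σ/2 → v e ≤ τ) : False := by
  have hs := R.s_gt
  obtain ⟨ρ, hρ⟩ := exists_QS v N a σ
  obtain ⟨H, hH⟩ : ∃ H : ℚ, (τ ≤ 1/4 ∧ H = 10) ∨ (1/4 < τ ∧ H = 11) := by
    by_cases h1 : τ ≤ 1/4
    · exact ⟨10, Or.inl ⟨h1, rfl⟩⟩
    · exact ⟨11, Or.inr ⟨not_le.1 h1, rfl⟩⟩
  obtain ⟨ω, hω⟩ : ∃ ω : ℚ → ℚ, ω = fun x => if 1/2 < x then 18 else if σ/2 < x then 18 else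
    if τ ≤ x then H else if (1-ρ)/3 < x ∧ ρ ≤ x then 19/2 else
    if σ/4 < x then 9 else 15/2 := ⟨_, rfl⟩
  have hH1 : 10 ≤ H := by rcases hH with h1 | h1 <;> linarith
  have hH2 : H ≤ 11 := by rcases hH with h1 | h1 <;> linarith
  have u0 : ∀ x, ω x ≤ 18 := by intro x; simp only [hω]; grind
  have u1 : ∀ x, x ≤ σ/2 → ω x ≤ H := by intro x hx; simp only [hω]; grind
  have u2 : ∀ x, x < τ → ω x ≤ 19/2 := by intro x hx; simp only [hω]; grind
  have u4 : ∀ x, x ≤ 1/4 → x < τ → ω x ≤ 9 := by intro x hx; simp only [hω]; grind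
  have u5 : ∀ x, x ≤ σ/4 → ω x ≤ 15/2 := by intro x hx; simp only [hω]; grind
  have l0 : ∀ x, 15/2 ≤ ω x := by intro x; simp only [hω]; grind
  have lQ : ∀ x, σ/4 < x → 9 ≤ ω x := by intro x hx; simp only [hω]; grind
  have ll : ∀ x, (1-ρ)/3 < x → ρ ≤ x → 19/2 ≤ ω x := by intro x hx hx2; simp only [hω]; grind
  have l2 : ∀ x, τ ≤ x → H ≤ ω x := by intro x hx; simp only [hω]; grind
  have l3 : ∀ x, σ/2 < x → 18 ≤ ω x := by intro x hx; simp only [hω]; grind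
  have lL : ∀ p, 1/2 < p → ω p = 18 := by intro p hp; simp only [hω]; rw [if_pos hp]
  clear hω
  have noM : ∀ k ∈ N, σ/3 < v (a k) → v (a k) ≤ σ/2 → False := by
    intro k hk h1 h2
    have := hM k hk (by linarith) (a k) (R.aV k hk) (R.ah k hk) h2
    linarith
  have hBB : ∀ k ∈ N, σ/2 < v (a k) → v (a k) ≤ 1/2 →
      36 ≤ ∑ f ∈ V.filter (fun f => h f = k), ω (v f) ∨ 3 ≤ (V.filter (fun f => h f = k)).card := by
    intro k hk h1 h2
    rcases R.two_or hk with ⟨x, hxV, hxk, hax, hx, hsum⟩ | h3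
    · left
      rw [R.two_wt hk ω hx]
      have := l3 _ h1
      have : σ/2 < v x := by
        by_contra hcon
        have := hM k hk h2 x hxV hxk (not_lt.1 hcon)
        linarith
      have := l3 _ this
      linarith
    · exact Or.inr h3
  obtain ⟨ℓB, ℓQ, ℓtr, nB, nQ, ntr, B1, Q1, e1⟩ : ∃ ℓB ℓQ ℓtr : ℚ, 0 ≤ ℓB ∧ 0 ≤ ℓQ ∧ 0 ≤ ℓtr ∧
      (∀ k ∈ N, σ/2 < v (a k) → v (a k) ≤ 1/2 → 36 ≤ ∑ f ∈ V.filter (fun f => h f = k), ω (v f) + ℓB) ∧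
      ((∃ k ∈ N, σ/4 < v (a k) ∧ v (a k) ≤ σ/3) →
        36 ≤ 9 + 3 * (15/2) + ℓQ ∧ 36 ≤ 19/2 + 2 * 9 + 15/2 + ℓtr) ∧
      ℓB + ℓQ + ℓtr ≤ 7 := by
    by_cases hQ : ∃ k ∈ N, σ/4 < v (a k) ∧ v (a k) ≤ σ/3
    · refine ⟨3/2, 9/2, 1, by norm_num, by norm_num, by norm_num, ?_, fun _ => by norm_num, by norm_num⟩
      obtain ⟨kq, hkq, hq1, hq2⟩ := hQ
      intro k hk h1 h2
      rcases hBB k hk h1 h2 with h3 | h3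
      · linarith
      have := R.W_nl (ω := ω) (m1 := 1) (m2 := 1) (wf := 18) (w1 := 9) (w0 := 15/2) hk hkq
        (R.lt_of_va hk hkq (by linarith)) (by push_cast; linarith)
        (l3 _ (by linarith)) (fun x hx _ => lQ x (by linarith)) (fun x _ => l0 x) (by norm_num) (by norm_num)
        (Or.inl h3)
      push_cast at this; linarith
    · refine ⟨3, 0, 0, by norm_num, by norm_num, by norm_num, ?_, fun h => (hQ h).elim, by norm_num⟩
      intro k hk h1 h2
      rcases hBB k hk h1 h2 with h3 | h3
      · linarith
      have := R.bin_wt' (ω := ω) (m := 2) (wf := 18) (w0 := 15/2) hk (l3 _ h1) (fun f _ => l0 _) (by norm_num) h3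
      push_cast at this; linarith
  have hloss := R.loss_total ω hσ hρ (wl := 19/2) (wQ := 9) (wP := 15/2)
      (ℓB := ℓB) (ℓM := 0) (ℓT := 0) (ℓQ := ℓQ) (ℓtr := ℓtr)
      (fun x h1 h2 _ => ll x h1 h2) (fun x _ => lQ x) (fun x _ => l0 x) (by norm_num) (by norm_num) (by norm_num) (by norm_num)
      (by norm_num) nB le_rfl le_rfl nQ ntr
      B1
      (by
        intro k hk k' hk' hlt h1 h2
        have := R.va_anti hk hk' hlt.le
        have := R.W_nl (ω := ω) (m1 := 1) (m2 := 0) (wf := 18) (w1 := 18) (w0 := 15/2) hk hk' hlt (by push_cast; linarith)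
          (l3 _ (by linarith)) (fun x hx _ => l3 x (by linarith)) (fun x _ => l0 x) (by norm_num) (by norm_num)
          (Or.inr rfl)
        push_cast at this; linarith)
      (fun k hk h1 h2 => (noM k hk (by linarith) h2).elim)
      (fun k hk k' hk' hlt h1 h2 => (noM k' hk' (by linarith) (by linarith [R.va_anti hk hk' hlt.le])).elim)
      (fun k hk h1 h2 => (noM k hk (by linarith) (by linarith)).elim)
      (fun k hk k' hk' hlt h1 h2 => (noM k' hk' (by linarith) (by linarith [R.va_anti hk hk' hlt.le])).elim)
      Q1
  have key := R.master ω 44 _ ?_ ?_ ?_ ?_ lL ?_ hloss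
  all_goals clear hloss
  · have := l0 (v c)
    have h2 : (11:ℚ) * D.card ≤ 9 * N.card := by exact_mod_cast R.dn
    linarith
  all_goals clear e1 nB nQ ntr
  · intro p q r hp hqp hrq hsr hsum
    have := u0 p
    have := u1 q (by linarith)
    have := u1 r (by linarith)
    linarith
  · intro p q r t hp hqp hrq htr hst hsum
    by_cases hp1 : p ≤ σ/2
    · have := u1 p (by linarith)
      have := u1 q (by linarith)
      have := u1 r (by linarith)
      have := u1 t (by linarith)
      linarith
    · have := u0 p
      have := u5 r (by linarith)
      have := u5 t (by linarith)
      rcases hH with ⟨h1, h2⟩ | ⟨h1, h2⟩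
      · have := u1 q (by linarith)
        linarith
      · have := u4 q (by linarith) (by linarith)
        linarith
  · intro p q r t u _ _ _ _ _ _ _
    have := u5 t (by linarith)
    have := u5 u (by linarith)
    by_cases hp : p ≤ 1/4
    · rcases hH with ⟨h1, h2⟩ | ⟨h1, h2⟩
      · have := u1 p (by linarith)
        have := u1 q (by linarith)
        have := u4 r (by linarith) (by linarith)
        linarith
      · have := u4 p (by linarith) (by linarith)
        have := u4 q (by linarith) (by linarith)
        have := u4 r (by linarith) (by linarith)
        linarith
    · have := u1 p (by linarith)
      have := u5 q (by linarith)
      have := u5 r (by linarith)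
      linarith
  · intro k hk p q hLk hqp hsq hsum
    rcases hL k hk hLk with ⟨⟨f, hf, hfv⟩, h1⟩ | h3 | ⟨x, hx, hx2 | ⟨hx1, hx2, hx3⟩⟩
    · have := l2 _ hfv
      have := R.erase_one ω hf (fun f _ => le_trans (by norm_num) (l0 (v f)))
      have := u4 q (by linarith) (by linarith)
      rcases hH with ⟨h5, h2⟩ | ⟨h5, h2⟩
      · have := u4 p (by linarith) (by linarith)
        linarith
      · have := u2 p (by linarith)
        linarith
    · have hp := u1 p (by linarith)
      have hq := u1 q (by linarith)
      have := R.erase_wt hk ω h3 (fun f _ => l0 (v f)) (by norm_num)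
      linarith
    · have hp := u1 p (by linarith)
      have hq := u1 q (by linarith)
      rw [hx, sum_singleton]
      have := l3 _ hx2
      linarith
    · have hp := u5 p (by linarith)
      have hq := u5 q (by linarith)
      rw [hx, sum_singleton]
      have := l0 (v x)
      linarith
  · intro p q hqp hsq hsum
    have hp := u1 p (by linarith)
    have hq := u1 q (by linarith)
    linarith

theorem contra (R : FRed v V c g h D N a) : False := by
  obtain ⟨σ, hσ⟩ : ∃ σ, σ = 1 - v c := ⟨_, rfl⟩
  by_cases hT : NoT v V h N a σ
  · by_cases hQ : NoQ v V h N a σ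
    · by_cases hs5 : v c ≤ 1/5
      · exact R.caseBN hσ hs5 hT hQ
      · exact R.caseAN hσ (not_le.1 hs5) hT hQ
    · obtain ⟨hs4, τ, ht1, ht2, ht3, hL, hM⟩ := R.Qreg hσ hQ
      by_cases hs5 : v c ≤ 1/5
      · exact R.caseBQ hσ hs5 ht1 ht2 ht3 hL hM
      · exact R.caseAQ hσ (not_le.1 hs5) hs4 ht2 hL hM
  · exact R.caseT hσ hT

end FRed

theorem FInst.contra {v : ℕ → ℚ} {V : Finset ℕ} {c : ℕ} {g h : ℕ → ℕ} {D N : Finset ℕ}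
    (I : FInst v V c g h D N) (hdn : 11 * D.card ≤ 9 * N.card) : False := by
  refine FInst.min_reduce ?_ D.card v V c g h D N I hdn rfl
  intro v V c g h D N I hdn h3
  obtain ⟨a, R⟩ := I.toRed hdn h3
  exact R.contra


theorem greedy_bundle {ι : Type*} (u : ι → ℕ → ℚ) (μ : ι → ℚ) (A : Finset ι) (hA : A.Nonempty)
    (hμ : ∀ i, 0 ≤ μ i) (I : Finset ℕ) :
    ∃ S ⊆ I, (∃ i ∈ A, ∑ f ∈ S, u i f ≤ μ i) ∧
      ∀ e ∈ I, e ∉ S → ∀ i ∈ A, μ i < ∑ f ∈ S.filter (fun f => f < e), u i f + u i e := by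
  induction I using Finset.induction_on_max with
  | empty =>
    obtain ⟨i, hi⟩ := hA
    exact ⟨∅, subset_rfl, ⟨i, hi, by simpa using hμ i⟩, by simp⟩
  | insert x I hx ih =>
    obtain ⟨S, hS, hacc, hrej⟩ := ih
    have hxS : x ∉ S := fun h => lt_irrefl _ (hx x (hS h))
    by_cases hc : ∃ i ∈ A, ∑ f ∈ S, u i f + u i x ≤ μ i
    · obtain ⟨i, hi, hle⟩ := hc
      refine ⟨insert x S, insert_subset_insert _ hS, ⟨i, hi, ?_⟩, ?_⟩
      · rw [sum_insert hxS]; linarith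
      · intro e he heS j hj
        rw [mem_insert, not_or] at heS
        have heI : e ∈ I := (mem_insert.1 he).resolve_left heS.1
        have := hrej e heI heS.2 j hj
        rw [filter_insert, if_neg (by have := hx e heI; omega)]
        exact this
    · refine ⟨S, hS.trans (subset_insert _ _), hacc, ?_⟩
      intro e he heS j hj
      rcases mem_insert.1 he with rfl | heI
      · rw [filter_true_of_mem (fun f hf => hx f (hS hf))]
        push Not at hc
        exact hc j hj
      · exact hrej e heI heS j hj

theorem hffd {ι : Type*} [DecidableEq ι] [Nonempty ι] (u : ι → ℕ → ℚ) (μ : ι → ℚ)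
    (hμ : ∀ i, 0 ≤ μ i) (a : ℕ) : ∀ (A : Finset ι) (I : Finset ℕ), A.card = a →
    (∃ b : ℕ → ι, (∀ e ∈ I, b e ∈ A) ∧ ∀ i ∈ A, ∑ e ∈ I.filter (fun e => b e = i), u i e ≤ μ i) ∨
    ∃ ω, (A.Nonempty → ω ∈ A) ∧ ∃ c ∈ I, ∃ h : ℕ → ℕ, h c = a ∧ (∀ e ∈ I, e < c → h e < a) ∧
      ∀ k < a, ∀ e ∈ I, e ≤ c → k < h e →
        μ ω < ∑ f ∈ I.filter (fun f => h f = k ∧ f < e), u ω f + u ω e := by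
  induction a with
  | zero =>
    intro A I hA
    rw [card_eq_zero] at hA
    subst hA
    rcases I.eq_empty_or_nonempty with rfl | hI
    · left
      exact ⟨fun _ => Classical.arbitrary ι, by simp, by simp⟩
    · right
      refine ⟨Classical.arbitrary ι, by simp, I.min' hI, I.min'_mem hI, fun _ => 0, rfl, ?_, by simp⟩
      intro e he hlt
      exact absurd (I.min'_le e he) (not_le.2 hlt)
  | succ a ih =>
    intro A I hA
    have hAne : A.Nonempty := card_pos.1 (by omega)
    obtain ⟨S, hS, ⟨i, hi, hacc⟩, hrej⟩ := greedy_bundle u μ A hAne hμ I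
    have hcard : (A.erase i).card = a := by rw [card_erase_of_mem hi]; omega
    rcases ih (A.erase i) (I \ S) hcard with ⟨b, hb, hsum⟩ | ⟨ω, hω, c, hcI, h, hc, hlt, hff⟩
    · left
      refine ⟨fun e => if e ∈ S then i else b e, ?_, ?_⟩
      · intro e he
        by_cases heS : e ∈ S
        · simp [heS, hi]
        · simp only [heS, if_false]
          exact mem_of_mem_erase (hb e (mem_sdiff.2 ⟨he, heS⟩))
      · intro j hj
        by_cases hji : j = i
        · subst hji
          refine le_trans (le_of_eq ?_) hacc
          congr 1
          ext e
          simp only [mem_filter]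
          constructor
          · rintro ⟨he, hbe⟩
            by_contra heS
            simp only [heS, if_false] at hbe
            exact ne_of_mem_erase (hb e (mem_sdiff.2 ⟨he, heS⟩)) hbe
          · intro he
            exact ⟨hS he, by simp [he]⟩
        · refine le_trans (le_of_eq ?_) (hsum j (mem_erase.2 ⟨hji, hj⟩))
          congr 1
          ext e
          simp only [mem_filter, mem_sdiff]
          by_cases heS : e ∈ S
          · simp [heS, Ne.symm hji]
          · simp [heS]
    · right
      rw [mem_sdiff] at hcI
      have key : ∀ ω' ∈ A, (∀ k < a, ∀ e ∈ I \ S, e ≤ c → k < h e →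
        μ ω' < ∑ f ∈ (I \ S).filter (fun f => h f = k ∧ f < e), u ω' f + u ω' e) →
        ∃ ω, (A.Nonempty → ω ∈ A) ∧ ∃ c ∈ I, ∃ h : ℕ → ℕ, h c = a + 1 ∧
          (∀ e ∈ I, e < c → h e < a + 1) ∧
          ∀ k < a + 1, ∀ e ∈ I, e ≤ c → k < h e →
          μ ω < ∑ f ∈ I.filter (fun f => h f = k ∧ f < e), u ω f + u ω e := by
        intro ω' hω' hff'
        refine ⟨ω', fun _ => hω', c, hcI.1, fun e => if e ∈ S then 0 else h e + 1, ?_, ?_, ?_⟩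
        · simp [hcI.2, hc]
        · intro e he hec
          by_cases heS : e ∈ S
          · simp [heS]
          · have := hlt e (mem_sdiff.2 ⟨he, heS⟩) hec
            simp [heS, this]
        · intro k hk e he hec hke
          by_cases heS : e ∈ S
          · simp [heS] at hke
          simp only [heS, if_false] at hke
          rcases k with _ | k
          · have := hrej e he heS ω' hω'
            have heq : I.filter (fun f => (if f ∈ S then 0 else h f + 1) = 0 ∧ f < e)
                = S.filter (fun f => f < e) := by
              ext f
              simp only [mem_filter]
              by_cases hfS : f ∈ S
              · simp [hfS, hS hfS]
              · simp [hfS]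
            rw [heq]; exact this
          · have := hff' k (by omega) e (mem_sdiff.2 ⟨he, heS⟩) hec (by omega)
            have heq : I.filter (fun f => (if f ∈ S then 0 else h f + 1) = k + 1 ∧ f < e)
                = (I \ S).filter (fun f => h f = k ∧ f < e) := by
              ext f
              simp only [mem_filter, mem_sdiff]
              by_cases hfS : f ∈ S
              · simp [hfS]
              · simp [hfS]
            rw [heq]; exact this
      by_cases hne : (A.erase i).Nonempty
      · exact key ω (mem_of_mem_erase (hω hne)) hff
      · rw [not_nonempty_iff_eq_empty] at hne
        rw [hne, card_empty] at hcard
        exact key i hi (fun k hk => by omega)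

theorem exists_sorted {α : Type*} [Nonempty α] (M : Finset α) (w : α → ℚ) :
    ∃ s : ℕ → α, (∀ j < M.card, s j ∈ M) ∧ (∀ i < M.card, ∀ j < M.card, s i = s j → i = j) ∧
      ∀ i j, i ≤ j → j < M.card → w (s j) ≤ w (s i) := by
  classical
  let e := M.equivFin
  let f : Fin M.card → ℚ := fun j => - w (e.symm j)
  let τ := Tuple.sort f
  have hmono : Monotone (f ∘ τ) := Tuple.monotone_sort f
  refine ⟨fun j => if hj : j < M.card then (e.symm (τ ⟨j, hj⟩) : α) else Classical.arbitrary α,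
    ?_, ?_, ?_⟩
  · intro j hj
    simp only [hj, dif_pos]
    exact (e.symm (τ ⟨j, hj⟩)).2
  · intro i hi j hj hij
    simp only [hi, hj, dif_pos] at hij
    have := τ.injective (e.symm.injective (Subtype.ext hij))
    simpa using this
  · intro i j hij hj
    have hi : i < M.card := by omega
    simp only [hi, hj, dif_pos]
    have := hmono (show (⟨i, hi⟩ : Fin M.card) ≤ ⟨j, hj⟩ from hij)
    simp only [Function.comp, f] at this
    linarith

/-- Hall step: from the ordered instance back to the original one. -/
theorem ido_pull {α ι : Type*} [DecidableEq α] (M : Finset α) (v : ι → α → ℚ)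
    (s : ι → ℕ → α) (hs : ∀ i, ∀ j < M.card, s i j ∈ M)
    (hinj : ∀ i, ∀ j < M.card, ∀ k < M.card, s i j = s i k → j = k)
    (hanti : ∀ i j k, j ≤ k → k < M.card → v i (s i k) ≤ v i (s i j)) (b : ℕ → ι) :
    ∃ π : ℕ → α, (∀ j < M.card, ∀ k < M.card, π j = π k → j = k) ∧ (∀ j < M.card, π j ∈ M) ∧
      (∀ c ∈ M, ∃ j < M.card, π j = c) ∧ ∀ j < M.card, v (b j) (π j) ≤ v (b j) (s (b j) j) := by
  classical
  let t : Fin M.card → Finset α := fun j => M.filter (fun c => v (b j) c ≤ v (b j) (s (b j) j))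
  have hall : ∀ X : Finset (Fin M.card), X.card ≤ (X.biUnion t).card := by
    intro X
    rcases X.eq_empty_or_nonempty with rfl | hX
    · simp
    have hmin := X.min'_mem hX
    set j0 := X.min' hX with hj0
    have h1 : X.card ≤ (t j0).card := by
      refine Finset.card_le_card_of_injOn (fun j => s (b j0) j) ?_ ?_
      · intro j hj
        have : j0 ≤ j := X.min'_le j hj
        simp only [t, coe_filter, Set.mem_ofPred_eq]
        exact ⟨hs _ _ j.2, hanti _ _ _ this j.2⟩
      · intro j _ k _ hjk
        exact Fin.ext (hinj _ _ j.2 _ k.2 hjk)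
    exact h1.trans (card_le_card (subset_biUnion_of_mem t hmin))
  obtain ⟨p, hp, hpt⟩ := (Finset.all_card_le_biUnion_card_iff_exists_injective t).1 hall
  have hpM : ∀ j, p j ∈ M := fun j => (mem_filter.1 (hpt j)).1
  have himg : univ.image p = M := by
    refine eq_of_subset_of_card_le ?_ ?_
    · intro c hc
      obtain ⟨j, _, rfl⟩ := mem_image.1 hc
      exact hpM j
    · rw [card_image_of_injective _ hp]; simp
  rcases Nat.eq_zero_or_pos M.card with h0 | h0
  · refine ⟨fun j => s (b j) j, ?_, ?_, ?_, ?_⟩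
    · intro j hj; omega
    · intro j hj; omega
    · intro c hc
      rw [card_eq_zero] at h0
      simp [h0] at hc
    · intro j hj; omega
  refine ⟨fun j => if hj : j < M.card then p ⟨j, hj⟩ else p ⟨0, h0⟩, ?_, ?_, ?_, ?_⟩
  · intro j hj k hk h
    simp only [hj, hk, dif_pos] at h
    simpa using hp h
  · intro j hj
    simp only [hj, dif_pos]; exact hpM _
  · intro c hc
    rw [← himg] at hc
    obtain ⟨j, _, rfl⟩ := mem_image.1 hc
    exact ⟨j, j.2, by simp⟩
  · intro j hj
    simp only [hj, dif_pos]
    exact (mem_filter.1 (hpt ⟨j, hj⟩)).2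

theorem exists_share (v : α → ℚ) (M : Finset α) (d : ℕ) (hd : 0 < d) :
    ∃ μ : ℚ, (∃ P : Fin d → Finset α, IsPartitionInto M d P ∧ ∀ j, bundleCost v (P j) ≤ μ) ∧
      ∀ μ', IsMMS v M d μ' → μ ≤ μ' := by
  by_cases h : ∃ μ, IsMMS v M d μ
  · obtain ⟨μ, h1, h2⟩ := h
    refine ⟨μ, h1, ?_⟩
    rintro μ' ⟨⟨P, hP, hle⟩, _⟩
    obtain ⟨j, hj⟩ := h2 P hP
    exact hj.trans (hle j)
  · let P : Fin d → Finset α := fun j => if j = ⟨0, hd⟩ then M else ∅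
    have hP : IsPartitionInto M d P := by
      refine ⟨?_, ?_, ?_⟩
      · intro j; simp only [P]; split_ifs <;> simp
      · intro j k hjk
        simp only [P]
        split_ifs with h1 h2
        · exact absurd (h1.trans h2.symm) hjk
        all_goals simp
      · intro c hc
        exact ⟨⟨0, hd⟩, by simpa [P] using hc⟩
    refine ⟨∑ j, |bundleCost v (P j)|, ⟨P, hP, ?_⟩, ?_⟩
    · intro j
      exact (le_abs_self _).trans
        (Finset.single_le_sum (f := fun j => |bundleCost v (P j)|) (fun i _ => abs_nonneg _)
          (mem_univ j))
    · intro μ' hμ'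
      exact absurd ⟨μ', hμ'⟩ h

theorem no_fail (n d : ℕ) (hdn : 11 * d ≤ 9 * n) (M : Finset α) (v : α → ℚ)
    (hv : ∀ c ∈ M, 0 < v c) (μ : ℚ) (P : Fin d → Finset α) (hP : IsPartitionInto M d P)
    (hPμ : ∀ j, bundleCost v (P j) ≤ μ) (s : ℕ → α) (hs : ∀ j < M.card, s j ∈ M)
    (hinj : ∀ j < M.card, ∀ k < M.card, s j = s k → j = k)
    (hanti : ∀ j k, j ≤ k → k < M.card → v (s k) ≤ v (s j))
    (c : ℕ) (hcI : c ∈ range M.card) (h : ℕ → ℕ) (hc : h c = n)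
    (hlt : ∀ e ∈ range M.card, e < c → h e < n)
    (hff : ∀ k < n, ∀ e ∈ range M.card, e ≤ c → k < h e →
        μ < ∑ f ∈ (range M.card).filter (fun f => h f = k ∧ f < e), v (s f) + v (s e)) : False := by
  have hcM : c < M.card := mem_range.1 hcI
  have hg : ∀ e, ∃ l, e < M.card → ∃ hl : l < d, s e ∈ P ⟨l, hl⟩ := by
    intro e
    by_cases he : e < M.card
    · obtain ⟨j, hj⟩ := hP.2.2 (s e) (hs e he)
      exact ⟨j, fun _ => ⟨j.2, hj⟩⟩
    · exact ⟨0, fun h => absurd h he⟩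
  choose g hg using hg
  have hsum : ∀ l : Fin d, ∑ e ∈ (range M.card).filter (fun e => g e = l), v (s e) ≤ μ := by
    intro l
    refine le_trans ?_ (hPμ l)
    unfold bundleCost
    rw [← Finset.sum_image (s := (range M.card).filter (fun e => g e = l)) (g := s) (f := v)]
    · refine sum_le_sum_of_subset_of_nonneg ?_ (fun x hx _ => (hv x (hP.1 l hx)).le)
      intro x hx
      obtain ⟨e, he, rfl⟩ := mem_image.1 hx
      rw [mem_filter, mem_range] at he
      obtain ⟨hl, hmem⟩ := hg e he.1
      have : (⟨g e, hl⟩ : Fin d) = l := Fin.ext he.2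
      rwa [this] at hmem
    · intro e he f hf hef
      simp only [coe_filter, mem_range, Set.mem_ofPred_eq] at he hf
      exact hinj e he.1 f hf.1 hef
  have hpos : ∀ e < M.card, 0 < v (s e) := fun e he => hv _ (hs e he)
  have hμ : 0 < μ := by
    obtain ⟨hl, _⟩ := hg c hcM
    refine lt_of_lt_of_le (hpos c hcM) (le_trans ?_ (hsum ⟨g c, hl⟩))
    exact Finset.single_le_sum (f := fun e => v (s e))
      (fun i hi => (hpos i (mem_range.1 (mem_filter.1 hi).1)).le) (by simp [hcM])
  have I : FInst (fun e => v (s e) / μ) (range (c + 1)) c g h (range d) (range n) := by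
    refine ⟨by simp, ?_, ?_, ?_, ?_, ?_, ?_, ?_, ?_⟩
    · intro e he; rw [mem_range] at he; omega
    · intro e he f hf hef
      rw [mem_range] at hf
      exact div_le_div_of_nonneg_right (hanti e f hef (by omega)) hμ.le
    · exact div_pos (hpos c hcM) hμ
    · intro e he
      rw [mem_range] at he
      obtain ⟨hl, _⟩ := hg e (by omega)
      exact mem_range.2 hl
    · intro l hl
      rw [mem_range] at hl
      rw [← sum_div, div_le_one hμ]
      refine le_trans ?_ (hsum ⟨l, hl⟩)
      refine sum_le_sum_of_subset_of_nonneg ?_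
        (fun x hx _ => (hpos x (mem_range.1 (mem_filter.1 hx).1)).le)
      exact filter_subset_filter _ (range_subset_range.2 (by omega))
    · intro e he hec
      rw [mem_range] at he
      exact mem_range.2 (hlt e (mem_range.2 (by omega)) (by omega))
    · intro k hk
      rw [mem_range] at hk; omega
    · intro k hk e he hke
      rw [mem_range] at he hk
      have := hff k hk e (mem_range.2 (by omega)) (by omega) hke
      have heq : (range M.card).filter (fun f => h f = k ∧ f < e)
          = (range (c + 1)).filter (fun f => h f = k ∧ f < e) := by
        ext f
        simp only [mem_filter, mem_range]
        constructor
        · rintro ⟨_, h1, h2⟩; exact ⟨by omega, h1, h2⟩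
        · rintro ⟨_, h1, h2⟩; exact ⟨by omega, h1, h2⟩
      rw [heq] at this
      rw [← sum_div, ← add_div, one_lt_div hμ]
      exact this
  exact I.contra (by simpa using hdn)

/-- existence of 1-out-of-⌊9n/11⌋ MMS allocations for chores. -/
theorem exists_one_out_of_9n11_mms_allocation
    (n : ℕ) (hn : 2 ≤ n) (M : Finset α)
    (v : Fin n → α → ℚ) (hv : ∀ i, ∀ c ∈ M, 0 < v i c) :
    ∃ A : Fin n → Finset α, IsPartitionInto M n A ∧
      ∀ i, ∀ μ : ℚ, IsMMS (v i) M (9 * n / 11) μ → bundleCost (v i) (A i) ≤ μ := by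
  have hd : 0 < 9 * n / 11 := by omega
  have hdn : 11 * (9 * n / 11) ≤ 9 * n := by omega
  generalize 9 * n / 11 = d at hd hdn
  have hshare := fun i => exists_share (v i) M d hd
  choose μ hμP hμle using hshare
  choose P hP hPμ using hμP
  suffices hsuff : ∃ A : Fin n → Finset α, IsPartitionInto M n A ∧
      ∀ i, bundleCost (v i) (A i) ≤ μ i by
    obtain ⟨A, hA, hle⟩ := hsuff
    exact ⟨A, hA, fun i μ' h => (hle i).trans (hμle i μ' h)⟩
  have hμ0 : ∀ i, 0 ≤ μ i := fun i =>
    le_trans (sum_nonneg fun c hc => (hv i c ((hP i).1 ⟨0, hd⟩ hc)).le) (hPμ i ⟨0, hd⟩)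
  rcases M.eq_empty_or_nonempty with rfl | hM
  · refine ⟨fun _ => ∅, ⟨by simp, by simp, by simp⟩, ?_⟩
    intro i
    simpa [bundleCost] using hμ0 i
  haveI : Nonempty α := ⟨hM.choose⟩
  haveI : Nonempty (Fin n) := ⟨⟨0, by omega⟩⟩
  have hsort := fun i => exists_sorted M (v i)
  choose s hs hinj hanti using hsort
  rcases hffd (fun i j => v i (s i j)) μ hμ0 n univ (range M.card) (by simp) with
    ⟨b, _, hb⟩ | ⟨ω, _, c, hcI, h, hc, hlt, hff⟩
  · obtain ⟨π, hπinj, hπM, hπsurj, hπle⟩ := ido_pull M v s hs hinj hanti b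
    refine ⟨fun i => ((range M.card).filter (fun e => b e = i)).image π, ⟨?_, ?_, ?_⟩, ?_⟩
    · intro i x hx
      obtain ⟨e, he, rfl⟩ := mem_image.1 hx
      exact hπM e (mem_range.1 (mem_filter.1 he).1)
    · intro i j hij
      rw [disjoint_left]
      intro x hx hx'
      obtain ⟨e, he, rfl⟩ := mem_image.1 hx
      obtain ⟨f, hf, hef⟩ := mem_image.1 hx'
      rw [mem_filter, mem_range] at he hf
      have := hπinj f hf.1 e he.1 hef
      subst this
      exact hij (he.2.symm.trans hf.2)
    · intro x hx
      obtain ⟨j, hj, rfl⟩ := hπsurj x hx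
      exact ⟨b j, mem_image.2 ⟨j, by simp [hj], rfl⟩⟩
    · intro i
      unfold bundleCost
      rw [Finset.sum_image]
      · refine le_trans (sum_le_sum ?_) (hb i (mem_univ i))
        intro e he
        rw [mem_filter, mem_range] at he
        have := hπle e he.1
        rwa [he.2] at this
      · intro e he f hf hef
        simp only [coe_filter, mem_range, Set.mem_ofPred_eq] at he hf
        exact hπinj e he.1 f hf.1 hef
  · exact (no_fail n d hdn M (v ω) (hv ω) (μ ω) (P ω) (hP ω) (hPμ ω) (s ω) (hs ω) (hinj ω)
      (hanti ω) c hcI h hc hlt hff).elim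
end

section
/- Let t be a positive rational number and let S be a finite set of chores with positive rational costs v(c) such that: (1) every two values among {v(c) : c ∈ S} ∪ {t} are comparable under divisibility (the smaller divides the larger with positive integer quotient); (2) v(c) ≤ t for every c ∈ S; and (3) Σ_{c∈S} v(c) ≥ t. Then there exists a subset S′ ⊆ S with Σ_{c∈S′} v(c) = t. -/
open Finset

variable {α : Type*} [DecidableEq α]

/-- in a set of chores whose costs, together with `t`, are pairwise comparable
under divisibility, are each at most `t`, and sum to at least `t`, some subset has cost
exactly `t`. -/
theorem exists_subset_sum_eq_of_divisible
    (S : Finset α) (v : α → ℚ) (t : ℚ) (ht : 0 < t)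
    (hpos : ∀ c ∈ S, 0 < v c)
    (hdiv : ∀ x ∈ insert t (S.image v), ∀ y ∈ insert t (S.image v),
      x ≤ y → ∃ q : ℕ, 0 < q ∧ y = q * x)
    (hle : ∀ c ∈ S, v c ≤ t)
    (hsum : t ≤ ∑ c ∈ S, v c) :
    ∃ S' ⊆ S, ∑ c ∈ S', v c = t := by
  induction S using Finset.strongInduction with
  | H S ih =>
  have hne : S.Nonempty := by
    rw [Finset.nonempty_iff_ne_empty]
    rintro rfl
    simp at hsum
    linarith
  obtain ⟨m, hm, hmin⟩ := S.exists_min_image v hne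
  by_cases h : t ≤ ∑ c ∈ S.erase m, v c
  · have hsub := Finset.erase_subset m S
    have hins : insert t ((S.erase m).image v) ⊆ insert t (S.image v) :=
      Finset.insert_subset_insert _ (Finset.image_subset_image hsub)
    obtain ⟨S', h1, h2⟩ := ih (S.erase m) (Finset.erase_ssubset hm)
      (fun c hc => hpos c (hsub hc))
      (fun x hx y hy => hdiv x (hins hx) y (hins hy))
      (fun c hc => hle c (hsub hc)) h
    exact ⟨S', h1.trans hsub, h2⟩
  · refine ⟨S, Finset.Subset.refl S, ?_⟩
    push Not at h
    have hmm : v m ∈ insert t (S.image v) :=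
      Finset.mem_insert_of_mem (Finset.mem_image_of_mem v hm)
    have key : ∀ T ⊆ S, ∃ k : ℕ, ∑ c ∈ T, v c = k * v m := by
      intro T
      induction T using Finset.induction_on with
      | empty => intro _; exact ⟨0, by simp⟩
      | insert a T ha ihT =>
        intro hT
        obtain ⟨k, hk⟩ := ihT ((Finset.subset_insert a T).trans hT)
        have haS : a ∈ S := hT (Finset.mem_insert_self a T)
        obtain ⟨q, _, hq⟩ := hdiv _ hmm (v a)
          (Finset.mem_insert_of_mem (Finset.mem_image_of_mem v haS)) (hmin a haS)
        refine ⟨q + k, ?_⟩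
        rw [Finset.sum_insert ha, hk, hq]
        push_cast
        ring
    obtain ⟨k, hk⟩ := key _ (Finset.erase_subset m S)
    obtain ⟨q, _, hq⟩ := hdiv _ hmm t (Finset.mem_insert_self _ _) (hle m hm)
    have hs := Finset.add_sum_erase S v hm
    have hp := hpos m hm
    rw [← hs, hk] at hsum ⊢
    rw [hk] at h
    have h1 : k < q := by
      have : (k : ℚ) < q := by
        rw [hq] at h
        exact lt_of_mul_lt_mul_right h hp.le
      exact_mod_cast this
    have h2 : ((k : ℚ) + 1) ≤ q := by exact_mod_cast h1
    nlinarith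
end

section
/- For every chore instance with n agents in which every agent's cost function v_i is factored, there exists an allocation, i.e., a partition (A_1,…,A_n) of M, such that v_i(A_i) ≤ MMS^n(v_i, M) for every agent i. (MMS allocations exist for factored instances.) -/
open Finset

variable {α : Type*} [DecidableEq α]

/-- `v` is factored on `M`: any two cost values are comparable under divisibility,
the smaller dividing the larger with a positive integer quotient. -/
def Factored (v : α → ℚ) (M : Finset α) : Prop :=
  ∀ c ∈ M, ∀ c' ∈ M, v c ≤ v c' → ∃ q : ℕ, 0 < q ∧ v c' = q * v c

def Pack {m : ℕ} (w : Fin m → ℚ) (μ : ℚ) : ℕ → Finset (Fin m) → Prop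
  | 0, S => S = ∅
  | k + 1, S => ∃ T, T ⊆ S ∧ ∑ p ∈ T, w p ≤ μ ∧ Pack w μ k (S \ T)

theorem Pack.mono {m : ℕ} {w : Fin m → ℚ} {μ : ℚ} (hw : ∀ p, 0 < w p) :
    ∀ (k : ℕ) (S S' : Finset (Fin m)), S' ⊆ S → Pack w μ k S → Pack w μ k S'
  | 0, S, S', h, hP => by
    simp only [Pack] at hP ⊢
    subst hP
    exact Finset.subset_empty.mp h
  | k + 1, S, S', h, ⟨T, hT, hc, hP⟩ => by
    refine ⟨T ∩ S', Finset.inter_subset_right, ?_, ?_⟩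
    · exact (Finset.sum_le_sum_of_subset_of_nonneg Finset.inter_subset_left
        (fun p _ _ => (hw p).le)).trans hc
    · refine Pack.mono hw k _ _ ?_ hP
      intro p hp
      simp only [Finset.mem_sdiff, Finset.mem_inter] at hp ⊢
      exact ⟨h hp.1, fun h' => hp.2 ⟨h', hp.1⟩⟩

theorem Pack.replace {m : ℕ} {w : Fin m → ℚ} {μ : ℚ} (hw : ∀ p, 0 < w p)
    (x : Fin m) (R : Finset (Fin m)) (hR : ∑ p ∈ R, w p ≤ w x) :
    ∀ (k : ℕ) (S : Finset (Fin m)), x ∈ S → Disjoint R S → Pack w μ k S →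
      Pack w μ k (S.erase x ∪ R)
  | 0, S, hx, _, hP => by
    simp only [Pack] at hP
    subst hP
    simp at hx
  | k + 1, S, hx, hd, ⟨T, hT, hc, hP⟩ => by
    have hdR : ∀ a, a ∈ R → a ∉ S := fun a ha => Finset.disjoint_left.mp hd ha
    by_cases hxT : x ∈ T
    · refine ⟨T.erase x ∪ R, ?_, ?_, ?_⟩
      · exact Finset.union_subset_union (Finset.erase_subset_erase _ hT) (Finset.Subset.refl _)
      · have h1 := Finset.sum_union_inter (s₁ := T.erase x) (s₂ := R) (f := w)
        have h2 : 0 ≤ ∑ p ∈ T.erase x ∩ R, w p := Finset.sum_nonneg (fun p _ => (hw p).le)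
        have h3 := Finset.sum_erase_add T w hxT
        linarith
      · refine Pack.mono hw k _ _ ?_ hP
        intro p hp
        simp only [Finset.mem_sdiff, Finset.mem_union, Finset.mem_erase] at hp ⊢
        tauto
    · refine ⟨T, ?_, hc, ?_⟩
      · intro p hp
        simp only [Finset.mem_union, Finset.mem_erase]
        exact Or.inl ⟨fun h => hxT (h ▸ hp), hT hp⟩
      · have := Pack.replace hw x R hR k (S \ T) (by simp [hx, hxT])
          (hd.mono_right Finset.sdiff_subset) hP
        refine Pack.mono hw k _ _ ?_ this
        intro p hp
        simp only [Finset.mem_sdiff, Finset.mem_union, Finset.mem_erase] at hp ⊢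
        tauto

theorem exact_subset {m : ℕ} {w : Fin m → ℚ} (hw : ∀ p, 0 < w p) (hmono : Monotone w)
    (hf : ∀ p q, w p ≤ w q → ∃ t : ℕ, 0 < t ∧ w q = t * w p) (x : Fin m) :
    ∀ (N : ℕ) (R : Finset (Fin m)), R.card = N → (∀ p ∈ R, p < x) → w x ≤ ∑ p ∈ R, w p →
      ∃ R', R' ⊆ R ∧ ∑ p ∈ R', w p = w x := by
  intro N
  induction N with
  | zero =>
    intro R hN _ hs
    rw [Finset.card_eq_zero] at hN
    subst hN
    simp at hs
    exact absurd (hw x) (not_lt.mpr hs)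
  | succ N ih =>
    intro R hN hlt hs
    have hne : R.Nonempty := Finset.card_pos.mp (by omega)
    set r := R.min' hne with hr
    have hrR : r ∈ R := Finset.min'_mem _ _
    by_cases hc : w x ≤ ∑ p ∈ R.erase r, w p
    · obtain ⟨R', h1, h2⟩ := ih (R.erase r) (by rw [Finset.card_erase_of_mem hrR]; omega)
        (fun p hp => hlt p (Finset.mem_of_mem_erase hp)) hc
      exact ⟨R', h1.trans (Finset.erase_subset _ _), h2⟩
    · push Not at hc
      refine ⟨R, Finset.Subset.refl _, ?_⟩
      have h3 := Finset.sum_erase_add R w hrR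
      have hmul : ∀ p, ∃ t : ℕ, r ≤ p → w p = t * w r := by
        intro p
        by_cases h : r ≤ p
        · obtain ⟨t, -, ht⟩ := hf r p (hmono h)
          exact ⟨t, fun _ => ht⟩
        · exact ⟨0, fun h' => absurd h' h⟩
      choose t ht using hmul
      have hx := ht x (hlt r hrR).le
      have hsum : ∑ p ∈ R.erase r, w p = ((∑ p ∈ R.erase r, t p : ℕ) : ℚ) * w r := by
        push_cast
        rw [Finset.sum_mul]
        exact Finset.sum_congr rfl fun p hp =>
          ht p (Finset.min'_le _ _ (Finset.mem_of_mem_erase hp))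
      set s := ∑ p ∈ R.erase r, t p with hsdef
      have hwr := hw r
      have hlt' : s < t x := by
        rw [hx, hsum] at hc
        exact_mod_cast lt_of_mul_lt_mul_right hc hwr.le
      have hle : ((s : ℚ) + 1) ≤ t x := by exact_mod_cast hlt'
      have : ((s : ℚ) + 1) * w r ≤ t x * w r := mul_le_mul_of_nonneg_right hle hwr.le
      apply le_antisymm _ hs
      rw [← h3, hsum, hx]
      linarith

theorem Pack.remove {m : ℕ} {w : Fin m → ℚ} {μ : ℚ} (hw : ∀ p, 0 < w p) (hmono : Monotone w)
    (hf : ∀ p q, w p ≤ w q → ∃ t : ℕ, 0 < t ∧ w q = t * w p) (k : ℕ)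
    (S B : Finset (Fin m)) (hBS : B ⊆ S)
    (hB : ∀ T, T ⊆ S → ∑ p ∈ T, w p ≤ μ → toColex T ≤ toColex B)
    (hP : Pack w μ (k + 1) S) : Pack w μ k (S \ B) := by
  classical
  have hne : (S.powerset.filter
      (fun T => ∑ p ∈ T, w p ≤ μ ∧ Pack w μ k (S \ T))).Nonempty := by
    obtain ⟨T, h1, h2, h3⟩ := hP
    exact ⟨T, by simp [h1, h2, h3]⟩
  obtain ⟨T, hT, hmax⟩ := Finset.exists_max_image _ (fun T => toColex T) hne
  simp only [Finset.mem_filter, Finset.mem_powerset] at hT hmax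
  obtain ⟨hTS, hTc, hTP⟩ := hT
  rcases (hB T hTS hTc).eq_or_lt with h | h
  · have : T = B := by simpa using h
    exact this ▸ hTP
  · obtain ⟨x, hxB, hxT, hx⟩ := Finset.Colex.toColex_lt_toColex_iff_exists_forall_lt.mp h
    have hxST : x ∈ S \ T := by simp [hBS hxB, hxT]
    by_cases hR : ∑ p ∈ T \ B, w p ≤ w x
    · refine Pack.mono hw k _ _ ?_ (Pack.replace hw x (T \ B) hR k _ hxST ?_ hTP)
      · intro p hp
        simp only [Finset.mem_sdiff, Finset.mem_union, Finset.mem_erase] at hp ⊢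
        by_cases hpT : p ∈ T
        · tauto
        · exact Or.inl ⟨fun h => hp.2 (h ▸ hxB), hp.1, hpT⟩
      · exact Finset.disjoint_sdiff.mono_left Finset.sdiff_subset
    · exfalso
      obtain ⟨R, hRs, hRx⟩ := exact_subset hw hmono hf x _ (T \ B) rfl
        (fun p hp => hx p (Finset.mem_sdiff.mp hp).1 (Finset.mem_sdiff.mp hp).2) (not_le.mp hR).le
      have hRT : R ⊆ T := hRs.trans Finset.sdiff_subset
      have hxR : x ∉ T \ R := by simp [hxT]
      have h1 := hmax (insert x (T \ R)) ⟨?_, ?_, ?_⟩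
      · refine absurd h1 (not_le.mpr ?_)
        refine Finset.Colex.toColex_lt_toColex_iff_exists_forall_lt.mpr ⟨x, by simp, hxT, ?_⟩
        intro b hb hb'
        simp only [Finset.mem_insert, Finset.mem_sdiff] at hb'
        have : b ∈ R := by tauto
        have := Finset.mem_sdiff.mp (hRs this)
        exact hx b this.1 this.2
      · intro p hp
        simp only [Finset.mem_insert, Finset.mem_sdiff] at hp
        rcases hp with rfl | hp
        · exact hBS hxB
        · exact hTS hp.1
      · rw [Finset.sum_insert hxR]
        have := Finset.sum_sdiff (f := w) hRT
        linarith
      · refine Pack.mono hw k _ _ ?_ (Pack.replace hw x R hRx.le k _ hxST ?_ hTP)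
        · intro p hp
          simp only [Finset.mem_sdiff, Finset.mem_union, Finset.mem_erase,
            Finset.mem_insert] at hp ⊢
          tauto
        · exact Finset.disjoint_sdiff.mono_left hRT

theorem assign {ι : Type*} [DecidableEq ι] [Nonempty ι] {m : ℕ} (w : ι → Fin m → ℚ) (μ : ι → ℚ)
    (hw : ∀ i p, 0 < w i p) (hmono : ∀ i, Monotone (w i))
    (hf : ∀ i p q, w i p ≤ w i q → ∃ t : ℕ, 0 < t ∧ w i q = t * w i p) :
    ∀ (k : ℕ) (I : Finset ι) (S : Finset (Fin m)), I.card = k →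
      (∀ i ∈ I, Pack (w i) (μ i) k S) → (k = 0 → S = ∅) →
      ∃ f : Fin m → ι, (∀ p ∈ S, f p ∈ I) ∧
        ∀ i ∈ I, ∑ p ∈ S with f p = i, w i p ≤ μ i := by
  intro k
  induction k with
  | zero =>
    intro I S hI _ hS
    have hI : I = ∅ := Finset.card_eq_zero.mp hI
    have hS := hS rfl
    subst hI hS
    exact ⟨fun _ => Classical.arbitrary ι, by simp, by simp⟩
  | succ k ih =>
    intro I S hI hP _
    have hne : (S.powerset.filter (fun T => ∃ i ∈ I, ∑ p ∈ T, w i p ≤ μ i)).Nonempty := by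
      have hIne : I.Nonempty := Finset.card_pos.mp (by omega)
      obtain ⟨i, hi⟩ := hIne
      obtain ⟨T, h1, h2, h3⟩ := hP i hi
      exact ⟨T, by simp only [Finset.mem_filter, Finset.mem_powerset]; exact ⟨h1, i, hi, h2⟩⟩
    obtain ⟨B, hB, hmax⟩ := Finset.exists_max_image _ (fun T => toColex T) hne
    simp only [Finset.mem_filter, Finset.mem_powerset] at hB hmax
    obtain ⟨hBS, i, hi, hBi⟩ := hB
    have key : ∀ j ∈ I, Pack (w j) (μ j) k (S \ B) := fun j hj =>
      Pack.remove (hw j) (hmono j) (hf j) k S B hBS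
        (fun T hT hc => hmax T ⟨hT, j, hj, hc⟩) (hP j hj)
    obtain ⟨f, hf1, hf2⟩ := ih (I.erase i) (S \ B)
      (by rw [Finset.card_erase_of_mem hi]; omega)
      (fun j hj => key j (Finset.mem_of_mem_erase hj))
      (by rintro rfl; exact key i hi)
    refine ⟨fun p => if p ∈ B then i else f p, ?_, ?_⟩
    · intro p hp
      by_cases hpB : p ∈ B
      · simp [hpB, hi]
      · simp only [hpB, if_false]
        exact Finset.mem_of_mem_erase (hf1 p (by simp [hp, hpB]))
    · intro j hj
      by_cases hji : j = i
      · subst hji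
        refine le_trans (le_of_eq (Finset.sum_congr ?_ fun _ _ => rfl)) hBi
        ext p
        simp only [Finset.mem_filter]
        constructor
        · rintro ⟨hp, h⟩
          by_contra hpB
          simp only [hpB, if_false] at h
          exact (Finset.mem_erase.mp (hf1 p (by simp [hp, hpB]))).1 h
        · intro hp
          exact ⟨hBS hp, by simp [hp]⟩
      · refine le_trans (le_of_eq (Finset.sum_congr ?_ fun _ _ => rfl))
          (hf2 j (Finset.mem_erase.mpr ⟨hji, hj⟩))
        ext p
        simp only [Finset.mem_filter, Finset.mem_sdiff]
        by_cases hpB : p ∈ B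
        · simp [hpB, Ne.symm hji]
        · simp [hpB]

theorem Pack.of_cover {m : ℕ} {w : Fin m → ℚ} {μ : ℚ} (hw : ∀ p, 0 < w p) :
    ∀ (d : ℕ) (P : Fin d → Finset (Fin m)) (S : Finset (Fin m)),
      (∀ p ∈ S, ∃ j, p ∈ P j) → (∀ j, ∑ p ∈ P j, w p ≤ μ) → Pack w μ d S := by
  intro d
  induction d with
  | zero =>
    intro P S h _
    refine Finset.eq_empty_of_forall_notMem fun p hp => ?_
    obtain ⟨j, _⟩ := h p hp
    exact j.elim0
  | succ d ih =>
    intro P S h hc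
    refine ⟨P 0 ∩ S, Finset.inter_subset_right, ?_, ih (fun j => P j.succ) _ ?_ fun j => hc _⟩
    · exact (Finset.sum_le_sum_of_subset_of_nonneg Finset.inter_subset_left
        (fun p _ _ => (hw p).le)).trans (hc 0)
    · intro p hp
      simp only [Finset.mem_sdiff, Finset.mem_inter] at hp
      obtain ⟨j, hj⟩ := h p hp.1
      induction j using Fin.cases with
      | zero => exact absurd ⟨hj, hp.1⟩ hp.2
      | succ j => exact ⟨j, hj⟩

theorem exists_threshold (n : ℕ) (hn : 0 < n) (M : Finset α) (v : α → ℚ) :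
    ∃ μ₀ : ℚ, (∃ P : Fin n → Finset α, IsPartitionInto M n P ∧ ∀ j, bundleCost v (P j) ≤ μ₀) ∧
      ∀ μ, IsMMS v M n μ → μ₀ ≤ μ := by
  by_cases h : ∃ μ, IsMMS v M n μ
  · obtain ⟨μ₀, h0⟩ := h
    refine ⟨μ₀, h0.1, fun μ hμ => ?_⟩
    obtain ⟨P, hP, hc⟩ := hμ.1
    obtain ⟨j, hj⟩ := h0.2 P hP
    exact hj.trans (hc j)
  · refine ⟨max (bundleCost v M) 0, ⟨fun j => if j = ⟨0, hn⟩ then M else ∅, ⟨?_, ?_, ?_⟩, ?_⟩,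
      fun μ hμ => absurd ⟨μ, hμ⟩ h⟩
    · intro j
      dsimp only
      split_ifs <;> simp
    · intro j k hjk
      dsimp only
      split_ifs with h1 h2
      · exact absurd (h1.trans h2.symm) hjk
      all_goals simp
    · intro c hc
      exact ⟨⟨0, hn⟩, by simpa using hc⟩
    · intro j
      dsimp only
      split_ifs
      · exact le_max_left _ _
      · simp [bundleCost]

/-- MMS allocations exist for factored chore instances. -/
theorem exists_mms_allocation_factored
    (n : ℕ) (hn : 0 < n) (M : Finset α)
    (v : Fin n → α → ℚ) (hv : ∀ i, ∀ c ∈ M, 0 < v i c)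
    (hfac : ∀ i, Factored (v i) M) :
    ∃ A : Fin n → Finset α, IsPartitionInto M n A ∧
      ∀ i, ∀ μ : ℚ, IsMMS (v i) M n μ → bundleCost (v i) (A i) ≤ μ := by
  have hsort : ∀ i, ∃ σ : Fin M.card ≃ M, Monotone fun p => v i (σ p) := fun i =>
    ⟨(Tuple.sort fun p => v i (M.equivFin.symm p)).trans M.equivFin.symm,
      Tuple.monotone_sort fun p => v i (M.equivFin.symm p)⟩
  choose σ hσ using hsort
  choose μ hμ1 hμ2 using fun i => exists_threshold n hn M (v i)
  have hw : ∀ i p, 0 < v i (σ i p) := fun i p => hv i _ (σ i p).2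
  haveI : Nonempty (Fin n) := ⟨⟨0, hn⟩⟩
  obtain ⟨f, -, hf⟩ := assign (fun i p => v i (σ i p)) μ hw hσ
    (fun i p q h => hfac i _ (σ i p).2 _ (σ i q).2 h) n Finset.univ Finset.univ (by simp)
    (by
      intro i _
      obtain ⟨P, hP, hc⟩ := hμ1 i
      refine Pack.of_cover (hw i) n
        (fun j => Finset.univ.filter fun p => (σ i p : α) ∈ P j) _ ?_ ?_
      · intro p _
        obtain ⟨j, hj⟩ := hP.2.2 _ (σ i p).2
        exact ⟨j, by simpa using hj⟩
      · intro j
        refine le_trans ?_ (hc j)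
        unfold bundleCost
        have hinj : Set.InjOn (fun p => (σ i p : α))
            (Finset.univ.filter fun p => (σ i p : α) ∈ P j : Finset (Fin M.card)) :=
          fun a _ b _ hab => (σ i).injective (Subtype.ext hab)
        rw [← Finset.sum_image (f := fun c => v i c) hinj]
        refine Finset.sum_le_sum_of_subset_of_nonneg ?_ ?_
        · intro c hc
          simp only [Finset.mem_image, Finset.mem_filter] at hc
          obtain ⟨p, hp, rfl⟩ := hc
          exact hp.2
        · intro c hc _
          exact (hv i c (hP.1 j hc)).le)
    (by omega)
  have hall : ∃ h : Fin M.card → M, Function.Injective h ∧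
      ∀ p, h p ∈ (Finset.Iic p).image (σ (f p)) := by
    refine (Finset.all_card_le_biUnion_card_iff_exists_injective _).mp ?_
    intro s
    rcases s.eq_empty_or_nonempty with rfl | hs
    · simp
    · have h1 : s ⊆ Finset.Iic (s.max' hs) := fun p hp => Finset.mem_Iic.mpr (s.le_max' p hp)
      calc s.card ≤ (Finset.Iic (s.max' hs)).card := Finset.card_le_card h1
        _ = ((Finset.Iic (s.max' hs)).image (σ (f (s.max' hs)))).card :=
          (Finset.card_image_of_injective _ (σ _).injective).symm
        _ ≤ _ := Finset.card_le_card
          (Finset.subset_biUnion_of_mem (fun p => (Finset.Iic p).image (σ (f p)))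
            (s.max'_mem hs))
  obtain ⟨h, hinj, hh⟩ := hall
  have hbij : Function.Bijective h :=
    (Fintype.bijective_iff_injective_and_card h).mpr ⟨hinj, by simp⟩
  refine ⟨fun i => (Finset.univ.filter fun p => f p = i).image fun p => (h p : α),
    ⟨?_, ?_, ?_⟩, ?_⟩
  · intro i c hc
    simp only [Finset.mem_image] at hc
    obtain ⟨p, -, rfl⟩ := hc
    exact (h p).2
  · intro i j hij
    rw [Finset.disjoint_left]
    intro c hc hc'
    simp only [Finset.mem_image, Finset.mem_filter, Finset.mem_univ, true_and] at hc hc'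
    obtain ⟨p, hp, rfl⟩ := hc
    obtain ⟨q, hq, hpq⟩ := hc'
    have : q = p := hinj (Subtype.ext hpq)
    subst this
    exact hij (hp.symm.trans hq)
  · intro c hc
    obtain ⟨p, hp⟩ := hbij.2 ⟨c, hc⟩
    exact ⟨f p, Finset.mem_image.mpr ⟨p, by simp, by rw [hp]⟩⟩
  · intro i ν hν
    refine le_trans ?_ ((hf i (Finset.mem_univ i)).trans (hμ2 i ν hν))
    unfold bundleCost
    rw [Finset.sum_image fun a _ b _ hab => hinj (Subtype.ext hab)]
    refine Finset.sum_le_sum fun p hp => ?_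
    have hp : f p = i := by simpa using hp
    subst hp
    obtain ⟨q, hq, hqp⟩ := Finset.mem_image.mp (hh p)
    rw [← hqp]
    exact hσ (f p) (Finset.mem_Iic.mp hq)
end
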